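/- Let r > 0 and let u : ℂ → ℂ be continuously real-differentiable on the open disc D of radius r centered at 0. Let A, B : D → (ℂ →ₗ[ℝ] ℂ) be continuously differentiable maps into the space of ℝ-linear endomorphisms of ℂ, with B(0) = 0, and assume that for all z ∈ D one has ∂u/∂z̄(z) = A(z)(u(z)) + B(z)(∂u/∂z(z)). Then either u vanishes identically on some neighborhood of 0, or there exist a ∈ ℂ ∖ {0} and m ∈ ℕ such that u(z) = a·z^m + o(|z|^m) as z → 0. -/

import Mathlib

open Complex Asymptotics Filter

/-- The Wirtinger derivative `∂f/∂z` of a map `f : ℂ → ℂ`, defined via the real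
Fréchet derivative: `∂f/∂z (z) = (1/2)(Df(z)(1) - i·Df(z)(i))`. -/
noncomputable def wirtingerDeriv (f : ℂ → ℂ) (z : ℂ) : ℂ :=
  (1 / 2) * (fderiv ℝ f z 1 - Complex.I * fderiv ℝ f z Complex.I)

/-- The conjugate Wirtinger derivative `∂f/∂z̄` of a map `f : ℂ → ℂ`, defined via the
real Fréchet derivative: `∂f/∂z̄ (z) = (1/2)(Df(z)(1) + i·Df(z)(i))`. -/
noncomputable def wirtingerDerivBar (f : ℂ → ℂ) (z : ℂ) : ℂ :=
  (1 / 2) * (fderiv ℝ f z 1 + Complex.I * fderiv ℝ f z Complex.I)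

/-- The open left half-plane `Re w < a`. -/
def leftHalfPlane (a : ℝ) : Set ℂ := {w | w.re < a}

/-- The integral of `f` over the vertical segment from `s` to `s + 2πi`. -/
noncomputable def segInt {E : Type*} [NormedAddCommGroup E] [NormedSpace ℝ E]
    (f : ℂ → E) (s : ℝ) : E :=
  ∫ θ in (0 : ℝ)..(2 * Real.pi), f (s + θ * I)

section SegInt

variable {E : Type*} [NormedAddCommGroup E] [NormedSpace ℝ E] {a s : ℝ}

theorem isOpen_leftHalfPlane (a : ℝ) : IsOpen (leftHalfPlane a) :=
  isOpen_lt Complex.continuous_re continuous_const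

theorem mem_leftHalfPlane {w : ℂ} : w ∈ leftHalfPlane a ↔ w.re < a := Iff.rfl

theorem leftHalfPlane_mono {b : ℝ} (h : b ≤ a) : leftHalfPlane b ⊆ leftHalfPlane a :=
  fun _ hw => lt_of_lt_of_le (mem_leftHalfPlane.1 hw) h

theorem seg_mem (h : s < a) (θ : ℝ) : (s + θ * I : ℂ) ∈ leftHalfPlane a := by
  simpa [mem_leftHalfPlane] using h

theorem continuous_seg {X : Type*} [TopologicalSpace X] {f : ℂ → X} (hf : ContinuousOn f (leftHalfPlane a)) (h : s < a) :
    Continuous fun θ : ℝ => f (s + θ * I) :=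
  hf.comp_continuous (by fun_prop) (seg_mem h)

theorem segInt_mono {f g : ℂ → ℝ} (hf : ContinuousOn f (leftHalfPlane a))
    (hg : ContinuousOn g (leftHalfPlane a)) (h : s < a)
    (hfg : ∀ w : ℂ, w.re = s → f w ≤ g w) : segInt f s ≤ segInt g s :=
  intervalIntegral.integral_mono Real.two_pi_pos.le
    ((continuous_seg hf h).intervalIntegrable _ _) ((continuous_seg hg h).intervalIntegrable _ _)
    fun θ => hfg _ (by simp)

theorem segInt_nonneg {f : ℂ → ℝ} (hf : ∀ w : ℂ, w.re = s → 0 ≤ f w) : 0 ≤ segInt f s :=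
  intervalIntegral.integral_nonneg Real.two_pi_pos.le fun θ _ => hf _ (by simp)

theorem segInt_add {f g : ℂ → E} (hf : ContinuousOn f (leftHalfPlane a))
    (hg : ContinuousOn g (leftHalfPlane a)) (h : s < a) :
    segInt (fun w => f w + g w) s = segInt f s + segInt g s :=
  intervalIntegral.integral_add
    ((continuous_seg hf h).intervalIntegrable _ _) ((continuous_seg hg h).intervalIntegrable _ _)

theorem segInt_sub {f g : ℂ → E} (hf : ContinuousOn f (leftHalfPlane a))
    (hg : ContinuousOn g (leftHalfPlane a)) (h : s < a) :
    segInt (fun w => f w - g w) s = segInt f s - segInt g s :=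
  intervalIntegral.integral_sub
    ((continuous_seg hf h).intervalIntegrable _ _) ((continuous_seg hg h).intervalIntegrable _ _)

theorem segInt_const_mul (c : ℝ) (f : ℂ → ℝ) :
    segInt (fun w => c * f w) s = c * segInt f s :=
  intervalIntegral.integral_const_mul _ _

theorem segInt_congr {f g : ℂ → E} (h : ∀ w : ℂ, w.re = s → f w = g w) :
    segInt f s = segInt g s :=
  intervalIntegral.integral_congr fun θ _ => h _ (by simp)

theorem segInt_shift {f : ℂ → E} (hf : ∀ w, f (w + 2 * Real.pi * I) = f w) (h : ℝ) :
    segInt (fun w => f (w + h * I)) s = segInt f s := by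
  have hp : Function.Periodic (fun θ : ℝ => f (s + θ * I)) (2 * Real.pi) := by
    intro θ
    simp only
    rw [← hf (s + θ * I)]
    push_cast
    ring_nf
  have := hp.intervalIntegral_add_eq h 0
  simp only [zero_add] at this
  unfold segInt
  rw [← this, add_comm h, ← zero_add h, ← add_assoc, add_zero,
    ← intervalIntegral.integral_comp_add_right (fun θ : ℝ => f (s + θ * I)) h]
  refine intervalIntegral.integral_congr fun θ _ => ?_
  simp only
  push_cast
  ring_nf

theorem continuousOn_segInt {f : ℂ → E} (hf : ContinuousOn f (leftHalfPlane a)) :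
    ContinuousOn (segInt f) (Set.Iio a) := by
  intro s hs
  obtain ⟨b, hsb, hba⟩ := exists_between (Set.mem_Iio.1 hs)
  have hc : Continuous (fun p : ℝ × ℝ => f ((min p.1 b : ℝ) + p.2 * I)) :=
    hf.comp_continuous (by fun_prop)
      fun p => by simp [mem_leftHalfPlane, hba]
  have := intervalIntegral.continuous_parametric_intervalIntegral_of_continuous'
    (μ := MeasureTheory.volume) (f := fun s θ : ℝ => f ((min s b : ℝ) + θ * I)) hc 0 (2 * Real.pi)
  refine ContinuousAt.continuousWithinAt (this.continuousAt.congr ?_)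
  filter_upwards [Iio_mem_nhds hsb] with t ht
  simp [segInt, min_eq_left (Set.mem_Iio.1 ht).le]

theorem continuousOn_fderiv_apply {f : ℂ → E} (hf : ContDiffOn ℝ 1 f (leftHalfPlane a)) (v : ℂ) :
    ContinuousOn (fun w => fderiv ℝ f w v) (leftHalfPlane a) :=
  (hf.continuousOn_fderiv_of_isOpen (isOpen_leftHalfPlane a) le_rfl).clm_apply continuousOn_const

theorem hasFDerivAt_of_leftHalfPlane {f : ℂ → E} (hf : ContDiffOn ℝ 1 f (leftHalfPlane a)) {w : ℂ}
    (hw : w ∈ leftHalfPlane a) : HasFDerivAt f (fderiv ℝ f w) w :=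
  ((hf.differentiableOn one_ne_zero).differentiableAt
    ((isOpen_leftHalfPlane a).mem_nhds hw)).hasFDerivAt

theorem hasDerivAt_horizontal {f : ℂ → E} (hf : ContDiffOn ℝ 1 f (leftHalfPlane a)) {t : ℝ}
    (ht : t < a) (θ : ℝ) :
    HasDerivAt (fun s : ℝ => f (s + θ * I)) (fderiv ℝ f (t + θ * I) 1) t :=
  (hasFDerivAt_of_leftHalfPlane hf (seg_mem ht θ)).comp_hasDerivAt t
    ((Complex.ofRealCLM.hasDerivAt (x := t)).add_const _)

theorem hasDerivAt_vertical {f : ℂ → E} (hf : ContDiffOn ℝ 1 f (leftHalfPlane a)) {w : ℂ}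
    (hw : w ∈ leftHalfPlane a) (θ : ℝ) :
    HasDerivAt (fun θ : ℝ => f (w + θ * I)) (fderiv ℝ f (w + θ * I) I) θ := by
  have hw' : w + θ * I ∈ leftHalfPlane a := by simpa [mem_leftHalfPlane] using hw
  refine (hasFDerivAt_of_leftHalfPlane hf hw').comp_hasDerivAt θ ?_
  simpa using ((Complex.ofRealCLM.hasDerivAt (x := θ)).mul_const I).const_add w

/-- Continuous functions on the half-plane are bounded on closed boxes. -/
theorem exists_bound_box {X : Type*} [NormedAddCommGroup X] {f : ℂ → X} (hf : ContinuousOn f (leftHalfPlane a)) {b c d e : ℝ}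
    (hc : c < a) : ∃ M, 0 ≤ M ∧ ∀ s ∈ Set.Icc b c, ∀ θ ∈ Set.Icc d e, ‖f (s + θ * I)‖ ≤ M := by
  have hK : IsCompact ((fun p : ℝ × ℝ => (p.1 + p.2 * I : ℂ)) '' (Set.Icc b c ×ˢ Set.Icc d e)) :=
    (isCompact_Icc.prod isCompact_Icc).image (by fun_prop)
  have hsub : (fun p : ℝ × ℝ => (p.1 + p.2 * I : ℂ)) '' (Set.Icc b c ×ˢ Set.Icc d e)
      ⊆ leftHalfPlane a := by
    rintro _ ⟨⟨s, θ⟩, ⟨hs, -⟩, rfl⟩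
    exact seg_mem (lt_of_le_of_lt hs.2 hc) θ
  obtain ⟨M, hM⟩ := hK.exists_bound_of_continuousOn (hf.mono hsub)
  exact ⟨max M 0, le_max_right _ _, fun s hs θ hθ =>
    (hM _ ⟨(s, θ), ⟨hs, hθ⟩, rfl⟩).trans (le_max_left _ _)⟩

theorem hasDerivAt_segInt [CompleteSpace E] {f : ℂ → E} (hf : ContDiffOn ℝ 1 f (leftHalfPlane a))
    (h : s < a) : HasDerivAt (segInt f) (segInt (fun w => fderiv ℝ f w 1) s) s := by
  obtain ⟨b, hsb, hba⟩ := exists_between h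
  obtain ⟨M, -, hM⟩ := exists_bound_box (b := s - 1) (d := 0) (e := 2 * Real.pi)
    (continuousOn_fderiv_apply hf 1) hba
  refine (intervalIntegral.hasDerivAt_integral_of_dominated_loc_of_deriv_le
    (F := fun (s θ : ℝ) => f (s + θ * I)) (F' := fun (s θ : ℝ) => fderiv ℝ f (s + θ * I) 1)
    (μ := MeasureTheory.volume) (bound := fun _ => M) (s := Set.Ioo (s - 1) b)
    (Ioo_mem_nhds (by linarith) hsb) ?_ ((continuous_seg hf.continuousOn h).intervalIntegrable _ _)
    (continuous_seg (continuousOn_fderiv_apply hf 1) h).aestronglyMeasurable ?_ (by simp) ?_).2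
  · filter_upwards [Iio_mem_nhds h] with t ht
    exact (continuous_seg hf.continuousOn ht).aestronglyMeasurable
  · refine Eventually.of_forall fun θ hθ t ht => hM t ⟨ht.1.le, ht.2.le⟩ θ ?_
    rw [Set.uIoc_of_le Real.two_pi_pos.le] at hθ
    exact ⟨hθ.1.le, hθ.2⟩
  · exact Eventually.of_forall fun θ _ t ht => hasDerivAt_horizontal hf (ht.2.trans hba) θ

theorem segInt_fderiv_I [CompleteSpace E] {f : ℂ → E} (hf : ContDiffOn ℝ 1 f (leftHalfPlane a))
    (hper : ∀ w, f (w + 2 * Real.pi * I) = f w) (h : s < a) :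
    segInt (fun w => fderiv ℝ f w I) s = 0 := by
  have hs : (s : ℂ) ∈ leftHalfPlane a := by simpa [mem_leftHalfPlane] using h
  unfold segInt
  rw [intervalIntegral.integral_eq_sub_of_hasDerivAt
    (f := fun θ : ℝ => f (s + θ * I)) (fun θ _ => hasDerivAt_vertical hf hs θ)
    ((continuous_seg (continuousOn_fderiv_apply hf I) h).intervalIntegrable _ _)]
  have := hper s
  simp only [ofReal_mul, ofReal_ofNat, ofReal_zero, zero_mul, add_zero]
  rw [this, sub_self]

theorem fderiv_periodic {f : ℂ → E} {c : ℂ} (hper : ∀ w, f (w + c) = f w) (w : ℂ) :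
    fderiv ℝ f (w + c) = fderiv ℝ f w := by
  rw [← fderiv_comp_add_right]
  congr 1
  funext v
  exact hper v

theorem integral_im_sub {p q dp dq : ℝ → ℂ} {T : ℝ} (hp : ∀ θ, HasDerivAt p (dp θ) θ)
    (hq : ∀ θ, HasDerivAt q (dq θ) θ) (hdp : Continuous dp) (hdq : Continuous dq)
    (hpT : p T = p 0) (hqT : q T = q 0) :
    (∫ θ in (0 : ℝ)..T, (dp θ * (starRingEnd ℂ) (p θ)).im)
      - (∫ θ in (0 : ℝ)..T, (dq θ * (starRingEnd ℂ) (q θ)).im)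
      = ∫ θ in (0 : ℝ)..T, ((dp θ + dq θ) * (starRingEnd ℂ) (p θ - q θ)).im := by
  have hpc : Continuous p := continuous_iff_continuousAt.2 fun θ => (hp θ).continuousAt
  have hqc : Continuous q := continuous_iff_continuousAt.2 fun θ => (hq θ).continuousAt
  have hder : ∀ θ : ℝ, HasDerivAt (fun θ : ℝ => (p θ * (starRingEnd ℂ) (q θ)).im)
      ((dp θ * (starRingEnd ℂ) (q θ)).im - (dq θ * (starRingEnd ℂ) (p θ)).im) θ := by
    intro θ
    have h3 := (Complex.conjCLE.toContinuousLinearMap.hasFDerivAt.comp_hasDerivAt θ (hq θ))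
    have h4 := Complex.imCLM.hasFDerivAt.comp_hasDerivAt θ ((hp θ).mul h3)
    refine h4.congr_deriv ?_
    simp
    ring
  have hzero := intervalIntegral.integral_eq_sub_of_hasDerivAt
    (a := 0) (b := T) (fun θ _ => hder θ)
    ((by fun_prop : Continuous fun θ : ℝ => ((dp θ * (starRingEnd ℂ) (q θ)).im -
      (dq θ * (starRingEnd ℂ) (p θ)).im)).intervalIntegrable _ _)
  rw [hpT, hqT, sub_self] at hzero
  have c1 : Continuous fun θ : ℝ => (dp θ * (starRingEnd ℂ) (p θ)).im := by fun_prop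
  have c2 : Continuous fun θ : ℝ => (dq θ * (starRingEnd ℂ) (q θ)).im := by fun_prop
  have c3 : Continuous fun θ : ℝ => ((dp θ + dq θ) * (starRingEnd ℂ) (p θ - q θ)).im := by fun_prop
  rw [← intervalIntegral.integral_sub (c1.intervalIntegrable _ _) (c2.intervalIntegrable _ _),
    ← sub_eq_zero, ← intervalIntegral.integral_sub ((by exact c1.sub c2 : Continuous fun θ : ℝ =>
      (dp θ * (starRingEnd ℂ) (p θ)).im - (dq θ * (starRingEnd ℂ) (q θ)).im).intervalIntegrable _ _)
    (c3.intervalIntegrable _ _)]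
  refine Eq.trans (intervalIntegral.integral_congr fun θ _ => ?_) hzero
  simp
  ring

theorem segInt_im_sub {U : ℂ → ℂ} (hU : ContDiffOn ℝ 1 U (leftHalfPlane a))
    (hper : ∀ w, U (w + 2 * Real.pi * I) = U w) {t : ℝ} (h : s < a) (ht : t < a) :
    segInt (fun w => (fderiv ℝ U w I * (starRingEnd ℂ) (U w)).im) t
      - segInt (fun w => (fderiv ℝ U w I * (starRingEnd ℂ) (U w)).im) s
      = ∫ θ in (0 : ℝ)..(2 * Real.pi),
        ((fderiv ℝ U (t + θ * I) I + fderiv ℝ U (s + θ * I) I) *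
          (starRingEnd ℂ) (U (t + θ * I) - U (s + θ * I))).im := by
  refine integral_im_sub
    (hasDerivAt_vertical hU (w := t) (by simpa [mem_leftHalfPlane] using ht))
    (hasDerivAt_vertical hU (w := s) (by simpa [mem_leftHalfPlane] using h))
    (continuous_seg (continuousOn_fderiv_apply hU I) ht)
    (continuous_seg (continuousOn_fderiv_apply hU I) h) ?_ ?_
  · simpa using hper t
  · simpa using hper s

/-- The symplectic form `∫ Im (∂_θ U · conj U)` is differentiable for merely `C¹` functions. -/
theorem hasDerivAt_segInt_im {U : ℂ → ℂ} (hU : ContDiffOn ℝ 1 U (leftHalfPlane a))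
    (hper : ∀ w, U (w + 2 * Real.pi * I) = U w) (h : s < a) :
    HasDerivAt (segInt fun w => (fderiv ℝ U w I * (starRingEnd ℂ) (U w)).im)
      (segInt (fun w => 2 * (fderiv ℝ U w I * (starRingEnd ℂ) (fderiv ℝ U w 1)).im) s) s := by
  obtain ⟨b, hsb, hba⟩ := exists_between h
  obtain ⟨M, hM0, hM⟩ := exists_bound_box (b := s - 1) (d := 0) (e := 2 * Real.pi)
    (continuousOn_fderiv_apply hU 1) hba
  obtain ⟨M', hM0', hM'⟩ := exists_bound_box (b := s - 1) (d := 0) (e := 2 * Real.pi)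
    (continuousOn_fderiv_apply hU I) hba
  have hnhds : Set.Icc (s - 1) b ∈ nhds s := Icc_mem_nhds (by linarith) hsb
  have hs_mem : s ∈ Set.Icc (s - 1) b := mem_of_mem_nhds hnhds
  rw [hasDerivAt_iff_tendsto_slope]
  have key : Tendsto (fun t : ℝ => ∫ θ in (0 : ℝ)..(2 * Real.pi),
      ((fderiv ℝ U (t + θ * I) I + fderiv ℝ U (s + θ * I) I) *
        (starRingEnd ℂ) (slope (fun t : ℝ => U (t + θ * I)) s t)).im) (nhdsWithin s {s}ᶜ)
      (nhds (segInt (fun w => 2 * (fderiv ℝ U w I * (starRingEnd ℂ) (fderiv ℝ U w 1)).im) s)) := by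
    refine intervalIntegral.tendsto_integral_filter_of_dominated_convergence
      (fun _ => 2 * M' * M) ?_ ?_ (by simp) ?_
    · filter_upwards [nhdsWithin_le_nhds hnhds] with t ht
      have hta : t < a := ht.2.trans_lt hba
      have hUt := continuous_seg hU.continuousOn hta
      have hUs := continuous_seg hU.continuousOn h
      have hDt := continuous_seg (continuousOn_fderiv_apply hU I) hta
      have hDs := continuous_seg (continuousOn_fderiv_apply hU I) h
      simp only [slope_def_module]
      exact (Complex.continuous_im.comp ((hDt.add hDs).mul (Complex.continuous_conj.comp
        ((hUt.sub hUs).const_smul _)))).aestronglyMeasurable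
    · filter_upwards [nhdsWithin_le_nhds hnhds, self_mem_nhdsWithin] with t ht hts
      refine Eventually.of_forall fun θ hθ => ?_
      rw [Set.uIoc_of_le Real.two_pi_pos.le] at hθ
      have hθ' : θ ∈ Set.Icc 0 (2 * Real.pi) := ⟨hθ.1.le, hθ.2⟩
      refine (Complex.abs_im_le_norm _).trans ?_
      rw [norm_mul, RCLike.norm_conj]
      have h1 : ‖fderiv ℝ U (t + θ * I) I + fderiv ℝ U (s + θ * I) I‖ ≤ 2 * M' := by
        refine (norm_add_le _ _).trans ?_
        linarith [hM' t ht θ hθ', hM' s hs_mem θ hθ']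
      have h2 : ‖slope (fun t : ℝ => U (t + θ * I)) s t‖ ≤ M := by
        have := (convex_Icc (s - 1) b).norm_image_sub_le_of_norm_hasDerivWithin_le
          (f := fun t : ℝ => U (t + θ * I)) (C := M)
          (fun x hx => (hasDerivAt_horizontal hU (hx.2.trans_lt hba) θ).hasDerivWithinAt)
          (fun x hx => hM x hx θ hθ') hs_mem ht
        rw [slope_def_module, norm_smul, norm_inv]
        rw [inv_mul_le_iff₀ (norm_pos_iff.2 (sub_ne_zero.2 hts))]
        linarith
      exact mul_le_mul h1 h2 (norm_nonneg _) (by positivity)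
    · refine Eventually.of_forall fun θ _ => ?_
      have h1 : Tendsto (fun t : ℝ => fderiv ℝ U (t + θ * I) I) (nhdsWithin s {s}ᶜ)
          (nhds (fderiv ℝ U (s + θ * I) I)) := by
        have hc : ContinuousAt (fun w => fderiv ℝ U w I) (s + θ * I) :=
          (continuousOn_fderiv_apply hU I).continuousAt
            ((isOpen_leftHalfPlane a).mem_nhds (seg_mem h θ))
        have : ContinuousAt (fun t : ℝ => fderiv ℝ U (t + θ * I) I) s :=
          ContinuousAt.comp (f := fun t : ℝ => (t + θ * I : ℂ)) hc
            (by fun_prop : Continuous fun t : ℝ => (t + θ * I : ℂ)).continuousAt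
        exact this.tendsto.mono_left nhdsWithin_le_nhds
      have h2 := hasDerivAt_iff_tendsto_slope.1 (hasDerivAt_horizontal hU h θ)
      have h3 := (h1.add_const (fderiv ℝ U (s + θ * I) I)).mul
        ((Complex.continuous_conj.tendsto _).comp h2)
      have h4 := (Complex.continuous_im.tendsto _).comp h3
      refine (tendsto_congr' (Eventually.of_forall fun _ => rfl)).1 (h4.trans_eq ?_)
      rw [← two_mul, mul_assoc]
      exact congrArg nhds (Complex.im_ofReal_mul 2 _)
  refine key.congr' ?_
  filter_upwards [nhdsWithin_le_nhds hnhds] with t ht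
  rw [slope_def_module, segInt_im_sub hU hper h (ht.2.trans_lt hba), smul_eq_mul,
    ← intervalIntegral.integral_const_mul]
  refine intervalIntegral.integral_congr fun θ _ => ?_
  simp only [slope_def_module, real_smul, map_mul, conj_ofReal]
  rw [← Complex.im_ofReal_mul]
  congr 1
  ring

end SegInt

/-- The real quadratic form `x ↦ e |x|² + Re (f · conj x ^ 2)` on `ℂ`. -/
def quadForm (e : ℝ) (f x : ℂ) : ℝ :=
  e * (x.re ^ 2 + x.im ^ 2) + f.re * (x.re ^ 2 - x.im ^ 2) + f.im * (2 * x.re * x.im)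

theorem abs_quadForm_zero_le (f x : ℂ) : |quadForm 0 f x| ≤ ‖f‖ * ‖x‖ ^ 2 := by
  have h : quadForm 0 f x = (f * (starRingEnd ℂ) x ^ 2).re := by
    simp [quadForm, pow_two]
    ring
  rw [h]
  refine (Complex.abs_re_le_norm _).trans ?_
  simp

theorem quadForm_eq_add (e : ℝ) (f x : ℂ) : quadForm e f x = e * ‖x‖ ^ 2 + quadForm 0 f x := by
  simp [quadForm, ← Complex.normSq_eq_norm_sq, Complex.normSq_apply]
  ring

theorem abs_quadForm_le {e : ℝ} {f : ℂ} {κ : ℝ} (he : |e| ≤ κ) (hf : ‖f‖ ≤ κ) (x : ℂ) :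
    |quadForm e f x| ≤ 2 * κ * ‖x‖ ^ 2 := by
  rw [quadForm_eq_add]
  refine (abs_add_le _ _).trans ?_
  have h1 := abs_quadForm_zero_le f x
  rw [abs_mul, abs_of_nonneg (sq_nonneg ‖x‖)]
  nlinarith [sq_nonneg ‖x‖, mul_le_mul_of_nonneg_right he (sq_nonneg ‖x‖),
    mul_le_mul_of_nonneg_right hf (sq_nonneg ‖x‖)]

theorem quadForm_bounds {e : ℝ} {f : ℂ} (he : |e - 1| ≤ 1 / 4) (hf : ‖f‖ ≤ 1 / 4) (x : ℂ) :
    1 / 2 * ‖x‖ ^ 2 ≤ quadForm e f x ∧ quadForm e f x ≤ 3 / 2 * ‖x‖ ^ 2 := by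
  have h : quadForm e f x = ‖x‖ ^ 2 + quadForm (e - 1) f x := by
    rw [quadForm_eq_add, quadForm_eq_add (e - 1)]
    ring
  have := abs_le.1 (abs_quadForm_le he hf x)
  constructor <;> linarith [this.1, this.2]

section Frequency

variable {a : ℝ} {U f : ℂ → ℂ} {e ρ : ℂ → ℝ}

theorem contDiffOn_quadForm (hU : ContDiffOn ℝ 1 U (leftHalfPlane a))
    (he : ContDiffOn ℝ 1 e (leftHalfPlane a)) (hf : ContDiffOn ℝ 1 f (leftHalfPlane a)) :
    ContDiffOn ℝ 1 (fun w => quadForm (e w) (f w) (U w)) (leftHalfPlane a) := by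
  have hre : ContDiff ℝ 1 Complex.re := Complex.reCLM.contDiff
  have him : ContDiff ℝ 1 Complex.im := Complex.imCLM.contDiff
  have h1 := hre.comp_contDiffOn hU
  have h2 := him.comp_contDiffOn hU
  have h3 := hre.comp_contDiffOn hf
  have h4 := him.comp_contDiffOn hf
  exact ((he.mul ((h1.pow 2).add (h2.pow 2))).add (h3.mul ((h1.pow 2).sub (h2.pow 2)))).add
    (h4.mul ((contDiffOn_const.mul h1).mul h2))

theorem fderiv_quadForm (hU : ContDiffOn ℝ 1 U (leftHalfPlane a))
    (he : ContDiffOn ℝ 1 e (leftHalfPlane a)) (hf : ContDiffOn ℝ 1 f (leftHalfPlane a)) {w : ℂ}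
    (hw : w ∈ leftHalfPlane a) (v : ℂ) :
    fderiv ℝ (fun w => quadForm (e w) (f w) (U w)) w v =
      quadForm (fderiv ℝ e w v) (fderiv ℝ f w v) (U w)
      + 2 * ((e w * fderiv ℝ U w v + f w * (starRingEnd ℂ) (fderiv ℝ U w v))
        * (starRingEnd ℂ) (U w)).re := by
  have hU' := hasFDerivAt_of_leftHalfPlane hU hw
  have he' := hasFDerivAt_of_leftHalfPlane he hw
  have hf' := hasFDerivAt_of_leftHalfPlane hf hw
  have h1 := Complex.reCLM.hasFDerivAt.comp w hU'
  have h2 := Complex.imCLM.hasFDerivAt.comp w hU'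
  have h3 := Complex.reCLM.hasFDerivAt.comp w hf'
  have h4 := Complex.imCLM.hasFDerivAt.comp w hf'
  have h := ((he'.mul ((h1.pow 2).add (h2.pow 2))).add (h3.mul ((h1.pow 2).sub (h2.pow 2)))).add
    (h4.mul ((h1.const_mul 2).mul h2))
  have h' : HasFDerivAt (fun w => quadForm (e w) (f w) (U w)) _ w := h
  rw [h'.fderiv]
  simp [quadForm]
  ring

theorem quadForm_sub_eq (e ρ N : ℝ) (f x xs xt F : ℂ)
    (hF : F = e * xs + f * (starRingEnd ℂ) xs + I * xt
      - ρ * (e * xt + f * (starRingEnd ℂ) xt)) :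
    2 * (xt * (starRingEnd ℂ) xs).im
      - N * (2 * ((e * xs + f * (starRingEnd ℂ) xs) * (starRingEnd ℂ) x).re)
      + N * (ρ * (2 * ((e * xt + f * (starRingEnd ℂ) xt) * (starRingEnd ℂ) x).re))
      + 2 * N * (N * quadForm e f x - (xt * (starRingEnd ℂ) x).im)
      = 2 * quadForm e f (xs - ρ * xt - N * x)
        - 2 * (F * (starRingEnd ℂ) (xs - ρ * xt - N * x)).re := by
  subst hF
  simp [quadForm]
  ring

theorem neg_two_re_ge (F y : ℂ) : -‖F‖ ^ 2 - ‖y‖ ^ 2 ≤ -(2 * (F * (starRingEnd ℂ) y).re) := by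
  have := Complex.re_le_norm (F * (starRingEnd ℂ) y)
  rw [norm_mul, RCLike.norm_conj] at this
  nlinarith [sq_nonneg (‖F‖ - ‖y‖)]

/-- The pointwise inequality behind the monotonicity of the frequency. -/
theorem frequency_pointwise {e ρ N κ e1 eI ρI : ℝ} {f f1 fI x xs xt : ℂ}
    (he : |e - 1| ≤ 1 / 4) (hf : ‖f‖ ≤ 1 / 4) (hρ : |ρ| ≤ 1) (hκ0 : 0 ≤ κ) (hκ1 : κ ≤ 1)
    (he1 : |e1| ≤ κ) (heI : |eI| ≤ κ) (hf1 : ‖f1‖ ≤ κ) (hfI : ‖fI‖ ≤ κ) (hρI : |ρI| ≤ κ)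
    (hF : ‖e * xs + f * (starRingEnd ℂ) xs + I * xt
      - ρ * (e * xt + f * (starRingEnd ℂ) xt)‖ ≤ κ * ‖x‖) :
    -(12 * κ * (1 + |N|)) * quadForm e f x ≤ 2 * (xt * (starRingEnd ℂ) xs).im
      - N * (quadForm e1 f1 x + 2 * ((e * xs + f * (starRingEnd ℂ) xs) * (starRingEnd ℂ) x).re)
      + N * (ρ * (quadForm eI fI x
          + 2 * ((e * xt + f * (starRingEnd ℂ) xt) * (starRingEnd ℂ) x).re)
        + ρI * quadForm e f x)
      + 2 * N * (N * quadForm e f x - (xt * (starRingEnd ℂ) x).im) := by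
  set F := e * xs + f * (starRingEnd ℂ) xs + I * xt
      - ρ * (e * xt + f * (starRingEnd ℂ) xt) with hFdef
  have key := quadForm_sub_eq e ρ N f x xs xt F hFdef
  set y := xs - ρ * xt - N * x
  have h1 := (quadForm_bounds he hf y).1
  have h2 := neg_two_re_ge F y
  obtain ⟨h3, h3'⟩ := quadForm_bounds he hf x
  have h4 := abs_quadForm_le he1 hf1 x
  have h5 := abs_quadForm_le heI hfI x
  have hX := sq_nonneg ‖x‖
  have hF2 : ‖F‖ ^ 2 ≤ κ * ‖x‖ ^ 2 := by
    calc ‖F‖ ^ 2 ≤ (κ * ‖x‖) ^ 2 := by gcongr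
      _ = κ * (κ * ‖x‖ ^ 2) := by ring
      _ ≤ 1 * (κ * ‖x‖ ^ 2) := by gcongr
      _ = _ := one_mul _
  have h6 : |N * (- quadForm e1 f1 x + ρ * quadForm eI fI x + ρI * quadForm e f x)|
      ≤ |N| * (6 * κ * ‖x‖ ^ 2) := by
    rw [abs_mul]
    gcongr
    have h7 : |ρ * quadForm eI fI x| ≤ 2 * κ * ‖x‖ ^ 2 := by
      rw [abs_mul]
      calc _ ≤ 1 * (2 * κ * ‖x‖ ^ 2) := by gcongr
        _ = _ := one_mul _
    have h8 : |ρI * quadForm e f x| ≤ κ * (3 / 2 * ‖x‖ ^ 2) := by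
      rw [abs_mul, abs_of_nonneg (by linarith : 0 ≤ quadForm e f x)]
      exact mul_le_mul hρI h3' (by linarith) hκ0
    refine (abs_add_three _ _ _).trans ?_
    rw [abs_neg]
    nlinarith [mul_nonneg hκ0 hX]
  have h9 := (abs_le.1 h6).1
  have h10 : 12 * κ * (1 + |N|) * (1 / 2 * ‖x‖ ^ 2) ≤ 12 * κ * (1 + |N|) * quadForm e f x := by
    gcongr
  have h11 : 0 ≤ κ * ‖x‖ ^ 2 := by positivity
  linarith

theorem growth_pointwise {e ρ κ e1 eI ρI : ℝ} {f f1 fI x xs xt : ℂ}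
    (he : |e - 1| ≤ 1 / 4) (hf : ‖f‖ ≤ 1 / 4) (hρ : |ρ| ≤ 1) (hκ0 : 0 ≤ κ)
    (he1 : |e1| ≤ κ) (heI : |eI| ≤ κ) (hf1 : ‖f1‖ ≤ κ) (hfI : ‖fI‖ ≤ κ) (hρI : |ρI| ≤ κ)
    (hF : ‖e * xs + f * (starRingEnd ℂ) xs + I * xt
      - ρ * (e * xt + f * (starRingEnd ℂ) xt)‖ ≤ κ * ‖x‖) :
    quadForm e1 f1 x + 2 * ((e * xs + f * (starRingEnd ℂ) xs) * (starRingEnd ℂ) x).re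
      - (ρ * (quadForm eI fI x
          + 2 * ((e * xt + f * (starRingEnd ℂ) xt) * (starRingEnd ℂ) x).re)
        + ρI * quadForm e f x) ≤ 2 * (xt * (starRingEnd ℂ) x).im + 16 * κ * quadForm e f x := by
  set F := e * xs + f * (starRingEnd ℂ) xs + I * xt
      - ρ * (e * xt + f * (starRingEnd ℂ) xt) with hFdef
  have key : 2 * ((e * xs + f * (starRingEnd ℂ) xs) * (starRingEnd ℂ) x).re
      - ρ * (2 * ((e * xt + f * (starRingEnd ℂ) xt) * (starRingEnd ℂ) x).re)
      = 2 * (xt * (starRingEnd ℂ) x).im + 2 * (F * (starRingEnd ℂ) x).re := by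
    rw [hFdef]
    simp
    ring
  obtain ⟨h3, h3'⟩ := quadForm_bounds he hf x
  have h4 := (abs_le.1 (abs_quadForm_le he1 hf1 x)).2
  have h5 := abs_quadForm_le heI hfI x
  have hX := sq_nonneg ‖x‖
  have h6 : (F * (starRingEnd ℂ) x).re ≤ κ * ‖x‖ ^ 2 := by
    refine (Complex.re_le_norm _).trans ?_
    rw [norm_mul, RCLike.norm_conj]
    nlinarith [norm_nonneg x]
  have h7 : |ρ * quadForm eI fI x| ≤ 2 * κ * ‖x‖ ^ 2 := by
    rw [abs_mul]
    calc _ ≤ 1 * (2 * κ * ‖x‖ ^ 2) := by gcongr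
      _ = _ := one_mul _
  have h8 : |ρI * quadForm e f x| ≤ κ * (3 / 2 * ‖x‖ ^ 2) := by
    rw [abs_mul, abs_of_nonneg (by linarith : 0 ≤ quadForm e f x)]
    exact mul_le_mul hρI h3' (by linarith) hκ0
  have h9 := (abs_le.1 h7).1
  have h10 := (abs_le.1 h8).1
  have h11 : κ * (1 / 2 * ‖x‖ ^ 2) ≤ κ * quadForm e f x := by gcongr
  have h12 : 0 ≤ κ * ‖x‖ ^ 2 := by positivity
  linarith

end Frequency

section FrequencyODE

variable {a K s₁ : ℝ} {H Q H' Q' : ℝ → ℝ}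

theorem arsinh_frequency_monotoneOn {s : ℝ} (hs₁ : s₁ < a) (hK : 0 ≤ K)
    (hH : ∀ t < a, HasDerivAt H (H' t) t) (hQ : ∀ t < a, HasDerivAt Q (Q' t) t)
    (hfreq : ∀ t < a, 0 < H t → -(12 * (K * Real.exp t) * (1 + |Q t / H t|)) * H t
      ≤ Q' t - Q t / H t * H' t)
    (hpos : ∀ t ∈ Set.Icc s s₁, 0 < H t) :
    MonotoneOn (fun t => Real.arsinh (Q t / H t) + 24 * K * Real.exp t) (Set.Icc s s₁) := by
  have hd : ∀ t ∈ Set.Icc s s₁, HasDerivAt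
      (fun t => Real.arsinh (Q t / H t) + 24 * K * Real.exp t)
      ((√(1 + (Q t / H t) ^ 2))⁻¹ • ((Q' t * H t - Q t * H' t) / H t ^ 2)
        + 24 * K * Real.exp t) t := by
    intro t ht
    have hta : t < a := ht.2.trans_lt hs₁
    exact (((hQ t hta).div (hH t hta) (hpos t ht).ne').arsinh).add
      ((Real.hasDerivAt_exp t).const_mul _)
  refine monotoneOn_of_deriv_nonneg (convex_Icc _ _)
    (fun t ht => (hd t ht).continuousAt.continuousWithinAt)
    (fun t ht => ((hd t (interior_subset ht)).differentiableAt).differentiableWithinAt) ?_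
  intro t ht
  have ht' := interior_subset ht
  rw [(hd t ht').deriv]
  have hp := hpos t ht'
  have h1 := hfreq t (ht'.2.trans_lt hs₁) hp
  set N := Q t / H t with hN
  have h2 : (Q' t * H t - Q t * H' t) / H t ^ 2 = (Q' t - N * H' t) / H t := by
    rw [hN]
    field_simp
  have h3 : -(12 * (K * Real.exp t) * (1 + |N|)) ≤ (Q' t - N * H' t) / H t := by
    rw [le_div_iff₀ hp]
    exact h1
  have hR : 0 < √(1 + N ^ 2) := Real.sqrt_pos.2 (by positivity)
  have h4 : 1 + |N| ≤ 2 * √(1 + N ^ 2) := by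
    have h5 : 1 ≤ √(1 + N ^ 2) := Real.one_le_sqrt.2 (by nlinarith [sq_nonneg N])
    have h6 : |N| ≤ √(1 + N ^ 2) := Real.abs_le_sqrt (by linarith)
    linarith
  have hKe : 0 ≤ K * Real.exp t := by positivity
  rw [h2, smul_eq_mul]
  have h7 : -(24 * (K * Real.exp t)) ≤ (√(1 + N ^ 2))⁻¹ * ((Q' t - N * H' t) / H t) := by
    rw [inv_mul_eq_div, le_div_iff₀ hR]
    nlinarith
  linarith

theorem lower_bound_of_pos {s : ℝ} (hs₁ : s₁ < a) (hs : s ≤ s₁) (hK : 0 ≤ K)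
    (hK1 : ∀ t < a, K * Real.exp t ≤ 1)
    (hH : ∀ t < a, HasDerivAt H (H' t) t) (hQ : ∀ t < a, HasDerivAt Q (Q' t) t)
    (hfreq : ∀ t < a, 0 < H t → -(12 * (K * Real.exp t) * (1 + |Q t / H t|)) * H t
      ≤ Q' t - Q t / H t * H' t)
    (hgrowth : ∀ t < a, H' t ≤ 2 * Q t + 16 * (K * Real.exp t) * H t)
    (hpos : ∀ t ∈ Set.Icc s s₁, 0 < H t) :
    H s₁ * Real.exp (-(2 * Real.sinh (Real.arsinh (Q s₁ / H s₁) + 24 * K * Real.exp s₁) + 16)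
      * (s₁ - s)) ≤ H s := by
  have hmono := arsinh_frequency_monotoneOn hs₁ hK hH hQ hfreq hpos
  set C := Real.sinh (Real.arsinh (Q s₁ / H s₁) + 24 * K * Real.exp s₁) with hC
  have hN : ∀ t ∈ Set.Icc s s₁, Q t ≤ C * H t := by
    intro t ht
    rw [← div_le_iff₀ (hpos t ht), ← Real.sinh_arsinh (Q t / H t), hC]
    refine Real.sinh_le_sinh.2 ?_
    have h1 := hmono ht (Set.right_mem_Icc.2 hs) ht.2
    simp only at h1
    have : 0 ≤ 24 * K * Real.exp t := by positivity
    linarith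
  have hd : ∀ t ∈ Set.Icc s s₁, HasDerivAt (fun t => H t * Real.exp (-(2 * C + 16) * t))
      (H' t * Real.exp (-(2 * C + 16) * t)
        + H t * (Real.exp (-(2 * C + 16) * t) * (-(2 * C + 16)))) t := by
    intro t ht
    refine (hH t (ht.2.trans_lt hs₁)).mul ?_
    simpa using ((hasDerivAt_id t).const_mul (-(2 * C + 16))).exp
  have hanti : AntitoneOn (fun t => H t * Real.exp (-(2 * C + 16) * t)) (Set.Icc s s₁) := by
    refine antitoneOn_of_deriv_nonpos (convex_Icc _ _)
      (fun t ht => (hd t ht).continuousAt.continuousWithinAt)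
      (fun t ht => ((hd t (interior_subset ht)).differentiableAt).differentiableWithinAt) ?_
    intro t ht
    have ht' := interior_subset ht
    rw [(hd t ht').deriv]
    have hta := ht'.2.trans_lt hs₁
    have h1 := hgrowth t hta
    have h2 := hN t ht'
    have h3 : K * Real.exp t * H t ≤ 1 * H t := by
      have := hK1 t hta
      have := (hpos t ht').le
      gcongr
    have h4 : H' t - (2 * C + 16) * H t ≤ 0 := by linarith
    have h5 := Real.exp_pos (-(2 * C + 16) * t)
    nlinarith
  have h1 := hanti (Set.left_mem_Icc.2 hs) (Set.right_mem_Icc.2 hs) hs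
  simp only at h1
  have h2 : Real.exp (-(2 * C + 16) * (s₁ - s)) * Real.exp (-(2 * C + 16) * s)
      = Real.exp (-(2 * C + 16) * s₁) := by
    rw [← Real.exp_add]
    congr 1
    ring
  have h3 := Real.exp_pos (-(2 * C + 16) * s)
  refine le_of_mul_le_mul_right ?_ h3
  rw [mul_assoc, h2]
  exact h1

theorem exists_lower_bound (hs₁ : s₁ < a) (hK : 0 ≤ K)
    (hK1 : ∀ t < a, K * Real.exp t ≤ 1)
    (hH : ∀ t < a, HasDerivAt H (H' t) t) (hQ : ∀ t < a, HasDerivAt Q (Q' t) t)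
    (hfreq : ∀ t < a, 0 < H t → -(12 * (K * Real.exp t) * (1 + |Q t / H t|)) * H t
      ≤ Q' t - Q t / H t * H' t)
    (hgrowth : ∀ t < a, H' t ≤ 2 * Q t + 16 * (K * Real.exp t) * H t)
    (hpos : 0 < H s₁) :
    ∃ c : ℝ, ∀ s ≤ s₁, H s₁ * Real.exp (-c * (s₁ - s)) ≤ H s := by
  set c := 2 * Real.sinh (Real.arsinh (Q s₁ / H s₁) + 24 * K * Real.exp s₁) + 16 with hc
  have hb : ∀ s ≤ s₁, (∀ t ∈ Set.Icc s s₁, 0 < H t) → H s₁ * Real.exp (-c * (s₁ - s)) ≤ H s :=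
    fun s hs h => lower_bound_of_pos hs₁ hs hK hK1 hH hQ hfreq hgrowth h
  refine ⟨c, fun s hs => hb s hs ?_⟩
  by_contra! hcon
  obtain ⟨t, ht, htH⟩ := hcon
  have hcont : ContinuousOn H (Set.Icc t s₁) := fun x hx =>
    (hH x (hx.2.trans_lt hs₁)).continuousAt.continuousWithinAt
  have hcomp : IsCompact (Set.Icc t s₁ ∩ H ⁻¹' Set.Iic 0) :=
    isCompact_Icc.of_isClosed_subset
      (hcont.preimage_isClosed_of_isClosed isClosed_Icc isClosed_Iic) Set.inter_subset_left
  obtain ⟨t₀, ht₀, hmax⟩ := hcomp.exists_isGreatest ⟨t, ⟨le_rfl, ht.2⟩, htH⟩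
  have hlt : t₀ < s₁ := by
    refine lt_of_le_of_ne ht₀.1.2 ?_
    rintro rfl
    exact absurd hpos (not_lt.2 ht₀.2)
  have hev : ∀ᶠ x in nhdsWithin t₀ (Set.Ioi t₀),
      H s₁ * Real.exp (-c * (s₁ - x)) ≤ H x := by
    filter_upwards [Ioo_mem_nhdsGT hlt] with x hx
    refine hb x hx.2.le fun y hy => ?_
    by_contra! hy0
    exact absurd (hmax ⟨⟨ht₀.1.1.trans (hx.1.le.trans hy.1), hy.2⟩, hy0⟩)
      (not_le.2 (hx.1.trans_le hy.1))
  have hlim : H s₁ * Real.exp (-c * (s₁ - t₀)) ≤ H t₀ := by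
    refine le_of_tendsto_of_tendsto
      (tendsto_nhdsWithin_of_tendsto_nhds (Continuous.tendsto (by fun_prop) t₀))
      (tendsto_nhdsWithin_of_tendsto_nhds (hH t₀ (hlt.trans hs₁)).continuousAt) hev
  have : 0 < H s₁ * Real.exp (-c * (s₁ - t₀)) := by positivity
  exact absurd (ht₀.2 : H t₀ ≤ 0) (not_le.2 (this.trans_le hlim))

end FrequencyODE

section UniqueContinuation

/-- A periodic solution `U` of the first-order system
`e U_s + f conj(U_s) + i U_θ = ρ (e U_θ + f conj(U_θ)) + O(|U|)` on a left half-plane, whose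
coefficients are small perturbations of those of the Cauchy-Riemann system. -/
structure IsSymmetrizedSolution (a K : ℝ) (U f : ℂ → ℂ) (e ρ : ℂ → ℝ) : Prop where
  nonneg : 0 ≤ K
  small : ∀ t < a, K * Real.exp t ≤ 1
  smooth : ContDiffOn ℝ 1 U (leftHalfPlane a)
  smooth_e : ContDiffOn ℝ 1 e (leftHalfPlane a)
  smooth_f : ContDiffOn ℝ 1 f (leftHalfPlane a)
  smooth_ρ : ContDiffOn ℝ 1 ρ (leftHalfPlane a)
  periodic : ∀ w, U (w + 2 * Real.pi * I) = U w
  periodic_e : ∀ w, e (w + 2 * Real.pi * I) = e w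
  periodic_f : ∀ w, f (w + 2 * Real.pi * I) = f w
  periodic_ρ : ∀ w, ρ (w + 2 * Real.pi * I) = ρ w
  bound_e : ∀ w ∈ leftHalfPlane a, |e w - 1| ≤ 1 / 4
  bound_f : ∀ w ∈ leftHalfPlane a, ‖f w‖ ≤ 1 / 4
  bound_ρ : ∀ w ∈ leftHalfPlane a, |ρ w| ≤ 1
  fderiv_e_one : ∀ w ∈ leftHalfPlane a, |fderiv ℝ e w 1| ≤ K * Real.exp w.re
  fderiv_e_I : ∀ w ∈ leftHalfPlane a, |fderiv ℝ e w I| ≤ K * Real.exp w.re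
  fderiv_f_one : ∀ w ∈ leftHalfPlane a, ‖fderiv ℝ f w 1‖ ≤ K * Real.exp w.re
  fderiv_f_I : ∀ w ∈ leftHalfPlane a, ‖fderiv ℝ f w I‖ ≤ K * Real.exp w.re
  fderiv_ρ_I : ∀ w ∈ leftHalfPlane a, |fderiv ℝ ρ w I| ≤ K * Real.exp w.re
  equation : ∀ w ∈ leftHalfPlane a,
    ‖e w * fderiv ℝ U w 1 + f w * (starRingEnd ℂ) (fderiv ℝ U w 1) + I * fderiv ℝ U w I
      - ρ w * (e w * fderiv ℝ U w I + f w * (starRingEnd ℂ) (fderiv ℝ U w I))‖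
      ≤ K * Real.exp w.re * ‖U w‖

namespace IsSymmetrizedSolution

variable {a K s : ℝ} {U f : ℂ → ℂ} {e ρ : ℂ → ℝ}

theorem segInt_fderiv_mul_quadForm (h : IsSymmetrizedSolution a K U f e ρ) (hs : s < a) :
    segInt (fun w => ρ w * fderiv ℝ (fun w => quadForm (e w) (f w) (U w)) w I
      + fderiv ℝ ρ w I * quadForm (e w) (f w) (U w)) s = 0 := by
  have hq := contDiffOn_quadForm h.smooth h.smooth_e h.smooth_f
  rw [← segInt_fderiv_I (h.smooth_ρ.mul hq) (fun w => by
    simp only [h.periodic, h.periodic_e, h.periodic_f, h.periodic_ρ]) hs]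
  refine segInt_congr fun w hw => ?_
  have hw' : w ∈ leftHalfPlane a := by rwa [mem_leftHalfPlane, hw]
  have h1 := (hasFDerivAt_of_leftHalfPlane h.smooth_ρ hw').mul
    (hasFDerivAt_of_leftHalfPlane hq hw')
  have h2 : HasFDerivAt (fun w => ρ w * quadForm (e w) (f w) (U w)) _ w := h1
  rw [h2.fderiv]
  simp
  ring

theorem continuousOn_im (hU : ContDiffOn ℝ 1 U (leftHalfPlane a)) :
    ContinuousOn (fun w => (fderiv ℝ U w I * (starRingEnd ℂ) (U w)).im) (leftHalfPlane a) :=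
  Complex.continuous_im.comp_continuousOn ((continuousOn_fderiv_apply hU I).mul
    (Complex.continuous_conj.comp_continuousOn hU.continuousOn))

theorem frequency_le (h : IsSymmetrizedSolution a K U f e ρ) (hs : s < a) {H Q N : ℝ}
    (hH : H = segInt (fun w => quadForm (e w) (f w) (U w)) s)
    (hQ : Q = segInt (fun w => (fderiv ℝ U w I * (starRingEnd ℂ) (U w)).im) s)
    (hN : N * H = Q) :
    -(12 * (K * Real.exp s) * (1 + |N|)) * H
      ≤ segInt (fun w => 2 * (fderiv ℝ U w I * (starRingEnd ℂ) (fderiv ℝ U w 1)).im) s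
        - N * segInt (fun w => fderiv ℝ (fun w => quadForm (e w) (f w) (U w)) w 1) s := by
  have hq := contDiffOn_quadForm h.smooth h.smooth_e h.smooth_f
  have hqc := hq.continuousOn
  have hq1 := continuousOn_fderiv_apply hq 1
  have hqI := continuousOn_fderiv_apply hq I
  have hρI := continuousOn_fderiv_apply h.smooth_ρ I
  have c1 : ContinuousOn (fun w => 2 * (fderiv ℝ U w I * (starRingEnd ℂ) (fderiv ℝ U w 1)).im)
      (leftHalfPlane a) := continuousOn_const.mul
    (Complex.continuous_im.comp_continuousOn ((continuousOn_fderiv_apply h.smooth I).mul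
      (Complex.continuous_conj.comp_continuousOn (continuousOn_fderiv_apply h.smooth 1))))
  have c2 := continuousOn_const (c := N).fun_mul hq1
  have c3 := (h.smooth_ρ.continuousOn.fun_mul hqI).fun_add (hρI.fun_mul hqc)
  have c4 := (continuousOn_const (c := N).fun_mul hqc).fun_sub (continuousOn_im h.smooth)
  have hmono := segInt_mono (s := s) (continuousOn_const.fun_mul hqc)
    (((c1.fun_sub c2).fun_add (continuousOn_const (c := N).fun_mul c3)).fun_add
      (continuousOn_const (c := 2 * N).fun_mul c4)) hs
    (f := fun w => -(12 * (K * Real.exp s) * (1 + |N|)) * quadForm (e w) (f w) (U w)) ?_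
  · rw [segInt_add ((c1.fun_sub c2).fun_add (continuousOn_const (c := N).fun_mul c3))
      (continuousOn_const (c := 2 * N).fun_mul c4) hs,
      segInt_add (c1.fun_sub c2) (continuousOn_const (c := N).fun_mul c3) hs,
      segInt_sub c1 c2 hs, segInt_const_mul (-(12 * (K * Real.exp s) * (1 + |N|))), segInt_const_mul N,
      segInt_const_mul N, segInt_const_mul (2 * N),
      h.segInt_fderiv_mul_quadForm hs,
      segInt_sub (continuousOn_const (c := N).fun_mul hqc) (continuousOn_im h.smooth) hs,
      segInt_const_mul N, ← hH, ← hQ, hN] at hmono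
    linarith
  · intro w hw
    have hw' : w ∈ leftHalfPlane a := by rwa [mem_leftHalfPlane, hw]
    subst hw
    simp only [fderiv_quadForm h.smooth h.smooth_e h.smooth_f hw']
    exact frequency_pointwise (h.bound_e w hw') (h.bound_f w hw') (h.bound_ρ w hw')
      (mul_nonneg h.nonneg (Real.exp_pos _).le) (h.small _ hs) (h.fderiv_e_one w hw')
      (h.fderiv_e_I w hw') (h.fderiv_f_one w hw') (h.fderiv_f_I w hw') (h.fderiv_ρ_I w hw')
      (h.equation w hw')

theorem growth_le (h : IsSymmetrizedSolution a K U f e ρ) (hs : s < a) :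
    segInt (fun w => fderiv ℝ (fun w => quadForm (e w) (f w) (U w)) w 1) s
      ≤ 2 * segInt (fun w => (fderiv ℝ U w I * (starRingEnd ℂ) (U w)).im) s
        + 16 * (K * Real.exp s) * segInt (fun w => quadForm (e w) (f w) (U w)) s := by
  have hq := contDiffOn_quadForm h.smooth h.smooth_e h.smooth_f
  have hqc := hq.continuousOn
  have hq1 := continuousOn_fderiv_apply hq 1
  have hqI := continuousOn_fderiv_apply hq I
  have hρI := continuousOn_fderiv_apply h.smooth_ρ I
  have c3 := (h.smooth_ρ.continuousOn.fun_mul hqI).fun_add (hρI.fun_mul hqc)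
  have c4 := continuousOn_im h.smooth
  have hmono := segInt_mono (s := s) (hq1.fun_sub c3)
    ((continuousOn_const (c := 2).fun_mul c4).fun_add
      (continuousOn_const (c := 16 * (K * Real.exp s)).fun_mul hqc)) hs ?_
  · rw [segInt_add (continuousOn_const (c := 2).fun_mul c4)
      (continuousOn_const (c := 16 * (K * Real.exp s)).fun_mul hqc) hs, segInt_sub hq1 c3 hs,
      segInt_const_mul, segInt_const_mul, h.segInt_fderiv_mul_quadForm hs, sub_zero] at hmono
    exact hmono
  · intro w hw
    have hw' : w ∈ leftHalfPlane a := by rwa [mem_leftHalfPlane, hw]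
    subst hw
    simp only [fderiv_quadForm h.smooth h.smooth_e h.smooth_f hw']
    exact growth_pointwise (h.bound_e w hw') (h.bound_f w hw') (h.bound_ρ w hw')
      (mul_nonneg h.nonneg (Real.exp_pos _).le) (h.fderiv_e_one w hw')
      (h.fderiv_e_I w hw') (h.fderiv_f_one w hw') (h.fderiv_f_I w hw') (h.fderiv_ρ_I w hw')
      (h.equation w hw')

theorem segInt_quadForm_bounds (h : IsSymmetrizedSolution a K U f e ρ) (hs : s < a) :
    1 / 2 * segInt (fun w => ‖U w‖ ^ 2) s ≤ segInt (fun w => quadForm (e w) (f w) (U w)) s ∧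
    segInt (fun w => quadForm (e w) (f w) (U w)) s ≤ 3 / 2 * segInt (fun w => ‖U w‖ ^ 2) s := by
  have hqc := (contDiffOn_quadForm h.smooth h.smooth_e h.smooth_f).continuousOn
  have hc := h.smooth.continuousOn.norm.pow 2
  have key : ∀ w : ℂ, w.re = s → _ := fun w hw =>
    have hw' : w ∈ leftHalfPlane a := by rwa [mem_leftHalfPlane, hw]
    quadForm_bounds (h.bound_e w hw') (h.bound_f w hw') (U w)
  rw [← segInt_const_mul, ← segInt_const_mul]
  exact ⟨segInt_mono (continuousOn_const.mul hc) hqc hs fun w hw => (key w hw).1,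
    segInt_mono hqc (continuousOn_const.mul hc) hs fun w hw => (key w hw).2⟩

/-- Strong unique continuation: the `L²` norm over a vertical segment decays at most
exponentially as the segment moves to the left. -/
theorem exists_exp_le (h : IsSymmetrizedSolution a K U f e ρ) {s₁ : ℝ} (hs₁ : s₁ < a)
    (hpos : 0 < segInt (fun w => ‖U w‖ ^ 2) s₁) :
    ∃ δ > 0, ∃ c : ℝ, ∀ s ≤ s₁, δ * Real.exp (c * s) ≤ segInt (fun w => ‖U w‖ ^ 2) s := by
  have hq := contDiffOn_quadForm h.smooth h.smooth_e h.smooth_f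
  set H := segInt fun w => quadForm (e w) (f w) (U w) with hHdef
  have hle : ∀ s < a, 0 ≤ H s := fun s hs =>
    (mul_nonneg (by norm_num) (segInt_nonneg fun w _ => by positivity)).trans
      (h.segInt_quadForm_bounds hs).1
  have hHpos : 0 < H s₁ := by linarith [(h.segInt_quadForm_bounds hs₁).1]
  have hcont : ContinuousOn (fun w => fderiv ℝ U w I) (leftHalfPlane a) :=
    continuousOn_fderiv_apply h.smooth I
  obtain ⟨c, hc⟩ := exists_lower_bound hs₁ h.nonneg h.small (H := H)
    (Q := segInt fun w => (fderiv ℝ U w I * (starRingEnd ℂ) (U w)).im)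
    (fun t ht => hasDerivAt_segInt hq ht) (fun t ht => hasDerivAt_segInt_im h.smooth h.periodic ht)
    (fun t ht h0 => h.frequency_le ht rfl rfl (div_mul_cancel₀ _ h0.ne'))
    (fun t ht => h.growth_le ht) hHpos
  · refine ⟨2 / 3 * (H s₁ * Real.exp (-c * s₁)), by positivity, c, fun s hs => ?_⟩
    have h1 := hc s hs
    have h2 := (h.segInt_quadForm_bounds (hs.trans_lt hs₁)).2
    have h3 : Real.exp (-c * (s₁ - s)) = Real.exp (-c * s₁) * Real.exp (c * s) := by
      rw [← Real.exp_add]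
      congr 1
      ring
    rw [h3] at h1
    linarith

end IsSymmetrizedSolution

end UniqueContinuation

section Cylinder

/-- A periodic solution `U` of `U_s + i U_θ = F U + L (U_s - i U_θ)` on a left half-plane, whose
coefficients decay exponentially together with their first derivatives. -/
structure IsCylinderSolution (a C : ℝ) (U : ℂ → ℂ) (F L : ℂ → (ℂ →L[ℝ] ℂ)) : Prop where
  nonneg : 0 ≤ C
  smooth : ContDiffOn ℝ 1 U (leftHalfPlane a)
  smooth_F : ContDiffOn ℝ 1 F (leftHalfPlane a)
  smooth_L : ContDiffOn ℝ 1 L (leftHalfPlane a)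
  periodic : ∀ w, U (w + 2 * Real.pi * I) = U w
  periodic_L : ∀ w, L (w + 2 * Real.pi * I) = L w
  bound_F : ∀ w ∈ leftHalfPlane a, ‖F w‖ ≤ C * Real.exp w.re
  bound_L : ∀ w ∈ leftHalfPlane a, ‖L w‖ ≤ C * Real.exp w.re
  bound_fderiv_F : ∀ w ∈ leftHalfPlane a, ‖fderiv ℝ F w‖ ≤ C * Real.exp w.re
  bound_fderiv_L : ∀ w ∈ leftHalfPlane a, ‖fderiv ℝ L w‖ ≤ C * Real.exp w.re
  equation : ∀ w ∈ leftHalfPlane a, fderiv ℝ U w 1 + I * fderiv ℝ U w I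
    = F w (U w) + L w (fderiv ℝ U w 1 - I * fderiv ℝ U w I)

theorem IsCylinderSolution.mono {a b C : ℝ} {U : ℂ → ℂ} {F L : ℂ → (ℂ →L[ℝ] ℂ)}
    (h : IsCylinderSolution a C U F L) (hb : b ≤ a) : IsCylinderSolution b C U F L where
  nonneg := h.nonneg
  smooth := h.smooth.mono (leftHalfPlane_mono hb)
  smooth_F := h.smooth_F.mono (leftHalfPlane_mono hb)
  smooth_L := h.smooth_L.mono (leftHalfPlane_mono hb)
  periodic := h.periodic
  periodic_L := h.periodic_L
  bound_F := fun w hw => h.bound_F w (leftHalfPlane_mono hb hw)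
  bound_L := fun w hw => h.bound_L w (leftHalfPlane_mono hb hw)
  bound_fderiv_F := fun w hw => h.bound_fderiv_F w (leftHalfPlane_mono hb hw)
  bound_fderiv_L := fun w hw => h.bound_fderiv_L w (leftHalfPlane_mono hb hw)
  equation := fun w hw => h.equation w (leftHalfPlane_mono hb hw)

/-- The `ℂ`-linear part of a real-linear endomorphism of `ℂ`. -/
noncomputable def linPart (ℓ : ℂ →L[ℝ] ℂ) : ℂ := 1 / 2 * (ℓ 1 - I * ℓ I)

/-- The conjugate-linear part of a real-linear endomorphism of `ℂ`. -/
noncomputable def conjPart (ℓ : ℂ →L[ℝ] ℂ) : ℂ := 1 / 2 * (ℓ 1 + I * ℓ I)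

theorem apply_eq_linPart_add_conjPart (ℓ : ℂ →L[ℝ] ℂ) (x : ℂ) :
    ℓ x = linPart ℓ * x + conjPart ℓ * (starRingEnd ℂ) x := by
  have hx : x = x.re • (1 : ℂ) + x.im • I := by simp [Complex.re_add_im]
  have h : ℓ x = x.re * ℓ 1 + x.im * ℓ I := by
    conv_lhs => rw [hx]
    rw [map_add, map_smul, map_smul]
    simp
  rw [h, linPart, conjPart]
  apply Complex.ext <;> simp <;> ring

theorem contDiff_linPart : ContDiff ℝ 1 linPart :=
  contDiff_const.mul (((ContinuousLinearMap.apply ℝ ℂ (1 : ℂ)).contDiff).sub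
    (contDiff_const.mul (ContinuousLinearMap.apply ℝ ℂ I).contDiff))

theorem contDiff_conjPart : ContDiff ℝ 1 conjPart :=
  contDiff_const.mul (((ContinuousLinearMap.apply ℝ ℂ (1 : ℂ)).contDiff).add
    (contDiff_const.mul (ContinuousLinearMap.apply ℝ ℂ I).contDiff))

theorem contDiff_normSq : ContDiff ℝ 1 Complex.normSq := by
  have h : ⇑Complex.normSq = fun z : ℂ => z.re * z.re + z.im * z.im := by
    funext z
    exact Complex.normSq_apply z
  rw [h]
  exact (Complex.reCLM.contDiff.mul Complex.reCLM.contDiff).add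
    (Complex.imCLM.contDiff.mul Complex.imCLM.contDiff)

/-- The determinant of `x ↦ x - ℓ x`. -/
noncomputable def symDet (ℓ : ℂ →L[ℝ] ℂ) : ℝ := normSq (1 - linPart ℓ) - normSq (conjPart ℓ)

/-- The coefficient `1 - |β₁|² + |β₂|²` of the symmetrizer. -/
noncomputable def symNum (ℓ : ℂ →L[ℝ] ℂ) : ℝ := 1 - normSq (linPart ℓ) + normSq (conjPart ℓ)

/-- The common denominator of the symmetrizer. -/
noncomputable def symDenom (ℓ : ℂ →L[ℝ] ℂ) : ℝ := symNum ℓ ^ 2 - 4 * normSq (conjPart ℓ)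

theorem contDiff_symDet : ContDiff ℝ 1 symDet :=
  (contDiff_normSq.comp (contDiff_const.sub contDiff_linPart)).sub
    (contDiff_normSq.comp contDiff_conjPart)

theorem contDiff_symNum : ContDiff ℝ 1 symNum :=
  (contDiff_const.sub (contDiff_normSq.comp contDiff_linPart)).add
    (contDiff_normSq.comp contDiff_conjPart)

theorem contDiff_symDenom : ContDiff ℝ 1 symDenom :=
  (contDiff_symNum.pow 2).sub (contDiff_const.mul (contDiff_normSq.comp contDiff_conjPart))

theorem symDet_zero : symDet 0 = 1 := by simp [symDet, linPart, conjPart]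

theorem symNum_zero : symNum 0 = 1 := by simp [symNum, linPart, conjPart]

theorem symDenom_zero : symDenom 0 = 1 := by simp [symDenom, symNum_zero, conjPart]

/-- The real coefficient `e` of the symmetrized system. -/
noncomputable def symE (ℓ : ℂ →L[ℝ] ℂ) : ℝ := symNum ℓ * symDet ℓ / symDenom ℓ

/-- The complex coefficient `f` of the symmetrized system. -/
noncomputable def symF (ℓ : ℂ →L[ℝ] ℂ) : ℂ := (symDet ℓ / symDenom ℓ) • (-2 * conjPart ℓ)

/-- The drift `ρ` of the symmetrized system. -/
noncomputable def symR (ℓ : ℂ →L[ℝ] ℂ) : ℝ := 2 * (linPart ℓ).im / symDet ℓ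

/-- The multiplier of the equation in the symmetrization. -/
noncomputable def symA (ℓ : ℂ →L[ℝ] ℂ) : ℂ :=
  (1 / symDenom ℓ) • (symNum ℓ • (1 - (starRingEnd ℂ) (linPart ℓ))
    - 2 * (conjPart ℓ * (starRingEnd ℂ) (conjPart ℓ)))

/-- The multiplier of the conjugate equation in the symmetrization. -/
noncomputable def symB (ℓ : ℂ →L[ℝ] ℂ) : ℂ :=
  (1 / symDenom ℓ) • (conjPart ℓ * ((symNum ℓ : ℂ) - 2 * (1 - linPart ℓ)))

theorem contDiffAt_symE : ContDiffAt ℝ 1 symE 0 :=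
  ((contDiff_symNum.mul contDiff_symDet).contDiffAt).div contDiff_symDenom.contDiffAt
    (by simp [symDenom_zero])

theorem contDiffAt_symF : ContDiffAt ℝ 1 symF 0 :=
  (contDiff_symDet.contDiffAt.div contDiff_symDenom.contDiffAt
    (by simp [symDenom_zero])).smul (contDiff_const.mul contDiff_conjPart).contDiffAt

theorem contDiffAt_symR : ContDiffAt ℝ 1 symR 0 :=
  ((contDiff_const.mul (Complex.imCLM.contDiff.comp contDiff_linPart)).contDiffAt).div
    contDiff_symDet.contDiffAt (by simp [symDet_zero])

theorem continuousAt_symA : ContinuousAt symA 0 := by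
  have h1 := contDiff_linPart.continuous
  have h2 := contDiff_conjPart.continuous
  have h3 := contDiff_symNum.continuous
  refine (continuousAt_const.div contDiff_symDenom.continuous.continuousAt
    (by simp [symDenom_zero])).smul (Continuous.continuousAt ?_)
  exact (h3.smul (continuous_const.sub (Complex.continuous_conj.comp h1))).sub
    (continuous_const.mul (h2.mul (Complex.continuous_conj.comp h2)))

theorem continuousAt_symB : ContinuousAt symB 0 := by
  have h1 := contDiff_linPart.continuous
  have h2 := contDiff_conjPart.continuous
  have h3 := contDiff_symNum.continuous
  refine (continuousAt_const.div contDiff_symDenom.continuous.continuousAt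
    (by simp [symDenom_zero])).smul (Continuous.continuousAt ?_)
  exact h2.mul ((Complex.continuous_ofReal.comp h3).sub
    (continuous_const.mul (continuous_const.sub h1)))

theorem symmetrize {ℓ : ℂ →L[ℝ] ℂ} (hd : symDet ℓ ≠ 0) (hD : symDenom ℓ ≠ 0) {xs xt g : ℂ}
    (h : xs + I * xt = g + ℓ (xs - I * xt)) :
    symE ℓ * xs + symF ℓ * (starRingEnd ℂ) xs + I * xt
      - symR ℓ * (symE ℓ * xt + symF ℓ * (starRingEnd ℂ) xt)
      = symA ℓ * g + symB ℓ * (starRingEnd ℂ) g := by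
  have hg : g = xs + I * xt - (linPart ℓ * (xs - I * xt)
      + conjPart ℓ * (starRingEnd ℂ) (xs - I * xt)) := by
    rw [← apply_eq_linPart_add_conjPart, h]
    ring
  have hE : (symE ℓ : ℂ) = (symNum ℓ : ℂ) * symDet ℓ / symDenom ℓ := by simp [symE]
  have hF : symF ℓ = (symDet ℓ : ℂ) / symDenom ℓ * (-2 * conjPart ℓ) := by simp [symF]
  have hR : (symR ℓ : ℂ) = 2 * ((linPart ℓ).im : ℂ) / symDet ℓ := by simp [symR]
  have hA : symA ℓ = 1 / (symDenom ℓ : ℂ) * ((symNum ℓ : ℂ) * (1 - (starRingEnd ℂ) (linPart ℓ))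
    - 2 * (conjPart ℓ * (starRingEnd ℂ) (conjPart ℓ))) := by simp [symA]
  have hB : symB ℓ = 1 / (symDenom ℓ : ℂ) * (conjPart ℓ * ((symNum ℓ : ℂ)
    - 2 * (1 - linPart ℓ))) := by simp [symB]
  have hd' : (symDet ℓ : ℂ) ≠ 0 := by exact_mod_cast hd
  have hD' : (symDenom ℓ : ℂ) ≠ 0 := by exact_mod_cast hD
  rw [hE, hF, hR, hA, hB]
  have hdet : (symDet ℓ : ℂ) = (1 - linPart ℓ) * (1 - (starRingEnd ℂ) (linPart ℓ))
      - conjPart ℓ * (starRingEnd ℂ) (conjPart ℓ) := by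
    rw [symDet]
    push_cast
    rw [← Complex.mul_conj, ← Complex.mul_conj, map_sub, map_one]
  have hnum : (symNum ℓ : ℂ) = 1 - linPart ℓ * (starRingEnd ℂ) (linPart ℓ)
      + conjPart ℓ * (starRingEnd ℂ) (conjPart ℓ) := by
    rw [symNum]
    push_cast
    rw [← Complex.mul_conj, ← Complex.mul_conj]
  have hden : (symDenom ℓ : ℂ) = (symNum ℓ : ℂ) ^ 2
      - 4 * (conjPart ℓ * (starRingEnd ℂ) (conjPart ℓ)) := by
    rw [symDenom]
    push_cast
    rw [← Complex.mul_conj]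
  have him : 2 * ((linPart ℓ).im : ℂ) * I = linPart ℓ - (starRingEnd ℂ) (linPart ℓ) := by
    rw [Complex.sub_conj]
    push_cast
    ring
  have him' : 2 * ((linPart ℓ).im : ℂ) = -I * (linPart ℓ - (starRingEnd ℂ) (linPart ℓ)) := by
    rw [← him]
    linear_combination (2 * ((linPart ℓ).im : ℂ)) * I_mul_I
  rw [him']
  field_simp
  rw [hden, hnum, hdet, hg]
  simp only [map_neg, map_sub, map_add, map_mul, Complex.conj_I, Complex.conj_conj]
  ring

theorem exists_uniform_of_contDiffAt {E G : Type*} [NormedAddCommGroup E] [NormedSpace ℝ E]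
    [NormedAddCommGroup G] [NormedSpace ℝ G] {Φ : E → G} (hΦ : ContDiffAt ℝ 1 Φ 0) :
    ∃ K : ℝ, 0 ≤ K ∧ ∀ᶠ x in nhds (0 : E),
      ContDiffAt ℝ 1 Φ x ∧ ‖fderiv ℝ Φ x‖ ≤ K ∧ ‖Φ x - Φ 0‖ ≤ 1 / 4 := by
  refine ⟨‖fderiv ℝ Φ 0‖ + 1, by positivity, ?_⟩
  have h1 : ∀ᶠ x in nhds (0 : E), ContDiffAt ℝ 1 Φ x := hΦ.eventually (by simp)
  have h2 : ContinuousAt (fun x => ‖fderiv ℝ Φ x‖) 0 :=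
    (hΦ.fderiv_right (m := 0) (by simp)).continuousAt.norm
  have h3 : ContinuousAt (fun x => ‖Φ x - Φ 0‖) 0 :=
    (hΦ.continuousAt.sub continuousAt_const).norm
  have h2' := h2.eventually (gt_mem_nhds (lt_add_one _))
  have h0 : ‖Φ 0 - Φ 0‖ < 1 / 4 := by simp
  have h3' := h3.eventually (gt_mem_nhds h0)
  filter_upwards [h1, h2', h3'] with x hx1 hx2 hx3
  exact ⟨hx1, hx2.le, hx3.le⟩

theorem comp_of_contDiffAt {E G : Type*} [NormedAddCommGroup E] [NormedSpace ℝ E]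
    [NormedAddCommGroup G] [NormedSpace ℝ G] {Φ : E → G} {L : ℂ → E} {a K : ℝ}
    (hL : ContDiffOn ℝ 1 L (leftHalfPlane a))
    (hΦ : ∀ w ∈ leftHalfPlane a, ContDiffAt ℝ 1 Φ (L w) ∧ ‖fderiv ℝ Φ (L w)‖ ≤ K) :
    ContDiffOn ℝ 1 (fun w => Φ (L w)) (leftHalfPlane a) ∧
    ∀ w ∈ leftHalfPlane a, ∀ v : ℂ, ‖v‖ = 1 →
      ‖fderiv ℝ (fun w => Φ (L w)) w v‖ ≤ K * ‖fderiv ℝ L w‖ := by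
  refine ⟨fun w hw => (hΦ w hw).1.comp_contDiffWithinAt w (hL w hw), fun w hw v hv => ?_⟩
  have h1 := ((hΦ w hw).1.differentiableAt one_ne_zero).hasFDerivAt.comp w
    (hasFDerivAt_of_leftHalfPlane hL hw)
  have h2 : HasFDerivAt (fun w => Φ (L w)) _ w := h1
  rw [h2.fderiv]
  refine (ContinuousLinearMap.le_opNorm _ v).trans ?_
  rw [hv, mul_one]
  exact (ContinuousLinearMap.opNorm_comp_le _ _).trans
    (mul_le_mul_of_nonneg_right (hΦ w hw).2 (norm_nonneg _))

theorem exists_mul_exp_le {C δ : ℝ} (a : ℝ) (hδ : 0 < δ) :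
    ∃ b ≤ a, C * Real.exp b < δ := by
  have h : Tendsto (fun b => C * Real.exp b) atBot (nhds 0) := by
    simpa using Real.tendsto_exp_atBot.const_mul C
  obtain ⟨b, hb1, hb2⟩ := ((h.eventually (gt_mem_nhds hδ)).and (eventually_le_atBot a)).exists
  exact ⟨b, hb2, hb1⟩

theorem IsCylinderSolution.exists_isSymmetrizedSolution {a C : ℝ} {U : ℂ → ℂ}
    {F L : ℂ → (ℂ →L[ℝ] ℂ)} (h : IsCylinderSolution a C U F L) :
    ∃ b ≤ a, ∃ K : ℝ, ∃ f : ℂ → ℂ, ∃ e ρ : ℂ → ℝ, IsSymmetrizedSolution b K U f e ρ := by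
  obtain ⟨KE, hKE, hE⟩ := exists_uniform_of_contDiffAt contDiffAt_symE
  obtain ⟨KF, hKF, hF⟩ := exists_uniform_of_contDiffAt contDiffAt_symF
  obtain ⟨KR, hKR, hR⟩ := exists_uniform_of_contDiffAt contDiffAt_symR
  have hA := (continuousAt_symA.norm).eventually (gt_mem_nhds (lt_add_one _))
  have hB := (continuousAt_symB.norm).eventually (gt_mem_nhds (lt_add_one _))
  have hd := contDiff_symDet.continuous.continuousAt (x := 0) |>.eventually_ne
    (by simp [symDet_zero] : symDet 0 ≠ 0)
  have hD := contDiff_symDenom.continuous.continuousAt (x := 0) |>.eventually_ne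
    (by simp [symDenom_zero] : symDenom 0 ≠ 0)
  obtain ⟨δ, hδ, hball⟩ := Metric.eventually_nhds_iff_ball.1
    (hE.and (hF.and (hR.and (hA.and (hB.and (hd.and hD))))))
  have hE0 : symE 0 = 1 := by simp [symE, symNum_zero, symDet_zero, symDenom_zero]
  have hF0 : symF 0 = 0 := by simp [symF, conjPart]
  have hR0 : symR 0 = 0 := by simp [symR, linPart]
  set M := KE + KF + KR + (‖symA 0‖ + 1) + (‖symB 0‖ + 1) with hM
  have hM0 : 0 ≤ M := by positivity
  obtain ⟨b₁, hb₁a, hb₁⟩ := exists_mul_exp_le (C := C) a hδ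
  obtain ⟨b, hbb₁, hb⟩ := exists_mul_exp_le (C := M * C) b₁ one_pos
  have hba := hbb₁.trans hb₁a
  have hexp : ∀ w ∈ leftHalfPlane b, Real.exp w.re ≤ Real.exp b₁ := fun w hw =>
    Real.exp_le_exp.2 ((mem_leftHalfPlane.1 hw).le.trans hbb₁)
  have hC := h.nonneg
  have hmem : ∀ w ∈ leftHalfPlane b, L w ∈ Metric.ball 0 δ := by
    intro w hw
    rw [mem_ball_zero_iff]
    exact (h.bound_L w (leftHalfPlane_mono hba hw)).trans_lt
      ((mul_le_mul_of_nonneg_left (hexp w hw) hC).trans_lt hb₁)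
  have hLb := h.smooth_L.mono (leftHalfPlane_mono hba)
  obtain ⟨sE, dE⟩ := comp_of_contDiffAt (K := KE) hLb fun w hw =>
    ⟨(hball _ (hmem w hw)).1.1, (hball _ (hmem w hw)).1.2.1⟩
  obtain ⟨sF, dF⟩ := comp_of_contDiffAt (K := KF) hLb fun w hw =>
    ⟨(hball _ (hmem w hw)).2.1.1, (hball _ (hmem w hw)).2.1.2.1⟩
  obtain ⟨sR, dR⟩ := comp_of_contDiffAt (K := KR) hLb fun w hw =>
    ⟨(hball _ (hmem w hw)).2.2.1.1, (hball _ (hmem w hw)).2.2.1.2.1⟩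
  have hle : ∀ K₀, 0 ≤ K₀ → K₀ ≤ M → ∀ w ∈ leftHalfPlane b,
      K₀ * ‖fderiv ℝ L w‖ ≤ M * C * Real.exp w.re := by
    intro K₀ h0 h1 w hw
    rw [mul_assoc]
    exact mul_le_mul h1 (h.bound_fderiv_L w (leftHalfPlane_mono hba hw))
      (ContinuousLinearMap.opNorm_nonneg _) hM0
  have nA := norm_nonneg (symA 0)
  have nB := norm_nonneg (symB 0)
  have hKE' : KE ≤ M := by linarith
  have hKF' : KF ≤ M := by linarith
  have hKR' : KR ≤ M := by linarith
  refine ⟨b, hba, M * C, fun w => symF (L w), fun w => symE (L w), fun w => symR (L w), ?_⟩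
  exact {
    nonneg := mul_nonneg hM0 hC
    small := fun t ht => (mul_le_mul_of_nonneg_left (Real.exp_le_exp.2 ht.le)
      (mul_nonneg hM0 hC)).trans hb.le
    smooth := h.smooth.mono (leftHalfPlane_mono hba)
    smooth_e := sE
    smooth_f := sF
    smooth_ρ := sR
    periodic := h.periodic
    periodic_e := fun w => by simp only [h.periodic_L]
    periodic_f := fun w => by simp only [h.periodic_L]
    periodic_ρ := fun w => by simp only [h.periodic_L]
    bound_e := fun w hw => by
      have := (hball _ (hmem w hw)).1.2.2
      rwa [hE0] at this
    bound_f := fun w hw => by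
      have := (hball _ (hmem w hw)).2.1.2.2
      rwa [hF0, sub_zero] at this
    bound_ρ := fun w hw => by
      have := (hball _ (hmem w hw)).2.2.1.2.2
      rw [hR0, sub_zero] at this
      exact this.trans (by norm_num)
    fderiv_e_one := fun w hw => (dE w hw 1 (by simp)).trans (hle KE hKE hKE' w hw)
    fderiv_e_I := fun w hw => (dE w hw I (by simp)).trans (hle KE hKE hKE' w hw)
    fderiv_f_one := fun w hw => (dF w hw 1 (by simp)).trans (hle KF hKF hKF' w hw)
    fderiv_f_I := fun w hw => (dF w hw I (by simp)).trans (hle KF hKF hKF' w hw)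
    fderiv_ρ_I := fun w hw => (dR w hw I (by simp)).trans (hle KR hKR hKR' w hw)
    equation := fun w hw => by
      obtain ⟨-, -, -, hA', hB', hd', hD'⟩ := hball _ (hmem w hw)
      have hwa := leftHalfPlane_mono hba hw
      rw [symmetrize hd' hD' (h.equation w hwa)]
      have hg : ‖F w (U w)‖ ≤ C * Real.exp w.re * ‖U w‖ :=
        (ContinuousLinearMap.le_opNorm _ _).trans
          (mul_le_mul_of_nonneg_right (h.bound_F w hwa) (norm_nonneg _))
      calc _ ≤ ‖symA (L w)‖ * ‖F w (U w)‖ + ‖symB (L w)‖ * ‖F w (U w)‖ := by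
            refine (norm_add_le _ _).trans ?_
            rw [norm_mul, norm_mul, RCLike.norm_conj]
        _ = (‖symA (L w)‖ + ‖symB (L w)‖) * ‖F w (U w)‖ := by ring
        _ ≤ M * (C * Real.exp w.re * ‖U w‖) :=
            mul_le_mul (by linarith) hg (norm_nonneg _) hM0
        _ = _ := by ring }

end Cylinder

section Caccioppoli

theorem cutoff_estimate {P P' T R E : ℝ → ℝ} {s δ : ℝ} (hδ : 0 ≤ δ)
    (hP : ∀ t ∈ Set.Icc (s - δ) (s + δ), HasDerivAt P (P' t) t)
    (cP' : ContinuousOn P' (Set.Icc (s - δ) (s + δ))) (cT : ContinuousOn T (Set.Icc (s - δ) (s + δ)))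
    (cR : ContinuousOn R (Set.Icc (s - δ) (s + δ))) (cE : ContinuousOn E (Set.Icc (s - δ) (s + δ)))
    (hlow : ∀ t ∈ Set.Icc (s - δ) (s + δ), 1 / 2 * T t - R t ≤ P' t)
    (hCS : ∀ t ∈ Set.Icc (s - δ) (s + δ), ∀ x y : ℝ, 2 * x * y * P t ≤ x ^ 2 * T t + y ^ 2 * E t) :
    ∫ t in (s - δ)..(s + δ), 1 / 4 * (δ ^ 2 - (t - s) ^ 2) ^ 2 * T t
      ≤ ∫ t in (s - δ)..(s + δ),
        ((δ ^ 2 - (t - s) ^ 2) ^ 2 * R t + 16 * (t - s) ^ 2 * E t) := by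
  have hle : s - δ ≤ s + δ := by linarith
  have hη : ∀ t, HasDerivAt (fun t => (δ ^ 2 - (t - s) ^ 2) ^ 2)
      (2 * (δ ^ 2 - (t - s) ^ 2) * (-(2 * (t - s)))) t := by
    intro t
    have h := ((((hasDerivAt_id t).sub_const s).pow 2).const_sub (δ ^ 2)).pow 2
    refine h.congr_deriv ?_
    simp
  have cη : Continuous fun t : ℝ => (δ ^ 2 - (t - s) ^ 2) ^ 2 := by fun_prop
  have cη' : Continuous fun t : ℝ => 2 * (δ ^ 2 - (t - s) ^ 2) * (-(2 * (t - s))) := by fun_prop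
  have cP : ContinuousOn P (Set.Icc (s - δ) (s + δ)) :=
    fun t ht => (hP t ht).continuousAt.continuousWithinAt
  have c1 := (cη'.continuousOn (s := Set.Icc (s - δ) (s + δ))).fun_mul cP |>.fun_add
    (cη.continuousOn.fun_mul cP')
  have h0 : ∫ t in (s - δ)..(s + δ), (2 * (δ ^ 2 - (t - s) ^ 2) * (-(2 * (t - s))) * P t
      + (δ ^ 2 - (t - s) ^ 2) ^ 2 * P' t) = 0 := by
    rw [intervalIntegral.integral_eq_sub_of_hasDerivAt
      (f := fun t => (δ ^ 2 - (t - s) ^ 2) ^ 2 * P t)]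
    · ring
    · intro t ht
      rw [Set.uIcc_of_le hle] at ht
      exact (hη t).mul (hP t ht)
    · exact ContinuousOn.intervalIntegrable_of_Icc hle c1
  have c2 : ContinuousOn (fun t => 1 / 4 * (δ ^ 2 - (t - s) ^ 2) ^ 2 * T t)
      (Set.Icc (s - δ) (s + δ)) := (continuous_const.mul cη).continuousOn.fun_mul cT
  have c3 : ContinuousOn (fun t => (δ ^ 2 - (t - s) ^ 2) ^ 2 * R t + 16 * (t - s) ^ 2 * E t)
      (Set.Icc (s - δ) (s + δ)) :=
    (cη.continuousOn.fun_mul cR).fun_add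
      ((by fun_prop : Continuous fun t : ℝ => 16 * (t - s) ^ 2).continuousOn.fun_mul cE)
  have i1 := ContinuousOn.intervalIntegrable_of_Icc (μ := MeasureTheory.volume) hle c1
  have i2 := ContinuousOn.intervalIntegrable_of_Icc (μ := MeasureTheory.volume) hle c2
  have i3 := ContinuousOn.intervalIntegrable_of_Icc (μ := MeasureTheory.volume) hle c3
  have h1 : ∫ t in (s - δ)..(s + δ), 1 / 4 * (δ ^ 2 - (t - s) ^ 2) ^ 2 * T t
      ≤ ∫ t in (s - δ)..(s + δ), ((2 * (δ ^ 2 - (t - s) ^ 2) * (-(2 * (t - s))) * P t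
        + (δ ^ 2 - (t - s) ^ 2) ^ 2 * P' t)
        + ((δ ^ 2 - (t - s) ^ 2) ^ 2 * R t + 16 * (t - s) ^ 2 * E t)) := by
    refine intervalIntegral.integral_mono_on hle i2 (i1.add i3) fun t ht => ?_
    have e1 := hlow t ht
    have e2 := hCS t ht ((δ ^ 2 - (t - s) ^ 2) / 2) (4 * (t - s))
    have e3 := mul_le_mul_of_nonneg_left e1 (sq_nonneg (δ ^ 2 - (t - s) ^ 2))
    nlinarith
  rwa [intervalIntegral.integral_add i1 i3, h0, zero_add] at h1

theorem two_mul_im_le (x y : ℝ) (p q : ℂ) :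
    2 * x * y * (p * (starRingEnd ℂ) q).im ≤ x ^ 2 * ‖p‖ ^ 2 + y ^ 2 * ‖q‖ ^ 2 := by
  have h : |(p * (starRingEnd ℂ) q).im| ≤ ‖p‖ * ‖q‖ := by
    refine (Complex.abs_im_le_norm _).trans ?_
    rw [norm_mul, RCLike.norm_conj]
  calc 2 * x * y * (p * (starRingEnd ℂ) q).im ≤ |2 * x * y * (p * (starRingEnd ℂ) q).im| :=
        le_abs_self _
    _ = 2 * |x| * |y| * |(p * (starRingEnd ℂ) q).im| := by
        rw [abs_mul, abs_mul, abs_mul, abs_two]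
    _ ≤ 2 * |x| * |y| * (‖p‖ * ‖q‖) := by gcongr
    _ ≤ |x| ^ 2 * ‖p‖ ^ 2 + |y| ^ 2 * ‖q‖ ^ 2 := by
        nlinarith [sq_nonneg (|x| * ‖p‖ - |y| * ‖q‖)]
    _ = _ := by rw [sq_abs, sq_abs]

theorem two_mul_im_eq (p q : ℂ) :
    2 * (p * (starRingEnd ℂ) q).im = ‖q‖ ^ 2 + ‖p‖ ^ 2 - ‖q + I * p‖ ^ 2 := by
  simp only [← Complex.normSq_eq_norm_sq, Complex.normSq_apply]
  simp
  ring

variable {a : ℝ} {E : ℂ → ℂ} {R : ℂ → ℝ}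

theorem continuousOn_normSq_fderiv (hE : ContDiffOn ℝ 1 E (leftHalfPlane a)) (v : ℂ) :
    ContinuousOn (fun w => ‖fderiv ℝ E w v‖ ^ 2) (leftHalfPlane a) :=
  (continuousOn_fderiv_apply hE v).norm.pow 2

theorem caccioppoli (hE : ContDiffOn ℝ 1 E (leftHalfPlane a))
    (hper : ∀ w, E (w + 2 * Real.pi * I) = E w) (hR : ContinuousOn R (leftHalfPlane a))
    (heq : ∀ w ∈ leftHalfPlane a, ‖fderiv ℝ E w 1 + I * fderiv ℝ E w I‖ ^ 2
      ≤ 1 / 2 * ‖fderiv ℝ E w I‖ ^ 2 + R w) {s δ : ℝ} (hδ : 0 ≤ δ) (hs : s + δ < a) :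
    ∫ t in (s - δ)..(s + δ),
        1 / 4 * (δ ^ 2 - (t - s) ^ 2) ^ 2 * segInt (fun w => ‖fderiv ℝ E w I‖ ^ 2) t
      ≤ ∫ t in (s - δ)..(s + δ),
        ((δ ^ 2 - (t - s) ^ 2) ^ 2 * segInt R t
          + 16 * (t - s) ^ 2 * segInt (fun w => ‖E w‖ ^ 2) t) := by
  have hsub : Set.Icc (s - δ) (s + δ) ⊆ Set.Iio a := fun t ht => ht.2.trans_lt hs
  have cT := continuousOn_normSq_fderiv hE I
  have cN : ContinuousOn (fun w => ‖E w‖ ^ 2) (leftHalfPlane a) := hE.continuousOn.norm.pow 2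
  have cP : ContinuousOn (fun w => 2 * (fderiv ℝ E w I * (starRingEnd ℂ) (fderiv ℝ E w 1)).im)
      (leftHalfPlane a) := continuousOn_const.fun_mul
    (Complex.continuous_im.comp_continuousOn ((continuousOn_fderiv_apply hE I).mul
      (Complex.continuous_conj.comp_continuousOn (continuousOn_fderiv_apply hE 1))))
  have cQ : ContinuousOn (fun w => (fderiv ℝ E w I * (starRingEnd ℂ) (E w)).im)
      (leftHalfPlane a) :=
    Complex.continuous_im.comp_continuousOn ((continuousOn_fderiv_apply hE I).mul
      (Complex.continuous_conj.comp_continuousOn hE.continuousOn))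
  refine cutoff_estimate hδ
    (fun t ht => hasDerivAt_segInt_im hE hper (hsub ht))
    ((continuousOn_segInt cP).mono hsub) ((continuousOn_segInt cT).mono hsub)
    ((continuousOn_segInt hR).mono hsub) ((continuousOn_segInt cN).mono hsub) ?_ ?_
  · intro t ht
    rw [← segInt_const_mul, ← segInt_sub (continuousOn_const.fun_mul cT) hR (hsub ht)]
    refine segInt_mono ((continuousOn_const.fun_mul cT).sub hR) cP (hsub ht) fun w hw => ?_
    have h1 := heq w (by rw [mem_leftHalfPlane, hw]; exact hsub ht)
    rw [two_mul_im_eq]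
    nlinarith [sq_nonneg ‖fderiv ℝ E w 1‖]
  · intro t ht x y
    rw [← segInt_const_mul, ← segInt_const_mul, ← segInt_const_mul,
      ← segInt_add (continuousOn_const.fun_mul cT) (continuousOn_const.fun_mul cN) (hsub ht)]
    exact segInt_mono (continuousOn_const.fun_mul cQ)
      ((continuousOn_const.fun_mul cT).add (continuousOn_const.fun_mul cN)) (hsub ht)
      fun w _ => two_mul_im_le x y _ _

end Caccioppoli

section LocalBounds

theorem cutoff_sup {N N' T R : ℝ → ℝ} {s : ℝ}
    (hN : ∀ t ∈ Set.Icc (s - 1 / 2) (s + 1 / 2), HasDerivAt N (N' t) t)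
    (cN' : ContinuousOn N' (Set.Icc (s - 1 / 2) (s + 1 / 2)))
    (cT : ContinuousOn T (Set.Icc (s - 1 / 2) (s + 1 / 2)))
    (cR : ContinuousOn R (Set.Icc (s - 1 / 2) (s + 1 / 2)))
    (hN0 : ∀ t ∈ Set.Icc (s - 1 / 2) (s + 1 / 2), 0 ≤ N t)
    (hT0 : ∀ t ∈ Set.Icc (s - 1 / 2) (s + 1 / 2), 0 ≤ T t)
    (hR0 : ∀ t ∈ Set.Icc (s - 1 / 2) (s + 1 / 2), 0 ≤ R t)
    (hup : ∀ t ∈ Set.Icc (s - 1 / 2) (s + 1 / 2), N' t ≤ 3 * T t + 2 * R t + N t)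
    (hcac : ∫ t in (s - 1 / 2)..(s + 1 / 2), 1 / 4 * ((1 / 2) ^ 2 - (t - s) ^ 2) ^ 2 * T t
      ≤ ∫ t in (s - 1 / 2)..(s + 1 / 2),
        (((1 / 2) ^ 2 - (t - s) ^ 2) ^ 2 * R t + 16 * (t - s) ^ 2 * N t)) :
    N s ≤ 800 * ∫ t in (s - 1 / 2)..(s + 1 / 2), (N t + R t) := by
  have hle : s - 1 / 2 ≤ s + 1 / 2 := by linarith
  have hle' : s - 1 / 2 ≤ s := by linarith
  have hsub : Set.Icc (s - 1 / 2) s ⊆ Set.Icc (s - 1 / 2) (s + 1 / 2) :=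
    Set.Icc_subset_Icc_right (by linarith)
  have hη : ∀ t, HasDerivAt (fun t : ℝ => ((1 / 2) ^ 2 - (t - s) ^ 2) ^ 2)
      (2 * ((1 / 2) ^ 2 - (t - s) ^ 2) * (-(2 * (t - s)))) t := by
    intro t
    have h := ((((hasDerivAt_id t).sub_const s).pow 2).const_sub ((1 / 2 : ℝ) ^ 2)).pow 2
    refine h.congr_deriv ?_
    simp
  have cη : Continuous fun t : ℝ => ((1 / 2 : ℝ) ^ 2 - (t - s) ^ 2) ^ 2 := by fun_prop
  have cη' : Continuous fun t : ℝ =>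
    2 * ((1 / 2 : ℝ) ^ 2 - (t - s) ^ 2) * (-(2 * (t - s))) := by fun_prop
  have cN : ContinuousOn N (Set.Icc (s - 1 / 2) (s + 1 / 2)) :=
    fun t ht => (hN t ht).continuousAt.continuousWithinAt
  have c1 : ContinuousOn (fun t => 2 * ((1 / 2 : ℝ) ^ 2 - (t - s) ^ 2) * (-(2 * (t - s))) * N t
      + ((1 / 2) ^ 2 - (t - s) ^ 2) ^ 2 * N' t) (Set.Icc (s - 1 / 2) (s + 1 / 2)) :=
    (cη'.continuousOn.fun_mul cN).fun_add (cη.continuousOn.fun_mul cN')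
  have h0 : ∫ t in (s - 1 / 2)..s, (2 * ((1 / 2) ^ 2 - (t - s) ^ 2) * (-(2 * (t - s))) * N t
      + ((1 / 2) ^ 2 - (t - s) ^ 2) ^ 2 * N' t) = 1 / 16 * N s := by
    rw [intervalIntegral.integral_eq_sub_of_hasDerivAt
      (f := fun t => ((1 / 2) ^ 2 - (t - s) ^ 2) ^ 2 * N t)]
    · ring
    · intro t ht
      rw [Set.uIcc_of_le hle'] at ht
      exact (hη t).mul (hN t (hsub ht))
    · exact ContinuousOn.intervalIntegrable_of_Icc hle' (c1.mono hsub)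
  have c2 : ContinuousOn (fun t => 1 / 4 * ((1 / 2 : ℝ) ^ 2 - (t - s) ^ 2) ^ 2 * T t)
      (Set.Icc (s - 1 / 2) (s + 1 / 2)) := (continuous_const.mul cη).continuousOn.fun_mul cT
  have c3 : ContinuousOn (fun t => ((1 / 2 : ℝ) ^ 2 - (t - s) ^ 2) ^ 2 * R t
      + 16 * (t - s) ^ 2 * N t) (Set.Icc (s - 1 / 2) (s + 1 / 2)) :=
    (cη.continuousOn.fun_mul cR).fun_add
      ((by fun_prop : Continuous fun t : ℝ => 16 * (t - s) ^ 2).continuousOn.fun_mul cN)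
  have c4 := cN.fun_add cR
  have i1 := ContinuousOn.intervalIntegrable_of_Icc (μ := MeasureTheory.volume) hle' (c1.mono hsub)
  have i2 := ContinuousOn.intervalIntegrable_of_Icc (μ := MeasureTheory.volume) hle c2
  have i3 := ContinuousOn.intervalIntegrable_of_Icc (μ := MeasureTheory.volume) hle c3
  have i4 := ContinuousOn.intervalIntegrable_of_Icc (μ := MeasureTheory.volume) hle c4
  have i5 := (i2.const_mul 12).add i4
  have hηb : ∀ t ∈ Set.Icc (s - 1 / 2) (s + 1 / 2),
      0 ≤ (1 / 2 : ℝ) ^ 2 - (t - s) ^ 2 ∧ (1 / 2 : ℝ) ^ 2 - (t - s) ^ 2 ≤ 1 / 4 := by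
    intro t ht
    constructor <;> nlinarith [ht.1, ht.2, sq_nonneg (t - s)]
  have h1 : 1 / 16 * N s ≤ ∫ t in (s - 1 / 2)..s,
      (12 * (1 / 4 * ((1 / 2) ^ 2 - (t - s) ^ 2) ^ 2 * T t) + (N t + R t)) := by
    rw [← h0]
    refine intervalIntegral.integral_mono_on hle' i1
      (i5.mono_set (by rw [Set.uIcc_of_le hle, Set.uIcc_of_le hle']; exact hsub)) fun t ht => ?_
    have ht' := hsub ht
    obtain ⟨b1, b2⟩ := hηb t ht'
    set η := (1 / 2 : ℝ) ^ 2 - (t - s) ^ 2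
    have e1 := mul_le_mul_of_nonneg_left (hup t ht') (sq_nonneg η)
    have e2 : 2 * η * (-(2 * (t - s))) ≤ 1 / 2 := by nlinarith [ht.1, ht.2]
    have e3 := mul_le_mul_of_nonneg_right e2 (hN0 t ht')
    have e4 : η ^ 2 ≤ 1 / 16 := by nlinarith
    have e5 := mul_le_mul_of_nonneg_right e4 (hN0 t ht')
    have e6 := mul_le_mul_of_nonneg_right e4 (hR0 t ht')
    have := hN0 t ht'
    have := hR0 t ht'
    linarith
  have h2 : ∫ t in (s - 1 / 2)..s,
      (12 * (1 / 4 * ((1 / 2) ^ 2 - (t - s) ^ 2) ^ 2 * T t) + (N t + R t))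
      ≤ ∫ t in (s - 1 / 2)..(s + 1 / 2),
      (12 * (1 / 4 * ((1 / 2) ^ 2 - (t - s) ^ 2) ^ 2 * T t) + (N t + R t)) := by
    refine intervalIntegral.integral_mono_interval le_rfl hle' (by linarith) ?_ i5
    filter_upwards [MeasureTheory.ae_restrict_mem measurableSet_Ioc] with t ht
    have ht' := Set.Ioc_subset_Icc_self ht
    have := hN0 t ht'
    have := hR0 t ht'
    have := hT0 t ht'
    simp only [Pi.zero_apply]
    positivity
  have h3 : ∫ t in (s - 1 / 2)..(s + 1 / 2),
        (((1 / 2) ^ 2 - (t - s) ^ 2) ^ 2 * R t + 16 * (t - s) ^ 2 * N t)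
      ≤ ∫ t in (s - 1 / 2)..(s + 1 / 2), 4 * (N t + R t) := by
    refine intervalIntegral.integral_mono_on hle i3 (i4.const_mul 4) fun t ht => ?_
    obtain ⟨b1, b2⟩ := hηb t ht
    have e4 : ((1 / 2 : ℝ) ^ 2 - (t - s) ^ 2) ^ 2 ≤ 4 := by nlinarith
    have e5 := mul_le_mul_of_nonneg_right e4 (hR0 t ht)
    have e6 : 16 * (t - s) ^ 2 ≤ 4 := by nlinarith
    have e7 := mul_le_mul_of_nonneg_right e6 (hN0 t ht)
    linarith
  rw [intervalIntegral.integral_add (i2.const_mul 12) i4, intervalIntegral.integral_const_mul] at h2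
  rw [intervalIntegral.integral_const_mul] at h3
  have h4 : 0 ≤ ∫ t in (s - 1 / 2)..(s + 1 / 2), (N t + R t) :=
    intervalIntegral.integral_nonneg hle fun t ht => add_nonneg (hN0 t ht) (hR0 t ht)
  linarith

variable {a s : ℝ} {E : ℂ → ℂ} {R : ℂ → ℝ}

theorem contDiffOn_normSq (hE : ContDiffOn ℝ 1 E (leftHalfPlane a)) :
    ContDiffOn ℝ 1 (fun w => ‖E w‖ ^ 2) (leftHalfPlane a) := by
  simp only [← Complex.normSq_eq_norm_sq]
  exact contDiff_normSq.comp_contDiffOn hE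

theorem fderiv_normSq_le (hE : ContDiffOn ℝ 1 E (leftHalfPlane a)) {w : ℂ}
    (hw : w ∈ leftHalfPlane a) :
    fderiv ℝ (fun w => ‖E w‖ ^ 2) w 1 ≤ ‖fderiv ℝ E w 1‖ ^ 2 + ‖E w‖ ^ 2 := by
  have h := (hasFDerivAt_of_leftHalfPlane hE hw).norm_sq
  rw [h.fderiv]
  have h1 := real_inner_le_norm (E w) (fderiv ℝ E w 1)
  simp only [smul_apply, ContinuousLinearMap.comp_apply, innerSL_apply_apply,
    nsmul_eq_mul, Nat.cast_ofNat]
  nlinarith [sq_nonneg (‖E w‖ - ‖fderiv ℝ E w 1‖)]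

theorem local_sup_bound (hE : ContDiffOn ℝ 1 E (leftHalfPlane a))
    (hper : ∀ w, E (w + 2 * Real.pi * I) = E w) (hR : ContinuousOn R (leftHalfPlane a))
    (heq : ∀ w ∈ leftHalfPlane a, ‖fderiv ℝ E w 1 + I * fderiv ℝ E w I‖ ^ 2
      ≤ 1 / 2 * ‖fderiv ℝ E w I‖ ^ 2 + R w)
    (hR0 : ∀ w ∈ leftHalfPlane a, 0 ≤ R w) (hs : s + 1 / 2 < a) :
    segInt (fun w => ‖E w‖ ^ 2) s ≤ 800 * ∫ t in (s - 1 / 2)..(s + 1 / 2),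
      (segInt (fun w => ‖E w‖ ^ 2) t + segInt R t) := by
  have hsub : Set.Icc (s - 1 / 2) (s + 1 / 2) ⊆ Set.Iio a := fun t ht => ht.2.trans_lt hs
  have hN := contDiffOn_normSq hE
  have cN := hN.continuousOn
  have cT := continuousOn_normSq_fderiv hE I
  have cN' := continuousOn_fderiv_apply hN 1
  refine cutoff_sup (fun t ht => hasDerivAt_segInt hN (hsub ht))
    ((continuousOn_segInt cN').mono hsub) ((continuousOn_segInt cT).mono hsub)
    ((continuousOn_segInt hR).mono hsub) (fun t _ => segInt_nonneg fun w _ => by positivity)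
    (fun t _ => segInt_nonneg fun w _ => by positivity)
    (fun t ht => segInt_nonneg fun w hw => hR0 w (by rw [mem_leftHalfPlane, hw]; exact hsub ht))
    (fun t ht => ?_) (caccioppoli hE hper hR heq (by norm_num) hs)
  have c1 := continuousOn_const (c := (3 : ℝ)).fun_mul cT
  have c2 := continuousOn_const (c := (2 : ℝ)).fun_mul hR
  rw [← segInt_const_mul, ← segInt_const_mul, ← segInt_add c1 c2 (hsub ht),
    ← segInt_add (c1.fun_add c2) cN (hsub ht)]
  refine segInt_mono cN' ((c1.fun_add c2).fun_add cN) (hsub ht) fun w hw => ?_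
  have hw' : w ∈ leftHalfPlane a := by rw [mem_leftHalfPlane, hw]; exact hsub ht
  have h1 := fderiv_normSq_le hE hw'
  have h2 := heq w hw'
  set p := fderiv ℝ E w 1
  set q := fderiv ℝ E w I
  have h3 : ‖p‖ ≤ ‖p + I * q‖ + ‖q‖ := by
    have := norm_sub_le (p + I * q) (I * q)
    simpa using this
  nlinarith [sq_nonneg (‖p + I * q‖ - ‖q‖), norm_nonneg p]

theorem exists_uniform_diffQuot {f : ℂ → ℂ} (hf : ContDiffOn ℝ 1 f (leftHalfPlane a)) {b c ε : ℝ}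
    (hc : c < a) (hε : 0 < ε) :
    ∃ h : ℝ, 0 < h ∧ ∀ t ∈ Set.Icc b c, ∀ θ ∈ Set.Icc (0 : ℝ) (2 * Real.pi),
      ‖(h : ℂ)⁻¹ * (f (t + θ * I + h * I) - f (t + θ * I)) - fderiv ℝ f (t + θ * I) I‖ ≤ ε := by
  have hK : IsCompact ((fun p : ℝ × ℝ => (p.1 + p.2 * I : ℂ)) ''
      (Set.Icc b c ×ˢ Set.Icc 0 (2 * Real.pi + 1))) :=
    (isCompact_Icc.prod isCompact_Icc).image (by fun_prop)
  set K := (fun p : ℝ × ℝ => (p.1 + p.2 * I : ℂ)) '' (Set.Icc b c ×ˢ Set.Icc 0 (2 * Real.pi + 1))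
    with hKdef
  have hsub : K ⊆ leftHalfPlane a := by
    rintro _ ⟨⟨t, θ⟩, ⟨ht, -⟩, rfl⟩
    exact seg_mem (ht.2.trans_lt hc) θ
  have huc := hK.uniformContinuousOn_of_continuous ((continuousOn_fderiv_apply hf I).mono hsub)
  obtain ⟨δ, hδ, hd⟩ := Metric.uniformContinuousOn_iff.1 huc ε hε
  refine ⟨min (δ / 2) 1, by positivity, fun t ht θ hθ => ?_⟩
  set h := min (δ / 2) 1 with hh
  have hpos : 0 < h := by positivity
  have hmem : ∀ τ ∈ Set.Icc 0 h, (t + θ * I + τ * I : ℂ) ∈ K := by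
    intro τ hτ
    refine ⟨(t, θ + τ), ⟨ht, ⟨add_nonneg hθ.1 hτ.1, ?_⟩⟩, ?_⟩
    · exact add_le_add hθ.2 (hτ.2.trans (min_le_right _ _))
    · push_cast
      ring
  have hw : (t + θ * I : ℂ) ∈ leftHalfPlane a := seg_mem (ht.2.trans_lt hc) θ
  have hder : ∀ τ : ℝ, HasDerivAt
      (fun τ : ℝ => f (t + θ * I + τ * I) - τ * fderiv ℝ f (t + θ * I) I)
      (fderiv ℝ f (t + θ * I + τ * I) I - 1 * fderiv ℝ f (t + θ * I) I) τ := fun τ =>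
    (hasDerivAt_vertical hf hw τ).sub ((Complex.ofRealCLM.hasDerivAt (x := τ)).mul_const _)
  have h0 := hmem 0 ⟨le_rfl, hpos.le⟩
  have key := norm_image_sub_le_of_norm_deriv_le_segment'
    (fun τ _ => (hder τ).hasDerivWithinAt) (C := ε) (a := 0) (b := h) ?_ h ⟨hpos.le, le_rfl⟩
  · have e : (h : ℂ)⁻¹ * (f (t + θ * I + h * I) - f (t + θ * I)) - fderiv ℝ f (t + θ * I) I
        = (h : ℂ)⁻¹ * ((f (t + θ * I + h * I) - h * fderiv ℝ f (t + θ * I) I)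
          - (f (t + θ * I + (0 : ℝ) * I) - (0 : ℝ) * fderiv ℝ f (t + θ * I) I)) := by
      have : (h : ℂ) ≠ 0 := by exact_mod_cast hpos.ne'
      field_simp
      simp
      ring
    rw [e, norm_mul, norm_inv, Complex.norm_real, Real.norm_of_nonneg hpos.le,
      inv_mul_le_iff₀ hpos]
    simpa [mul_comm] using key
  · intro τ hτ
    rw [one_mul, ← dist_eq_norm]
    simp only [ofReal_zero, zero_mul, add_zero] at h0
    refine (hd _ (hmem τ (Set.Ico_subset_Icc_self hτ)) _ h0 ?_).le
    rw [dist_eq_norm, add_sub_cancel_left, norm_mul, Complex.norm_I, mul_one, Complex.norm_real,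
      Real.norm_of_nonneg hτ.1]
    exact hτ.2.trans_le ((min_le_left _ _).trans (by linarith))

end LocalBounds

section DerivativeBounds

variable {a C s : ℝ} {U : ℂ → ℂ} {F L : ℂ → (ℂ →L[ℝ] ℂ)}

theorem norm_shift_sub_le {E : Type*} [NormedAddCommGroup E] [NormedSpace ℝ E] {f : ℂ → E}
    (hf : ContDiffOn ℝ 1 f (leftHalfPlane a))
    (hb : ∀ w ∈ leftHalfPlane a, ‖fderiv ℝ f w‖ ≤ C * Real.exp w.re) {w : ℂ}
    (hw : w ∈ leftHalfPlane a) {h : ℝ} (hh : 0 ≤ h) :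
    ‖f (w + h * I) - f w‖ ≤ C * Real.exp w.re * h := by
  have key := norm_image_sub_le_of_norm_deriv_le_segment'
    (fun τ _ => (hasDerivAt_vertical hf hw τ).hasDerivWithinAt) (C := C * Real.exp w.re)
    (a := 0) (b := h) (fun τ _ => ?_) h ⟨hh, le_rfl⟩
  · simpa using key
  · have hw' : w + τ * I ∈ leftHalfPlane a := by simpa [mem_leftHalfPlane] using hw
    have h1 := ContinuousLinearMap.le_opNorm (fderiv ℝ f (w + τ * I)) I
    have h2 := hb _ hw'
    simp only [Complex.norm_I, mul_one] at h1
    refine h1.trans (h2.trans (le_of_eq ?_))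
    simp

theorem IsCylinderSolution.mul_exp_le (h : IsCylinderSolution a C U F L)
    (hC : C * Real.exp a ≤ 1 / 100) {w : ℂ} (hw : w ∈ leftHalfPlane a) :
    C * Real.exp w.re ≤ 1 / 100 :=
  (mul_le_mul_of_nonneg_left (Real.exp_le_exp.2 (mem_leftHalfPlane.1 hw).le) h.nonneg).trans hC

theorem norm_dz_le (p q : ℂ) : ‖p - I * q‖ ≤ ‖p + I * q‖ + 2 * ‖q‖ := by
  have h := norm_sub_le (p + I * q) (2 * (I * q))
  rw [norm_mul, norm_mul, Complex.norm_I, one_mul, Complex.norm_ofNat] at h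
  refine le_trans (le_of_eq (congrArg _ ?_)) h
  ring

theorem IsCylinderSolution.norm_dbar_le (h : IsCylinderSolution a C U F L)
    (hC : C * Real.exp a ≤ 1 / 100) {w : ℂ} (hw : w ∈ leftHalfPlane a) :
    ‖fderiv ℝ U w 1 + I * fderiv ℝ U w I‖
      ≤ 3 * (C * Real.exp w.re) * (‖U w‖ + ‖fderiv ℝ U w I‖) := by
  have h0 := h.mul_exp_le hC hw
  have hε : 0 ≤ C * Real.exp w.re := mul_nonneg h.nonneg (Real.exp_pos _).le
  have h1 := norm_dz_le (fderiv ℝ U w 1) (fderiv ℝ U w I)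
  have h2 := (F w).le_of_opNorm_le (h.bound_F w hw) (U w)
  have h3 := (L w).le_of_opNorm_le (h.bound_L w hw) (fderiv ℝ U w 1 - I * fderiv ℝ U w I)
  have h4 := norm_add_le (F w (U w)) (L w (fderiv ℝ U w 1 - I * fderiv ℝ U w I))
  rw [← h.equation w hw] at h4
  set G := ‖fderiv ℝ U w 1 + I * fderiv ℝ U w I‖
  set X := ‖fderiv ℝ U w 1 - I * fderiv ℝ U w I‖
  set ε := C * Real.exp w.re
  have hG : 0 ≤ G := norm_nonneg _
  have h5 := mul_le_mul_of_nonneg_left h1 hε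
  have h6 := mul_le_mul_of_nonneg_right h0 hG
  have h7 : 0 ≤ ε * ‖U w‖ := by positivity
  have h8 : 0 ≤ ε * ‖fderiv ℝ U w I‖ := by positivity
  nlinarith

theorem fderiv_diffQuot {U : ℂ → ℂ} (hU : ContDiffOn ℝ 1 U (leftHalfPlane a)) (h : ℝ) {w : ℂ}
    (hw : w ∈ leftHalfPlane a) (v : ℂ) :
    fderiv ℝ (fun w => (h : ℂ)⁻¹ * (U (w + h * I) - U w)) w v
      = (h : ℂ)⁻¹ * (fderiv ℝ U (w + h * I) v - fderiv ℝ U w v) := by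
  have hw' : w + h * I ∈ leftHalfPlane a := by simpa [mem_leftHalfPlane] using hw
  have h1 : HasFDerivAt (fun w => U (w + h * I)) (fderiv ℝ U (w + h * I)) w :=
    (hasFDerivAt_comp_add_right (h * I : ℂ)).2 (hasFDerivAt_of_leftHalfPlane hU hw')
  have h2 := (h1.sub (hasFDerivAt_of_leftHalfPlane hU hw)).const_mul (h : ℂ)⁻¹
  have h3 := h2.fderiv
  refine (congrArg (fun T : ℂ →L[ℝ] ℂ => T v) h3).trans ?_
  simp

theorem contDiffOn_shift {E : Type*} [NormedAddCommGroup E] [NormedSpace ℝ E] {f : ℂ → E}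
    (hf : ContDiffOn ℝ 1 f (leftHalfPlane a)) (h : ℝ) :
    ContDiffOn ℝ 1 (fun w => f (w + h * I)) (leftHalfPlane a) :=
  hf.comp (contDiff_id.add contDiff_const).contDiffOn
    fun w hw => by simpa [mem_leftHalfPlane] using hw

theorem contDiffOn_diffQuot {U : ℂ → ℂ} (hU : ContDiffOn ℝ 1 U (leftHalfPlane a)) (h : ℝ) :
    ContDiffOn ℝ 1 (fun w => (h : ℂ)⁻¹ * (U (w + h * I) - U w)) (leftHalfPlane a) :=
  contDiffOn_const.mul ((contDiffOn_shift hU h).sub hU)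

/-- Difference quotients in the periodic direction satisfy the same type of inequality. -/
theorem IsCylinderSolution.dbar_diffQuot_le (H : IsCylinderSolution a C U F L)
    (hC : C * Real.exp a ≤ 1 / 100) {h : ℝ} (hh : 0 < h) {D : ℂ → ℂ}
    (hD : D = fun w => (h : ℂ)⁻¹ * (U (w + h * I) - U w)) {w : ℂ} (hw : w ∈ leftHalfPlane a) :
    ‖fderiv ℝ D w 1 + I * fderiv ℝ D w I‖ ^ 2 ≤ 1 / 2 * ‖fderiv ℝ D w I‖ ^ 2
      + (‖D w‖ ^ 2 + (‖U (w + h * I)‖ ^ 2 + ‖fderiv ℝ U (w + h * I) I‖ ^ 2)) := by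
  have hw' : w + h * I ∈ leftHalfPlane a := by simpa [mem_leftHalfPlane] using hw
  have hre : (w + h * I).re = w.re := by simp
  have h0 := H.mul_exp_le hC hw
  have hε : 0 ≤ C * Real.exp w.re := mul_nonneg H.nonneg (Real.exp_pos _).le
  have e1 : D w = (h : ℂ)⁻¹ * (U (w + h * I) - U w) := by rw [hD]
  have e2 : ∀ v, fderiv ℝ D w v = (h : ℂ)⁻¹ * (fderiv ℝ U (w + h * I) v - fderiv ℝ U w v) := by
    intro v
    rw [hD]
    exact fderiv_diffQuot H.smooth h hw v
  have hG' := H.norm_dbar_le hC hw'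
  have hX' := norm_dz_le (fderiv ℝ U (w + h * I) 1) (fderiv ℝ U (w + h * I) I)
  have hXD := norm_dz_le (fderiv ℝ D w 1) (fderiv ℝ D w I)
  have hq := H.equation w hw
  have hq' := H.equation _ hw'
  have hsm : ∀ z : ℂ, (h : ℂ)⁻¹ * z = (h⁻¹ : ℝ) • z := by
    intro z
    rw [Complex.real_smul, Complex.ofReal_inv]
  have eQ : fderiv ℝ D w 1 + I * fderiv ℝ D w I
      = F w (D w) + (h⁻¹ : ℝ) • ((F (w + h * I) - F w) (U (w + h * I)))
        + L w (fderiv ℝ D w 1 - I * fderiv ℝ D w I)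
        + (h⁻¹ : ℝ) • ((L (w + h * I) - L w)
          (fderiv ℝ U (w + h * I) 1 - I * fderiv ℝ U (w + h * I) I)) := by
    have l1 : F w (D w) = (h : ℂ)⁻¹ * (F w (U (w + h * I)) - F w (U w)) := by
      rw [e1, hsm, hsm, map_smul, map_sub]
    have l2 : L w (fderiv ℝ D w 1 - I * fderiv ℝ D w I) = (h : ℂ)⁻¹ *
        (L w (fderiv ℝ U (w + h * I) 1 - I * fderiv ℝ U (w + h * I) I)
          - L w (fderiv ℝ U w 1 - I * fderiv ℝ U w I)) := by
      rw [e2, e2, hsm, hsm, hsm, ← map_sub, ← map_smul]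
      congr 1
      simp only [Complex.real_smul]
      ring
    rw [l1, l2, ← hsm, ← hsm, sub_apply, sub_apply, e2, e2]
    linear_combination (h : ℂ)⁻¹ * (hq' - hq)
  have n1 := (F w).le_of_opNorm_le (H.bound_F w hw) (D w)
  have n2 := (L w).le_of_opNorm_le (H.bound_L w hw) (fderiv ℝ D w 1 - I * fderiv ℝ D w I)
  have n3 : ∀ {M : ℂ → (ℂ →L[ℝ] ℂ)}, ContDiffOn ℝ 1 M (leftHalfPlane a) →
      (∀ w ∈ leftHalfPlane a, ‖fderiv ℝ M w‖ ≤ C * Real.exp w.re) → ∀ z,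
      ‖(h⁻¹ : ℝ) • ((M (w + h * I) - M w) z)‖ ≤ C * Real.exp w.re * ‖z‖ := by
    intro M hM hb z
    rw [norm_smul, norm_inv, Real.norm_of_nonneg hh.le, inv_mul_le_iff₀ hh]
    refine ((M (w + h * I) - M w).le_of_opNorm_le (norm_shift_sub_le hM hb hw hh.le) z).trans ?_
    exact le_of_eq (by ring)
  have n4 := n3 H.smooth_F H.bound_fderiv_F (U (w + h * I))
  have n5 := n3 H.smooth_L H.bound_fderiv_L
    (fderiv ℝ U (w + h * I) 1 - I * fderiv ℝ U (w + h * I) I)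
  have n6 := norm_add₄_le (a := F w (D w))
    (b := (h⁻¹ : ℝ) • ((F (w + h * I) - F w) (U (w + h * I))))
    (c := L w (fderiv ℝ D w 1 - I * fderiv ℝ D w I))
    (d := (h⁻¹ : ℝ) • ((L (w + h * I) - L w)
          (fderiv ℝ U (w + h * I) 1 - I * fderiv ℝ U (w + h * I) I)))
  rw [← eQ] at n6
  rw [hre] at hG'
  set ε := C * Real.exp w.re
  set Q := ‖fderiv ℝ D w 1 + I * fderiv ℝ D w I‖
  set X := ‖fderiv ℝ D w 1 - I * fderiv ℝ D w I‖
  set X' := ‖fderiv ℝ U (w + h * I) 1 - I * fderiv ℝ U (w + h * I) I‖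
  set G' := ‖fderiv ℝ U (w + h * I) 1 + I * fderiv ℝ U (w + h * I) I‖
  set y := ‖fderiv ℝ D w I‖
  set d := ‖D w‖
  set u := ‖U (w + h * I)‖
  set v := ‖fderiv ℝ U (w + h * I) I‖
  have p1 : 0 ≤ Q := norm_nonneg _
  have p2 : 0 ≤ X := norm_nonneg _
  have p3 : 0 ≤ X' := norm_nonneg _
  have p4 : 0 ≤ y := norm_nonneg _
  have p5 : 0 ≤ d := norm_nonneg _
  have p6 : 0 ≤ u := norm_nonneg _
  have p7 : 0 ≤ v := norm_nonneg _
  have q1 := mul_le_mul_of_nonneg_right h0 p5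
  have q2 := mul_le_mul_of_nonneg_right h0 p2
  have q3 := mul_le_mul_of_nonneg_right h0 p3
  have q4 := mul_le_mul_of_nonneg_right h0 p6
  have q5 := mul_le_mul_of_nonneg_right h0 p7
  have q6 : Q ≤ 1 / 20 * (d + u + y + v) := by nlinarith
  have q7 : Q ^ 2 ≤ (1 / 20 * (d + u + y + v)) ^ 2 := pow_le_pow_left₀ p1 q6 2
  nlinarith [sq_nonneg (d - u), sq_nonneg (d - y), sq_nonneg (d - v), sq_nonneg (u - y),
    sq_nonneg (u - v), sq_nonneg (y - v), sq_nonneg d, sq_nonneg u, sq_nonneg v, sq_nonneg y]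

theorem segInt_mono_on {f g : ℂ → ℝ} (hf : ContinuousOn f (leftHalfPlane a))
    (hg : ContinuousOn g (leftHalfPlane a)) (h : s < a)
    (hfg : ∀ θ ∈ Set.Icc 0 (2 * Real.pi), f (s + θ * I) ≤ g (s + θ * I)) :
    segInt f s ≤ segInt g s :=
  intervalIntegral.integral_mono_on Real.two_pi_pos.le
    ((continuous_seg hf h).intervalIntegrable _ _) ((continuous_seg hg h).intervalIntegrable _ _)
    hfg

theorem segInt_const (c : ℝ) : segInt (fun _ => c) s = 2 * Real.pi * c := by
  simp [segInt]

theorem integral_segInt_le {N T : ℝ → ℝ} {M : ℝ} (cN : ContinuousOn N (Set.Icc (s - 1) (s + 1)))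
    (cT : ContinuousOn T (Set.Icc (s - 1) (s + 1)))
    (hN : ∀ t ∈ Set.Icc (s - 1) (s + 1), N t ≤ M) (hN0 : ∀ t ∈ Set.Icc (s - 1) (s + 1), 0 ≤ N t)
    (hT0 : ∀ t ∈ Set.Icc (s - 1) (s + 1), 0 ≤ T t)
    (hcac : ∫ t in (s - 1)..(s + 1), 1 / 4 * (1 ^ 2 - (t - s) ^ 2) ^ 2 * T t
      ≤ ∫ t in (s - 1)..(s + 1), ((1 ^ 2 - (t - s) ^ 2) ^ 2 * N t + 16 * (t - s) ^ 2 * N t)) :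
    ∫ t in (s - 1 / 2)..(s + 1 / 2), T t ≤ 242 * M := by
  have hle : s - 1 ≤ s + 1 := by linarith
  have hle' : s - 1 / 2 ≤ s + 1 / 2 := by linarith
  have hsub : Set.Icc (s - 1 / 2) (s + 1 / 2) ⊆ Set.Icc (s - 1) (s + 1) :=
    Set.Icc_subset_Icc (by linarith) (by linarith)
  have c1 : ContinuousOn (fun t => 1 / 4 * ((1 : ℝ) ^ 2 - (t - s) ^ 2) ^ 2 * T t)
      (Set.Icc (s - 1) (s + 1)) :=
    (by fun_prop : Continuous fun t : ℝ => 1 / 4 * ((1 : ℝ) ^ 2 - (t - s) ^ 2) ^ 2).continuousOn.mul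
      cT
  have c2 : ContinuousOn (fun t => ((1 : ℝ) ^ 2 - (t - s) ^ 2) ^ 2 * N t + 16 * (t - s) ^ 2 * N t)
      (Set.Icc (s - 1) (s + 1)) :=
    ((by fun_prop : Continuous fun t : ℝ => ((1 : ℝ) ^ 2 - (t - s) ^ 2) ^ 2).continuousOn.mul
      cN).add ((by fun_prop : Continuous fun t : ℝ => 16 * (t - s) ^ 2).continuousOn.mul cN)
  have i1 := ContinuousOn.intervalIntegrable_of_Icc (μ := MeasureTheory.volume) hle c1
  have i2 := ContinuousOn.intervalIntegrable_of_Icc (μ := MeasureTheory.volume) hle c2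
  have i3 := ContinuousOn.intervalIntegrable_of_Icc (μ := MeasureTheory.volume) hle' (cT.mono hsub)
  have h1 : ∫ t in (s - 1)..(s + 1), ((1 ^ 2 - (t - s) ^ 2) ^ 2 * N t + 16 * (t - s) ^ 2 * N t)
      ≤ ∫ _ in (s - 1)..(s + 1), 17 * M := by
    refine intervalIntegral.integral_mono_on hle i2 intervalIntegrable_const fun t ht => ?_
    have e0 : (t - s) ^ 2 ≤ 1 := by nlinarith [ht.1, ht.2]
    have e1 : ((1 : ℝ) ^ 2 - (t - s) ^ 2) ^ 2 + 16 * (t - s) ^ 2 ≤ 17 := by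
      nlinarith [sq_nonneg (t - s)]
    have e2 := mul_le_mul_of_nonneg_right e1 (hN0 t ht)
    linarith [hN t ht]
  have h2 : ∫ t in (s - 1 / 2)..(s + 1 / 2), 9 / 64 * T t
      ≤ ∫ t in (s - 1 / 2)..(s + 1 / 2), 1 / 4 * (1 ^ 2 - (t - s) ^ 2) ^ 2 * T t := by
    refine intervalIntegral.integral_mono_on hle' (i3.const_mul _)
      (ContinuousOn.intervalIntegrable_of_Icc hle' (c1.mono hsub)) fun t ht => ?_
    refine mul_le_mul_of_nonneg_right ?_ (hT0 t (hsub ht))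
    have e0 : (t - s) ^ 2 ≤ 1 / 4 := by nlinarith [ht.1, ht.2]
    nlinarith
  have h3 : ∫ t in (s - 1 / 2)..(s + 1 / 2), 1 / 4 * (1 ^ 2 - (t - s) ^ 2) ^ 2 * T t
      ≤ ∫ t in (s - 1)..(s + 1), 1 / 4 * (1 ^ 2 - (t - s) ^ 2) ^ 2 * T t := by
    refine intervalIntegral.integral_mono_interval (by linarith) hle' (by linarith) ?_ i1
    filter_upwards [MeasureTheory.ae_restrict_mem measurableSet_Ioc] with t ht
    have := hT0 t (Set.Ioc_subset_Icc_self ht)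
    simp only [Pi.zero_apply]
    positivity
  have hM : 0 ≤ M := (hN0 s ⟨by linarith, by linarith⟩).trans (hN s ⟨by linarith, by linarith⟩)
  rw [intervalIntegral.integral_const, smul_eq_mul] at h1
  rw [intervalIntegral.integral_const_mul] at h2
  have h4 := h2.trans (h3.trans (hcac.trans h1))
  have h5 : (s + 1 - (s - 1)) * (17 * M) = 34 * M := by ring
  rw [h5] at h4
  linarith

/-- Interior estimate: the `L²` norm of `U` on nearby circles controls that of `∂_θ U`. -/
theorem IsCylinderSolution.segInt_fderiv_le (H : IsCylinderSolution a C U F L)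
    (hC : C * Real.exp a ≤ 1 / 100) (hs : s + 1 < a) {M : ℝ} (hM : 0 < M)
    (hb : ∀ t ∈ Set.Icc (s - 1) (s + 1), segInt (fun w => ‖U w‖ ^ 2) t ≤ M) :
    segInt (fun w => ‖fderiv ℝ U w I‖ ^ 2) s ≤ 2000000 * M := by
  have hsub1 : Set.Icc (s - 1) (s + 1) ⊆ Set.Iio a := fun t ht => ht.2.trans_lt hs
  have hsub2 : Set.Icc (s - 1 / 2) (s + 1 / 2) ⊆ Set.Icc (s - 1) (s + 1) :=
    Set.Icc_subset_Icc (by linarith) (by linarith)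
  have hsub3 := hsub2.trans hsub1
  have hle' : s - 1 / 2 ≤ s + 1 / 2 := by linarith
  have cN := (contDiffOn_normSq H.smooth).continuousOn
  have cT := continuousOn_normSq_fderiv H.smooth I
  have hcac := caccioppoli (s := s) H.smooth H.periodic cN (fun w hw => by
    have h1 := H.norm_dbar_le hC hw
    have h2 := H.mul_exp_le hC hw
    have h3 : ‖fderiv ℝ U w 1 + I * fderiv ℝ U w I‖
        ≤ 3 * (1 / 100) * (‖U w‖ + ‖fderiv ℝ U w I‖) := h1.trans (by gcongr)
    have h4 := pow_le_pow_left₀ (norm_nonneg _) h3 2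
    nlinarith [sq_nonneg (‖U w‖ - ‖fderiv ℝ U w I‖), sq_nonneg (‖U w‖),
      sq_nonneg ‖fderiv ℝ U w I‖]) zero_le_one hs
  have hT := integral_segInt_le ((continuousOn_segInt cN).mono hsub1)
    ((continuousOn_segInt cT).mono hsub1) hb (fun t _ => segInt_nonneg fun w _ => by positivity)
    (fun t _ => segInt_nonneg fun w _ => by positivity) hcac
  obtain ⟨h, hh, hdq⟩ := exists_uniform_diffQuot H.smooth (b := s - 1 / 2) (c := s + 1 / 2)
    (by linarith) (Real.sqrt_pos.2 (div_pos hM (mul_pos (by norm_num : (0 : ℝ) < 4) Real.pi_pos)))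
  have hsq : 2 * Real.pi * (2 * Real.sqrt (M / (4 * Real.pi)) ^ 2) = M := by
    rw [Real.sq_sqrt (by positivity)]
    field_simp
    norm_num
  set ε := Real.sqrt (M / (4 * Real.pi))
  obtain ⟨D, hD⟩ : ∃ D : ℂ → ℂ, D = fun w => (h : ℂ)⁻¹ * (U (w + h * I) - U w) := ⟨_, rfl⟩
  have sD : ContDiffOn ℝ 1 D (leftHalfPlane a) := hD ▸ contDiffOn_diffQuot H.smooth h
  have pD : ∀ w, D (w + 2 * Real.pi * I) = D w := by
    intro w
    simp only [hD]
    rw [H.periodic, add_right_comm, H.periodic]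
  have cD := (contDiffOn_normSq sD).continuousOn
  have cN2 := (contDiffOn_normSq (contDiffOn_shift H.smooth h)).continuousOn
  have cT2 : ContinuousOn (fun w => ‖fderiv ℝ U (w + h * I) I‖ ^ 2) (leftHalfPlane a) :=
    cT.comp (g := fun w => ‖fderiv ℝ U w I‖ ^ 2)
      (continuous_id.add continuous_const).continuousOn
      fun w hw => by simpa [mem_leftHalfPlane] using hw
  have hnear : ∀ t ∈ Set.Icc (s - 1 / 2) (s + 1 / 2), ∀ θ ∈ Set.Icc 0 (2 * Real.pi),
      ‖D (t + θ * I) - fderiv ℝ U (t + θ * I) I‖ ≤ ε := by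
    intro t ht θ hθ
    rw [hD]
    exact hdq t ht θ hθ
  have b1 : ∀ t ∈ Set.Icc (s - 1 / 2) (s + 1 / 2), segInt (fun w => ‖D w‖ ^ 2) t
      ≤ 2 * segInt (fun w => ‖fderiv ℝ U w I‖ ^ 2) t + M := by
    intro t ht
    rw [← segInt_const_mul, ← hsq, ← segInt_const (s := t),
      ← segInt_add (continuousOn_const.fun_mul cT) continuousOn_const (hsub3 ht)]
    refine segInt_mono_on cD ((continuousOn_const.mul cT).add continuousOn_const) (hsub3 ht)
      fun θ hθ => ?_
    have e1 := hnear t ht θ hθ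
    have e2 := norm_le_norm_sub_add (D (t + θ * I)) (fderiv ℝ U (t + θ * I) I)
    nlinarith [sq_nonneg (ε - ‖fderiv ℝ U (t + θ * I) I‖), norm_nonneg (D (t + θ * I))]
  have b2 : segInt (fun w => ‖fderiv ℝ U w I‖ ^ 2) s ≤ 2 * segInt (fun w => ‖D w‖ ^ 2) s + M := by
    have hs' : s ∈ Set.Icc (s - 1 / 2) (s + 1 / 2) := ⟨by linarith, by linarith⟩
    rw [← segInt_const_mul, ← hsq, ← segInt_const (s := s),
      ← segInt_add (continuousOn_const.fun_mul cD) continuousOn_const (hsub3 hs')]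
    refine segInt_mono_on cT ((continuousOn_const.mul cD).add continuousOn_const) (hsub3 hs')
      fun θ hθ => ?_
    have e1 := hnear s hs' θ hθ
    rw [norm_sub_rev] at e1
    have e2 := norm_le_norm_sub_add (fderiv ℝ U (s + θ * I) I) (D (s + θ * I))
    nlinarith [sq_nonneg (ε - ‖D (s + θ * I)‖), norm_nonneg (fderiv ℝ U (s + θ * I) I)]
  have cR1 := cN2.fun_add cT2
  have cR := cD.fun_add cR1
  have b3 := local_sup_bound (s := s) sD pD cR (fun w hw => H.dbar_diffQuot_le hC hh hD hw)
    (fun w _ => by positivity) (by linarith)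
  have b4 : ∫ t in (s - 1 / 2)..(s + 1 / 2), (segInt (fun w => ‖D w‖ ^ 2) t
      + segInt (fun w => ‖D w‖ ^ 2 + (‖U (w + h * I)‖ ^ 2 + ‖fderiv ℝ U (w + h * I) I‖ ^ 2)) t)
      ≤ ∫ t in (s - 1 / 2)..(s + 1 / 2),
        (5 * segInt (fun w => ‖fderiv ℝ U w I‖ ^ 2) t + 3 * M) := by
    refine intervalIntegral.integral_mono_on hle'
      (ContinuousOn.intervalIntegrable_of_Icc hle' (((continuousOn_segInt cD).fun_add
        (continuousOn_segInt cR)).mono hsub3))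
      (ContinuousOn.intervalIntegrable_of_Icc hle' ((continuousOn_const.mul
        ((continuousOn_segInt cT).mono hsub3)).add continuousOn_const)) fun t ht => ?_
    rw [segInt_add cD cR1 (hsub3 ht), segInt_add cN2 cT2 (hsub3 ht),
      segInt_shift (f := fun w => ‖U w‖ ^ 2) (fun w => by simp only [H.periodic w]) h,
      segInt_shift (f := fun w => ‖fderiv ℝ U w I‖ ^ 2)
        (fun w => by simp only [fderiv_periodic H.periodic w]) h]
    linarith [b1 t ht, hb t (hsub2 ht)]
  have iT := ContinuousOn.intervalIntegrable_of_Icc (μ := MeasureTheory.volume) hle'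
    ((continuousOn_segInt cT).mono hsub3)
  rw [intervalIntegral.integral_add (iT.const_mul 5) intervalIntegrable_const,
    intervalIntegral.integral_const_mul, intervalIntegral.integral_const, smul_eq_mul] at b4
  linarith

end DerivativeBounds

/-- The `n`-th Fourier mode of `f` along the segment over `s`, multiplied by `2π exp (-n s)`. -/
noncomputable def fourierMode (n : ℤ) (f : ℂ → ℂ) (s : ℝ) : ℂ :=
  segInt (fun w => cexp (-(n * w)) * f w) s

section FourierModes

variable {a s : ℝ} {f : ℂ → ℂ}

theorem hasSum_fourierMode (hf : ContinuousOn f (leftHalfPlane a)) (hs : s < a) :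
    HasSum (fun n : ℤ => (Real.exp (n * s) * ‖fourierMode n f s‖) ^ 2)
      (2 * Real.pi * segInt (fun w => ‖f w‖ ^ 2) s) := by
  have hc := continuous_seg hf hs
  obtain ⟨M, hM⟩ := isCompact_Icc.exists_bound_of_continuousOn (s := Set.Icc 0 (2 * Real.pi))
    hc.continuousOn
  have hL2 : MeasureTheory.MemLp (fun θ : ℝ => f (s + θ * I)) 2
      (MeasureTheory.volume.restrict (Set.Ioc 0 (2 * Real.pi))) := by
    refine MeasureTheory.MemLp.of_bound hc.aestronglyMeasurable M ?_
    filter_upwards [MeasureTheory.ae_restrict_mem measurableSet_Ioc] with θ hθ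
    exact hM θ (Set.Ioc_subset_Icc_self hθ)
  have h := (hasSum_sq_fourierCoeffOn Real.two_pi_pos hL2).mul_left ((2 * Real.pi) ^ 2)
  have hval : 2 * Real.pi * segInt (fun w => ‖f w‖ ^ 2) s = (2 * Real.pi) ^ 2 *
      ((2 * Real.pi - 0)⁻¹ • ∫ θ in (0 : ℝ)..(2 * Real.pi), ‖f (s + θ * I)‖ ^ 2) := by
    rw [sub_zero, smul_eq_mul, segInt, ← mul_assoc, sq, mul_assoc (2 * Real.pi),
      mul_inv_cancel₀ Real.two_pi_pos.ne', mul_one]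
  have hterm : (fun n : ℤ => (Real.exp (n * s) * ‖fourierMode n f s‖) ^ 2) = fun n =>
      (2 * Real.pi) ^ 2 *
      ‖fourierCoeffOn Real.two_pi_pos (fun θ : ℝ => f (s + θ * I)) n‖ ^ 2 := by
    funext n
    have e1 : fourierMode n f s = (Real.exp (-(n * s)) : ℂ) * (2 * Real.pi : ℝ) *
        fourierCoeffOn Real.two_pi_pos (fun θ : ℝ => f (s + θ * I)) n := by
      rw [fourierCoeffOn_eq_integral, Complex.real_smul, mul_assoc, ← mul_assoc ((2 * Real.pi : ℝ) : ℂ) _ _,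
        ← Complex.ofReal_mul, sub_zero, mul_one_div_cancel Real.two_pi_pos.ne', Complex.ofReal_one,
        one_mul, fourierMode, segInt, ← intervalIntegral.integral_const_mul]
      refine intervalIntegral.integral_congr fun θ _ => ?_
      simp only [smul_eq_mul]
      rw [← mul_assoc, fourier_coe_apply, Complex.ofReal_exp, ← Complex.exp_add]
      congr 2
      have : (Real.pi : ℂ) ≠ 0 := by exact_mod_cast Real.pi_ne_zero
      push_cast
      field_simp
      ring
    rw [e1, norm_mul, norm_mul, Complex.norm_real, Complex.norm_real,
      Real.norm_of_nonneg (Real.exp_pos _).le, Real.norm_of_nonneg Real.two_pi_pos.le,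
      ← mul_assoc, ← mul_assoc, ← Real.exp_add, add_neg_cancel, Real.exp_zero, one_mul, mul_pow]
  rw [hval, hterm]
  exact h

theorem fourierMode_hasDerivAt (hf : ContDiffOn ℝ 1 f (leftHalfPlane a))
    (hper : ∀ w, f (w + 2 * Real.pi * I) = f w) (hs : s < a) (n : ℤ) :
    HasDerivAt (fourierMode n f)
      (fourierMode n (fun w => fderiv ℝ f w 1 + I * fderiv ℝ f w I) s) s := by
  have hexp : ContDiff ℝ 1 fun w : ℂ => cexp (-(n * w)) := by fun_prop
  have hV : ContDiffOn ℝ 1 (fun w => cexp (-(n * w)) * f w) (leftHalfPlane a) :=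
    hexp.contDiffOn.mul hf
  have hperV : ∀ w, cexp (-(n * (w + 2 * Real.pi * I))) * f (w + 2 * Real.pi * I)
      = cexp (-(n * w)) * f w := by
    intro w
    rw [hper]
    congr 1
    rw [Complex.exp_eq_exp_iff_exists_int]
    refine ⟨-n, ?_⟩
    push_cast
    ring
  have h1 := hasDerivAt_segInt hV hs
  have h2 := segInt_fderiv_I hV hperV hs
  have hder : ∀ w ∈ leftHalfPlane a, ∀ v,
      fderiv ℝ (fun w => cexp (-(n * w)) * f w) w v
        = cexp (-(n * w)) * fderiv ℝ f w v - n * v * cexp (-(n * w)) * f w := by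
    intro w hw v
    have e1 : HasDerivAt (fun w : ℂ => cexp (-(n * w))) (cexp (-(n * w)) * (-(n * 1))) w :=
      (((hasDerivAt_id w).const_mul (n : ℂ)).neg).cexp
    have e2 := e1.hasFDerivAt.restrictScalars ℝ
    have e3 := (e2.mul (hasFDerivAt_of_leftHalfPlane hf hw)).fderiv
    refine (congrArg (fun T : ℂ →L[ℝ] ℂ => T v) e3).trans ?_
    simp
    ring
  refine h1.congr_deriv ?_
  have c1 := continuousOn_fderiv_apply hV 1
  have c2 := continuousOn_fderiv_apply hV I
  have h3 : segInt (fun w => I * fderiv ℝ (fun w => cexp (-(n * w)) * f w) w I) s = 0 := by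
    rw [segInt, intervalIntegral.integral_const_mul]
    exact mul_eq_zero_of_right _ h2
  rw [← add_zero (segInt _ s), ← h3, ← segInt_add c1 (continuousOn_const.fun_mul c2) hs, fourierMode]
  refine segInt_congr fun w hw => ?_
  have hw' : w ∈ leftHalfPlane a := by rw [mem_leftHalfPlane, hw]; exact hs
  rw [hder w hw', hder w hw']
  linear_combination (-(n : ℂ) * cexp (-(n * w)) * f w) * Complex.I_sq

theorem sum_fourierMode_le (hf : ContinuousOn f (leftHalfPlane a)) (hs : s < a) (S : Finset ℤ) :
    ∑ n ∈ S, (Real.exp (n * s) * ‖fourierMode n f s‖) ^ 2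
      ≤ 2 * Real.pi * segInt (fun w => ‖f w‖ ^ 2) s :=
  sum_le_hasSum S (fun _ _ => by positivity) (hasSum_fourierMode hf hs)

end FourierModes

section ScalarODE

variable {a : ℝ}

theorem exists_hasDerivAt_weighted {d : ℝ → ℂ} {d' : ℂ} {s : ℝ} (hd : HasDerivAt d d' s) (n : ℝ) :
    ∃ p', HasDerivAt (fun s => (Real.exp (n * s) * ‖d s‖) ^ 2) p' s ∧
      |p' - 2 * n * (Real.exp (n * s) * ‖d s‖) ^ 2|
        ≤ 1 / 2 * (Real.exp (n * s) * ‖d s‖) ^ 2 + 2 * (Real.exp (n * s) * ‖d'‖) ^ 2 := by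
  have h1 : HasDerivAt (fun s => Real.exp (n * s)) (Real.exp (n * s) * (n * 1)) s :=
    ((hasDerivAt_id s).const_mul n).exp
  have h2 := (h1.pow 2).mul hd.norm_sq
  simp only [mul_pow]
  refine ⟨_, h2, ?_⟩
  have h3 := abs_real_inner_le_norm (d s) d'
  have h4 : ∀ x y : ℝ, |x| ≤ y →
      |Real.exp (n * s) ^ 2 * (2 * x)| ≤ Real.exp (n * s) ^ 2 * (2 * y) := by
    intro x y hxy
    rw [abs_mul, abs_mul, abs_of_pos (by positivity : (0 : ℝ) < Real.exp (n * s) ^ 2), abs_two]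
    gcongr
  have h5 := h4 _ _ h3
  refine le_trans (le_of_eq (congrArg _ ?_)) (h5.trans ?_)
  · simp only [Pi.pow_apply]
    ring
  · nlinarith [mul_nonneg (sq_nonneg (Real.exp (n * s))) (sq_nonneg (‖d s‖ - 2 * ‖d'‖))]

theorem le_of_growth {E : ℝ → ℝ} {k K : ℝ}
    (hE : ∀ s < a, ∃ E', HasDerivAt E E' s ∧ (k + 1 / 2) * E s - K * Real.exp (k * s) ≤ E')
    {s t : ℝ} (hst : s ≤ t) (ht : t < a) (hK : 0 ≤ K) :
    E s ≤ Real.exp ((k + 1 / 2) * (s - t)) * E t + 2 * K * Real.exp (k * s) := by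
  choose! E' hE' hb using hE
  have hder : ∀ x < a, HasDerivAt
      (fun x => Real.exp (-(k + 1 / 2) * x) * E x - 2 * K * Real.exp (-(1 / 2) * x))
      (Real.exp (-(k + 1 / 2) * x) * (E' x - ((k + 1 / 2) * E x - K * Real.exp (k * x)))) x := by
    intro x hx
    have e1 := ((hasDerivAt_id x).const_mul (-(k + 1 / 2))).exp
    have e2 := (((hasDerivAt_id x).const_mul (-(1 / 2) : ℝ)).exp).const_mul (2 * K)
    refine ((e1.mul (hE' x hx)).sub e2).congr_deriv ?_
    have e3 : Real.exp (-(1 / 2) * x) = Real.exp (-(k + 1 / 2) * x) * Real.exp (k * x) := by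
      rw [← Real.exp_add]
      ring_nf
    simp only [id_eq, mul_one]
    rw [e3]
    ring
  have hmono : MonotoneOn
      (fun x => Real.exp (-(k + 1 / 2) * x) * E x - 2 * K * Real.exp (-(1 / 2) * x)) (Set.Iio a) := by
    refine monotoneOn_of_deriv_nonneg (convex_Iio a)
      (fun x hx => (hder x hx).continuousAt.continuousWithinAt) ?_ ?_
    · rw [interior_Iio]
      exact fun x hx => (hder x hx).differentiableAt.differentiableWithinAt
    · rw [interior_Iio]
      intro x hx
      rw [(hder x hx).deriv]
      exact mul_nonneg (Real.exp_pos _).le (sub_nonneg.2 (hb x hx))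
  have h := hmono (hst.trans_lt ht) ht hst
  simp only at h
  have h2 : 0 ≤ 2 * K * Real.exp (-(1 / 2) * t) := by positivity
  have h3 : Real.exp (-(k + 1 / 2) * s) * E s
      ≤ Real.exp (-(k + 1 / 2) * t) * E t + 2 * K * Real.exp (-(1 / 2) * s) := by linarith
  have h4 := mul_le_mul_of_nonneg_left h3 (Real.exp_pos ((k + 1 / 2) * s)).le
  rw [mul_add, ← mul_assoc, ← mul_assoc, ← Real.exp_add, ← Real.exp_add, mul_left_comm,
    ← Real.exp_add] at h4
  have e1 : (k + 1 / 2) * s + -(k + 1 / 2) * s = 0 := by ring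
  have e2 : (k + 1 / 2) * s + -(k + 1 / 2) * t = (k + 1 / 2) * (s - t) := by ring
  have e3 : (k + 1 / 2) * s + -(1 / 2) * s = k * s := by ring
  rwa [e1, e2, e3, Real.exp_zero, one_mul] at h4

theorem le_of_decay {E : ℝ → ℝ} {k K M : ℝ}
    (hE : ∀ s < a, ∃ E', HasDerivAt E E' s ∧ E' ≤ (k - 5 / 2) * E s + K * Real.exp (k * s))
    (hM : ∀ s < a, E s ≤ M * Real.exp ((k - 2) * s)) {s : ℝ} (hs : s < a) (hK : 0 ≤ K) :
    E s ≤ K * Real.exp (k * s) := by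
  choose! E' hE' hb using hE
  have hder : ∀ x < a, HasDerivAt
      (fun x => Real.exp (-(k - 5 / 2) * x) * E x - 2 / 5 * K * Real.exp (5 / 2 * x))
      (Real.exp (-(k - 5 / 2) * x) * (E' x - ((k - 5 / 2) * E x + K * Real.exp (k * x)))) x := by
    intro x hx
    have e1 := ((hasDerivAt_id x).const_mul (-(k - 5 / 2))).exp
    have e2 := (((hasDerivAt_id x).const_mul (5 / 2 : ℝ)).exp).const_mul (2 / 5 * K)
    refine ((e1.mul (hE' x hx)).sub e2).congr_deriv ?_
    have e3 : Real.exp (5 / 2 * x) = Real.exp (-(k - 5 / 2) * x) * Real.exp (k * x) := by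
      rw [← Real.exp_add]
      ring_nf
    simp only [id_eq, mul_one]
    rw [e3]
    ring
  have hanti : AntitoneOn
      (fun x => Real.exp (-(k - 5 / 2) * x) * E x - 2 / 5 * K * Real.exp (5 / 2 * x))
      (Set.Iio a) := by
    refine antitoneOn_of_deriv_nonpos (convex_Iio a)
      (fun x hx => (hder x hx).continuousAt.continuousWithinAt) ?_ ?_
    · rw [interior_Iio]
      exact fun x hx => (hder x hx).differentiableAt.differentiableWithinAt
    · rw [interior_Iio]
      intro x hx
      rw [(hder x hx).deriv]
      exact mul_nonpos_of_nonneg_of_nonpos (Real.exp_pos _).le (sub_nonpos.2 (hb x hx))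
  have hlim : Tendsto (fun r : ℝ => M * Real.exp (1 / 2 * r)) atBot (nhds 0) := by
    have := (Real.tendsto_exp_atBot.comp
      (tendsto_id.const_mul_atBot (by norm_num : (0 : ℝ) < 1 / 2))).const_mul M
    simpa using this
  have h0 : Real.exp (-(k - 5 / 2) * s) * E s - 2 / 5 * K * Real.exp (5 / 2 * s) ≤ 0 := by
    refine ge_of_tendsto hlim ?_
    filter_upwards [Iic_mem_atBot s] with r hr
    refine (hanti (hr.trans_lt hs) hs hr).trans ?_
    have h1 := mul_le_mul_of_nonneg_left (hM r (lt_of_le_of_lt hr hs))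
      (Real.exp_pos (-(k - 5 / 2) * r)).le
    rw [mul_left_comm, ← Real.exp_add] at h1
    have h2 : 0 ≤ 2 / 5 * K * Real.exp (5 / 2 * r) := by positivity
    have h3 : -(k - 5 / 2) * r + (k - 2) * r = 1 / 2 * r := by ring
    rw [h3] at h1
    simp only
    linarith
  have h4 := mul_le_mul_of_nonneg_left (sub_nonpos.1 h0) (Real.exp_pos ((k - 5 / 2) * s)).le
  rw [← mul_assoc, ← Real.exp_add, mul_left_comm, ← Real.exp_add, ← add_mul] at h4
  have h5 : (k - 5 / 2) * s + 5 / 2 * s = k * s := by ring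
  rw [h5] at h4
  simp only [add_neg_cancel, zero_mul, Real.exp_zero, one_mul] at h4
  have h6 : 0 ≤ K * Real.exp (k * s) := by positivity
  linarith

theorem exists_limit_atBot {y y' : ℝ → ℂ} {κ : ℝ} (hy : ∀ s < a, HasDerivAt y (y' s) s)
    (hb : ∀ s < a, ‖y' s‖ ≤ κ * Real.exp (1 / 2 * s)) (hκ : 0 ≤ κ) :
    ∃ α, ∀ s < a, ‖y s - α‖ ≤ 2 * κ * Real.exp (1 / 2 * s) := by
  have key : ∀ s t, s ≤ t → t < a → ‖y t - y s‖ ≤ 2 * κ * Real.exp (1 / 2 * t) := by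
    intro s t hst ht
    have hB : ∀ x : ℝ, HasDerivAt (fun x : ℝ => 2 * κ * Real.exp (1 / 2 * x))
        (κ * Real.exp (1 / 2 * x)) x := by
      intro x
      refine ((((hasDerivAt_id x).const_mul (1 / 2 : ℝ)).exp).const_mul (2 * κ)).congr_deriv ?_
      simp only [id_eq]
      ring
    refine image_norm_le_of_norm_deriv_right_le_deriv_boundary (f := fun x => y x - y s) (a := s)
      (b := t) (f' := y')
      (fun x hx => ((hy x (hx.2.trans_lt ht)).sub_const _).continuousAt.continuousWithinAt)
      (fun x hx => ((hy x (hx.2.trans ht)).sub_const _).hasDerivWithinAt) ?_ hB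
      (fun x hx => hb x (hx.2.trans ht)) ⟨hst, le_rfl⟩
    rw [sub_self, norm_zero]
    positivity
  have hlim : Tendsto (fun r : ℝ => 2 * κ * Real.exp (1 / 2 * r)) atBot (nhds 0) := by
    have := (Real.tendsto_exp_atBot.comp
      (tendsto_id.const_mul_atBot (by norm_num : (0 : ℝ) < 1 / 2))).const_mul (2 * κ)
    simpa using this
  have hc : Cauchy (map y atBot) := by
    rw [Metric.cauchy_iff]
    refine ⟨inferInstance, fun ε hε => ?_⟩
    obtain ⟨t, ht1, ht2⟩ := ((hlim.eventually_lt_const (half_pos hε)).and (Iio_mem_atBot a)).exists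
    refine ⟨y '' Set.Iic t, image_mem_map (Iic_mem_atBot t), ?_⟩
    rintro _ ⟨p, hp, rfl⟩ _ ⟨q, hq, rfl⟩
    have h1 := key p t hp ht2
    have h2 := key q t hq ht2
    rw [← dist_eq_norm] at h1 h2
    have h3 := dist_triangle_left (y p) (y q) (y t)
    linarith
  obtain ⟨α, hα⟩ := CompleteSpace.complete hc
  refine ⟨α, fun s hs => ?_⟩
  have hα' : Tendsto y atBot (nhds α) := hα
  refine le_of_tendsto (hα'.const_sub (y s)).norm ?_
  filter_upwards [Iic_mem_atBot s] with r hr using key r s hr hs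

end ScalarODE

section ModeExpansion

variable {a k K M s : ℝ} {V : ℂ → ℂ}

theorem continuousOn_dbar (hV : ContDiffOn ℝ 1 V (leftHalfPlane a)) :
    ContinuousOn (fun w => fderiv ℝ V w 1 + I * fderiv ℝ V w I) (leftHalfPlane a) :=
  (continuousOn_fderiv_apply hV 1).add (continuousOn_const.mul (continuousOn_fderiv_apply hV I))

theorem exists_hasDerivAt_sum_modes (hV : ContDiffOn ℝ 1 V (leftHalfPlane a))
    (hper : ∀ w, V (w + 2 * Real.pi * I) = V w) (hs : s < a)
    (hG : segInt (fun w => ‖fderiv ℝ V w 1 + I * fderiv ℝ V w I‖ ^ 2) s ≤ K * Real.exp (k * s))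
    (S : Finset ℤ) :
    ∃ E', HasDerivAt (fun s => ∑ n ∈ S, (Real.exp (n * s) * ‖fourierMode n V s‖) ^ 2) E' s ∧
      |E' - ∑ n ∈ S, 2 * n * (Real.exp (n * s) * ‖fourierMode n V s‖) ^ 2|
        ≤ 1 / 2 * ∑ n ∈ S, (Real.exp (n * s) * ‖fourierMode n V s‖) ^ 2
          + 4 * Real.pi * K * Real.exp (k * s) := by
  choose p' hp' hb using fun n : ℤ =>
    exists_hasDerivAt_weighted (fourierMode_hasDerivAt hV hper hs n) n
  refine ⟨∑ n ∈ S, p' n, HasDerivAt.fun_sum fun n _ => hp' n, ?_⟩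
  rw [← Finset.sum_sub_distrib]
  refine (Finset.abs_sum_le_sum_abs _ _).trans ((Finset.sum_le_sum fun n _ => hb n).trans ?_)
  rw [Finset.sum_add_distrib, ← Finset.mul_sum, ← Finset.mul_sum]
  have h1 := sum_fourierMode_le (continuousOn_dbar hV) hs S
  have h2 := mul_le_mul_of_nonneg_left hG Real.two_pi_pos.le
  linarith

theorem sum_high_modes_le (hV : ContDiffOn ℝ 1 V (leftHalfPlane a))
    (hper : ∀ w, V (w + 2 * Real.pi * I) = V w)
    (hG : ∀ s < a, segInt (fun w => ‖fderiv ℝ V w 1 + I * fderiv ℝ V w I‖ ^ 2) s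
      ≤ K * Real.exp (k * s)) (hK : 0 ≤ K) {S : Finset ℤ} (hS : ∀ n ∈ S, k + 1 ≤ 2 * n) {t : ℝ}
    (hst : s ≤ t) (ht : t < a) :
    ∑ n ∈ S, (Real.exp (n * s) * ‖fourierMode n V s‖) ^ 2
      ≤ Real.exp ((k + 1 / 2) * (s - t)) * (2 * Real.pi * segInt (fun w => ‖V w‖ ^ 2) t)
        + 8 * Real.pi * K * Real.exp (k * s) := by
  have h := le_of_growth (a := a) (k := k) (K := 4 * Real.pi * K)
    (E := fun s => ∑ n ∈ S, (Real.exp (n * s) * ‖fourierMode n V s‖) ^ 2)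
    (fun s hs => ?_) hst ht (by have := Real.pi_pos; positivity)
  · have h1 := mul_le_mul_of_nonneg_left (sum_fourierMode_le hV.continuousOn ht S)
      (Real.exp_pos ((k + 1 / 2) * (s - t))).le
    linarith
  · obtain ⟨E', hE, hb⟩ := exists_hasDerivAt_sum_modes hV hper hs (hG s hs) S
    refine ⟨E', hE, ?_⟩
    have h1 : ∑ n ∈ S, (k + 1) * (Real.exp (n * s) * ‖fourierMode n V s‖) ^ 2
        ≤ ∑ n ∈ S, 2 * n * (Real.exp (n * s) * ‖fourierMode n V s‖) ^ 2 :=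
      Finset.sum_le_sum fun n hn => mul_le_mul_of_nonneg_right (hS n hn) (by positivity)
    rw [← Finset.mul_sum] at h1
    have h2 := (abs_le.1 hb).1
    linarith

theorem sum_low_modes_le (hV : ContDiffOn ℝ 1 V (leftHalfPlane a))
    (hper : ∀ w, V (w + 2 * Real.pi * I) = V w)
    (hG : ∀ s < a, segInt (fun w => ‖fderiv ℝ V w 1 + I * fderiv ℝ V w I‖ ^ 2) s
      ≤ K * Real.exp (k * s)) (hK : 0 ≤ K)
    (hM : ∀ s < a, segInt (fun w => ‖V w‖ ^ 2) s ≤ M * Real.exp ((k - 2) * s))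
    {S : Finset ℤ} (hS : ∀ n ∈ S, 2 * n ≤ k - 3) (hs : s < a) :
    ∑ n ∈ S, (Real.exp (n * s) * ‖fourierMode n V s‖) ^ 2
      ≤ 4 * Real.pi * K * Real.exp (k * s) := by
  refine le_of_decay (a := a) (k := k) (K := 4 * Real.pi * K) (M := 2 * Real.pi * M)
    (E := fun s => ∑ n ∈ S, (Real.exp (n * s) * ‖fourierMode n V s‖) ^ 2)
    (fun s hs => ?_) (fun s hs => ?_) hs (by have := Real.pi_pos; positivity)
  · obtain ⟨E', hE, hb⟩ := exists_hasDerivAt_sum_modes hV hper hs (hG s hs) S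
    refine ⟨E', hE, ?_⟩
    have h1 : ∑ n ∈ S, 2 * n * (Real.exp (n * s) * ‖fourierMode n V s‖) ^ 2
        ≤ ∑ n ∈ S, (k - 3) * (Real.exp (n * s) * ‖fourierMode n V s‖) ^ 2 :=
      Finset.sum_le_sum fun n hn => mul_le_mul_of_nonneg_right (hS n hn) (by positivity)
    rw [← Finset.mul_sum] at h1
    have h2 := (abs_le.1 hb).2
    linarith
  · have h1 := sum_fourierMode_le hV.continuousOn hs S
    have h2 := mul_le_mul_of_nonneg_left (hM s hs) Real.two_pi_pos.le
    linarith

theorem exists_limit_fourierMode (hV : ContDiffOn ℝ 1 V (leftHalfPlane a))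
    (hper : ∀ w, V (w + 2 * Real.pi * I) = V w) (m : ℤ)
    (hG : ∀ s < a, segInt (fun w => ‖fderiv ℝ V w 1 + I * fderiv ℝ V w I‖ ^ 2) s
      ≤ K * Real.exp ((2 * m + 1) * s)) (hK : 0 ≤ K) :
    ∃ α, ∀ s < a, (Real.exp (m * s) * ‖fourierMode m V s - α‖) ^ 2
      ≤ 8 * Real.pi * K * Real.exp ((2 * m + 1) * s) := by
  have hπ := Real.pi_pos
  have hexp : ∀ s : ℝ, Real.exp ((2 * m + 1) * s)
      = Real.exp (m * s) ^ 2 * Real.exp (1 / 2 * s) ^ 2 := by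
    intro s
    rw [← Real.exp_nat_mul, ← Real.exp_nat_mul, ← Real.exp_add]
    congr 1
    push_cast
    ring
  have hbound : ∀ s < a, ‖fourierMode m (fun w => fderiv ℝ V w 1 + I * fderiv ℝ V w I) s‖
      ≤ Real.sqrt (2 * Real.pi * K) * Real.exp (1 / 2 * s) := by
    intro s hs
    have h1 := sum_fourierMode_le (continuousOn_dbar hV) hs {m}
    rw [Finset.sum_singleton] at h1
    have h2 := mul_le_mul_of_nonneg_left (hG s hs) Real.two_pi_pos.le
    have h3 : 2 * Real.pi * (K * Real.exp ((2 * m + 1) * s))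
        = (Real.exp (m * s) * (Real.sqrt (2 * Real.pi * K) * Real.exp (1 / 2 * s))) ^ 2 := by
      rw [mul_pow, mul_pow, Real.sq_sqrt (by positivity), hexp]
      ring
    have h4 := abs_le_of_sq_le_sq ((h1.trans h2).trans_eq h3) (by positivity)
    exact le_of_mul_le_mul_left ((abs_le.1 h4).2) (Real.exp_pos _)
  obtain ⟨α, hα⟩ := exists_limit_atBot (κ := Real.sqrt (2 * Real.pi * K))
    (fun s hs => fourierMode_hasDerivAt hV hper hs m) hbound (Real.sqrt_nonneg _)
  refine ⟨α, fun s hs => ?_⟩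
  rw [mul_pow, hexp]
  have h1 := pow_le_pow_left₀ (norm_nonneg _) (hα s hs) 2
  rw [mul_pow, mul_pow, Real.sq_sqrt (by positivity)] at h1
  have h2 := mul_le_mul_of_nonneg_left h1 (sq_nonneg (Real.exp (m * s)))
  linarith

theorem fderiv_sub_exp (hV : ContDiffOn ℝ 1 V (leftHalfPlane a)) (α : ℂ) (m : ℤ) {w : ℂ}
    (hw : w ∈ leftHalfPlane a) (v : ℂ) :
    fderiv ℝ (fun w => V w - α * cexp (m * w)) w v
      = fderiv ℝ V w v - α * (m * cexp (m * w)) * v := by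
  have e1 : HasDerivAt (fun w : ℂ => α * cexp (m * w)) (α * (cexp (m * w) * (m * 1))) w :=
    (((hasDerivAt_id w).const_mul (m : ℂ)).cexp).const_mul α
  have e2 := ((hasFDerivAt_of_leftHalfPlane hV hw).sub (e1.hasFDerivAt.restrictScalars ℝ)).fderiv
  refine (congrArg (fun T : ℂ →L[ℝ] ℂ => T v) e2).trans ?_
  simp
  ring

theorem contDiffOn_sub_exp (hV : ContDiffOn ℝ 1 V (leftHalfPlane a)) (α : ℂ) (m : ℤ) :
    ContDiffOn ℝ 1 (fun w => V w - α * cexp (m * w)) (leftHalfPlane a) :=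
  hV.sub (by fun_prop : ContDiff ℝ 1 fun w : ℂ => α * cexp (m * w)).contDiffOn

theorem sub_exp_periodic (hper : ∀ w, V (w + 2 * Real.pi * I) = V w) (α : ℂ) (m : ℤ) (w : ℂ) :
    V (w + 2 * Real.pi * I) - α * cexp (m * (w + 2 * Real.pi * I)) = V w - α * cexp (m * w) := by
  rw [hper]
  congr 2
  rw [Complex.exp_eq_exp_iff_exists_int]
  exact ⟨m, by ring⟩

theorem fourierMode_sub_exp (hV : ContinuousOn V (leftHalfPlane a)) (α : ℂ) (m : ℤ) (hs : s < a) :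
    fourierMode m (fun w => V w - α * cexp (m * w)) s = fourierMode m V s - 2 * Real.pi * α := by
  have h1 : ContinuousOn (fun w => cexp (-(m * w)) * V w) (leftHalfPlane a) :=
    (by fun_prop : Continuous fun w : ℂ => cexp (-(m * w))).continuousOn.mul hV
  have h2 : segInt (fun _ => α) s = 2 * Real.pi * α := by
    simp [segInt]
  rw [← h2, fourierMode, fourierMode, ← segInt_sub h1 continuousOn_const hs]
  refine segInt_congr fun w _ => ?_
  rw [mul_sub, mul_left_comm, ← Complex.exp_add, neg_add_cancel, Complex.exp_zero, mul_one]

theorem norm_mul_exp_sq (α : ℂ) (m : ℤ) (w : ℂ) :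
    ‖α * cexp (m * w)‖ ^ 2 = ‖α‖ ^ 2 * Real.exp (2 * m * w.re) := by
  rw [norm_mul, mul_pow, Complex.norm_exp, ← Real.exp_nat_mul]
  congr 2
  simp
  ring

end ModeExpansion

section ModeApproximation

variable {a K M : ℝ} {V : ℂ → ℂ}

theorem sum_le_sum_filter_add {f : ℤ → ℝ} (hf : ∀ n, 0 ≤ f n) (S : Finset ℤ) (m : ℤ) :
    ∑ n ∈ S, f n ≤ ∑ n ∈ S with n < m, f n + (∑ n ∈ S with m < n, f n + f m) := by
  rw [← Finset.sum_filter_add_sum_filter_not S (· < m) f,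
    ← Finset.sum_filter_add_sum_filter_not (S.filter (¬ · < m)) (m < ·) f]
  refine add_le_add_right (add_le_add ?_ ?_) _
  · rw [Finset.filter_filter]
    exact Finset.sum_le_sum_of_subset_of_nonneg
      (fun n hn => by simp only [Finset.mem_filter] at hn ⊢; exact ⟨hn.1, hn.2.2⟩) fun n _ _ => hf n
  · rw [← Finset.sum_singleton f m]
    refine Finset.sum_le_sum_of_subset_of_nonneg (fun n hn => ?_) fun n _ _ => hf n
    simp only [Finset.mem_filter, Finset.mem_singleton] at hn ⊢
    omega

theorem exists_mode_approx (hV : ContDiffOn ℝ 1 V (leftHalfPlane a))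
    (hper : ∀ w, V (w + 2 * Real.pi * I) = V w) (m : ℤ)
    (hG : ∀ s < a, segInt (fun w => ‖fderiv ℝ V w 1 + I * fderiv ℝ V w I‖ ^ 2) s
      ≤ K * Real.exp ((2 * m + 1) * s)) (hK : 0 ≤ K)
    (hM : ∀ s < a, segInt (fun w => ‖V w‖ ^ 2) s ≤ M * Real.exp ((2 * m + 1 - 2) * s))
    {b : ℝ} (hb : b < a) :
    ∃ α K', ∀ s ≤ b, segInt (fun w => ‖V w - α * cexp (m * w)‖ ^ 2) s
      ≤ K' * Real.exp ((2 * m + 1) * s) := by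
  have hπ := Real.pi_pos
  obtain ⟨α₀, hα₀⟩ := exists_limit_fourierMode hV hper m hG hK
  set α : ℂ := (2 * Real.pi : ℂ)⁻¹ * α₀ with hα
  have hα' : 2 * Real.pi * α = α₀ := by
    rw [hα, mul_inv_cancel_left₀]
    exact_mod_cast Real.two_pi_pos.ne'
  have hE := contDiffOn_sub_exp hV α m
  have hEper := sub_exp_periodic hper α m
  set e : ℂ → ℂ := fun w => V w - α * cexp (m * w) with he
  have hGe : ∀ s < a, segInt (fun w => ‖fderiv ℝ e w 1 + I * fderiv ℝ e w I‖ ^ 2) s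
      ≤ K * Real.exp ((2 * m + 1) * s) := by
    intro s hs
    refine le_of_eq_of_le (segInt_congr fun w hw => ?_) (hG s hs)
    have hw' : w ∈ leftHalfPlane a := mem_leftHalfPlane.2 (hw ▸ hs)
    rw [fderiv_sub_exp hV α m hw', fderiv_sub_exp hV α m hw']
    congr 2
    linear_combination (-(α * (m * cexp (m * w)))) * I_mul_I
  have hMe : ∀ s < a, segInt (fun w => ‖e w‖ ^ 2) s
      ≤ (2 * M + 4 * Real.pi * ‖α‖ ^ 2 * Real.exp a) * Real.exp ((2 * m + 1 - 2) * s) := by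
    intro s hs
    have h1 : segInt (fun w => ‖e w‖ ^ 2) s
        ≤ segInt (fun w => 2 * ‖V w‖ ^ 2 + 2 * ‖α‖ ^ 2 * Real.exp (2 * m * s)) s := by
      refine segInt_mono (a := a) (contDiffOn_normSq hE).continuousOn
        ((continuousOn_const.mul (hV.continuousOn.norm.pow 2)).add continuousOn_const) hs
        fun w hw => ?_
      have h2 := norm_mul_exp_sq α m w
      have h3 := norm_sub_le (V w) (α * cexp (m * w))
      have h4 : ‖e w‖ ^ 2 ≤ (‖V w‖ + ‖α * cexp (m * w)‖) ^ 2 :=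
        pow_le_pow_left₀ (norm_nonneg _) h3 2
      rw [hw] at h2
      nlinarith [sq_nonneg (‖V w‖ - ‖α * cexp (m * w)‖)]
    rw [segInt_add (a := a) (continuousOn_const.fun_mul (contDiffOn_normSq hV).continuousOn)
      continuousOn_const hs, segInt_const_mul 2 fun w => ‖V w‖ ^ 2, segInt_const] at h1
    have h2 : Real.exp (2 * m * s) ≤ Real.exp a * Real.exp ((2 * m + 1 - 2) * s) := by
      rw [← Real.exp_add]
      exact Real.exp_le_exp.2 (by linarith)
    have h3 := mul_le_mul_of_nonneg_left h2 (by positivity : 0 ≤ 4 * Real.pi * ‖α‖ ^ 2)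
    have h4 := hM s hs
    linarith
  set E₀ := segInt (fun w => ‖e w‖ ^ 2) b with hE₀
  have hE₀' : 0 ≤ E₀ := segInt_nonneg fun w _ => sq_nonneg _
  have key : ∀ s ≤ b, 2 * Real.pi * segInt (fun w => ‖e w‖ ^ 2) s
      ≤ (20 * Real.pi * K + 2 * Real.pi * E₀ * Real.exp (-(2 * m + 1) * b))
        * Real.exp ((2 * m + 1) * s) := by
    intro s hs
    refine hasSum_le_of_sum_le (hasSum_fourierMode hE.continuousOn (hs.trans_lt hb)) fun S => ?_
    refine (sum_le_sum_filter_add (fun n => sq_nonneg _) S m).trans ?_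
    have h1 := sum_low_modes_le (S := S.filter (· < m)) hE hEper hGe hK hMe
      (fun n hn => by
        have h : n + 1 ≤ m := (Finset.mem_filter.1 hn).2
        have h' : (n : ℝ) + 1 ≤ m := by exact_mod_cast h
        linarith) (hs.trans_lt hb)
    have h2 := sum_high_modes_le (S := S.filter (m < ·)) hE hEper hGe hK
      (fun n hn => by
        have h : m + 1 ≤ n := (Finset.mem_filter.1 hn).2
        have h' : (m : ℝ) + 1 ≤ n := by exact_mod_cast h
        linarith) hs hb
    have h3 := hα₀ s (hs.trans_lt hb)
    rw [← hα', ← fourierMode_sub_exp hV.continuousOn α m (hs.trans_lt hb)] at h3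
    have h4 : Real.exp ((2 * m + 1 + 1 / 2) * (s - b))
        ≤ Real.exp (-(2 * m + 1) * b) * Real.exp ((2 * m + 1) * s) := by
      rw [← Real.exp_add]
      exact Real.exp_le_exp.2 (by linarith)
    have h5 := mul_le_mul_of_nonneg_right h4 (by positivity : 0 ≤ 2 * Real.pi * E₀)
    linarith
  refine ⟨α, (20 * Real.pi * K + 2 * Real.pi * E₀ * Real.exp (-(2 * m + 1) * b)) / (2 * Real.pi),
    fun s hs => ?_⟩
  rw [div_mul_eq_mul_div, le_div_iff₀ Real.two_pi_pos, mul_comm]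
  exact key s hs

end ModeApproximation

section LeadingTerm

variable {a C s : ℝ} {U : ℂ → ℂ} {F L : ℂ → (ℂ →L[ℝ] ℂ)}

theorem neg_le_fderiv_normSq_I {f : ℂ → ℂ} (hf : ContDiffOn ℝ 1 f (leftHalfPlane a)) {l : ℝ}
    (hl : 0 < l) {w : ℂ} (hw : w ∈ leftHalfPlane a) :
    -(l * ‖f w‖ ^ 2 + l⁻¹ * ‖fderiv ℝ f w I‖ ^ 2) ≤ fderiv ℝ (fun w => ‖f w‖ ^ 2) w I := by
  have h := (hasFDerivAt_of_leftHalfPlane hf hw).norm_sq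
  rw [h.fderiv]
  have h1 := (abs_le.1 (abs_real_inner_le_norm (f w) (fderiv ℝ f w I))).1
  simp only [smul_apply, ContinuousLinearMap.comp_apply, innerSL_apply_apply,
    nsmul_eq_mul, Nat.cast_ofNat]
  have h2 := mul_nonneg hl.le (sq_nonneg (‖f w‖ - l⁻¹ * ‖fderiv ℝ f w I‖))
  have h3 : l * (‖f w‖ - l⁻¹ * ‖fderiv ℝ f w I‖) ^ 2 = l * ‖f w‖ ^ 2
      + l⁻¹ * ‖fderiv ℝ f w I‖ ^ 2 - 2 * (‖f w‖ * ‖fderiv ℝ f w I‖) := by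
    field_simp
    ring
  linarith

/-- A one-dimensional Sobolev inequality on the vertical circles of the cylinder. -/
theorem norm_sq_le_segInt {f : ℂ → ℂ} (hf : ContDiffOn ℝ 1 f (leftHalfPlane a))
    (hper : ∀ w, f (w + 2 * Real.pi * I) = f w) {l : ℝ} (hl : 0 < l) {w : ℂ}
    (hw : w ∈ leftHalfPlane a) :
    ‖f w‖ ^ 2 ≤ segInt (fun w => ‖f w‖ ^ 2) w.re
      + (l * segInt (fun w => ‖f w‖ ^ 2) w.re
        + l⁻¹ * segInt (fun w => ‖fderiv ℝ f w I‖ ^ 2) w.re) := by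
  have hre : w.re < a := hw
  set G : ℂ → ℝ := fun w => l * ‖f w‖ ^ 2 + l⁻¹ * ‖fderiv ℝ f w I‖ ^ 2 with hG
  have cN := (contDiffOn_normSq hf).continuousOn
  have cT := continuousOn_normSq_fderiv hf I
  have cG : ContinuousOn G (leftHalfPlane a) :=
    (continuousOn_const.fun_mul cN).fun_add (continuousOn_const.fun_mul cT)
  have hGper : ∀ w, G (w + 2 * Real.pi * I) = G w := fun w => by
    simp only [hG]
    rw [hper, fderiv_periodic hper]
  have hshift : ∀ {g : ℂ → ℝ}, (∀ w, g (w + 2 * Real.pi * I) = g w) →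
      ∫ θ in (0 : ℝ)..(2 * Real.pi), g (w + θ * I) = segInt g w.re := by
    intro g hg
    rw [← segInt_shift hg w.im]
    refine intervalIntegral.integral_congr fun θ _ => ?_
    simp only
    congr 1
    conv_lhs => rw [← Complex.re_add_im w]
    ring
  have hmem : ∀ θ : ℝ, w + θ * I ∈ leftHalfPlane a := fun θ => by
    simpa [mem_leftHalfPlane] using hw
  have hline : Continuous fun θ : ℝ => w + θ * I := by fun_prop
  have cline : ∀ {g : ℂ → ℝ}, ContinuousOn g (leftHalfPlane a) →
      Continuous fun θ : ℝ => g (w + θ * I) := fun hg => hg.comp_continuous hline hmem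
  have hG0 : ∀ w, 0 ≤ G w := fun w => by positivity
  set R := segInt G w.re with hR
  have key : ∀ θ ∈ Set.Icc 0 (2 * Real.pi), ‖f w‖ ^ 2 ≤ ‖f (w + θ * I)‖ ^ 2 + R := by
    intro θ hθ
    have h1 := intervalIntegral.integral_eq_sub_of_hasDerivAt (a := 0) (b := θ)
      (fun x _ => hasDerivAt_vertical (contDiffOn_normSq hf) hw x)
      ((cline (continuousOn_fderiv_apply (contDiffOn_normSq hf) I)).intervalIntegrable _ _)
    have h2 : ∫ x in (0 : ℝ)..θ, -G (w + x * I)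
        ≤ ∫ x in (0 : ℝ)..θ, fderiv ℝ (fun w => ‖f w‖ ^ 2) (w + x * I) I :=
      intervalIntegral.integral_mono_on hθ.1 ((cline cG).neg.intervalIntegrable _ _)
        ((cline (continuousOn_fderiv_apply (contDiffOn_normSq hf) I)).intervalIntegrable _ _)
        fun x _ => neg_le_fderiv_normSq_I hf hl (hmem x)
    have h3 : ∫ x in (0 : ℝ)..θ, G (w + x * I) ≤ ∫ x in (0 : ℝ)..(2 * Real.pi), G (w + x * I) :=
      intervalIntegral.integral_mono_interval le_rfl hθ.1 hθ.2
        (MeasureTheory.ae_of_all _ fun x => hG0 _) ((cline cG).intervalIntegrable _ _)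
    rw [hshift hGper] at h3
    rw [intervalIntegral.integral_neg, h1] at h2
    simp only [Complex.ofReal_zero, zero_mul, add_zero] at h2
    linarith
  have h4 := intervalIntegral.integral_mono_on Real.two_pi_pos.le
    (continuous_const.intervalIntegrable (μ := MeasureTheory.volume) 0 (2 * Real.pi))
    (((cline cN).fun_add continuous_const).intervalIntegrable (μ := MeasureTheory.volume) _ _) key
  rw [intervalIntegral.integral_add ((cline cN).intervalIntegrable _ _)
    (continuous_const.intervalIntegrable _ _),
    hshift (g := fun w => ‖f w‖ ^ 2) fun w => by rw [hper]] at h4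
  simp only [intervalIntegral.integral_const, smul_eq_mul, sub_zero] at h4
  have hN0 : 0 ≤ segInt (fun w => ‖f w‖ ^ 2) w.re := segInt_nonneg fun w _ => sq_nonneg _
  have hRe : R = l * segInt (fun w => ‖f w‖ ^ 2) w.re
      + l⁻¹ * segInt (fun w => ‖fderiv ℝ f w I‖ ^ 2) w.re := by
    rw [hR, hG, segInt_add (continuousOn_const.fun_mul cN) (continuousOn_const.fun_mul cT) hre,
      segInt_const_mul l fun w => ‖f w‖ ^ 2, segInt_const_mul l⁻¹ fun w => ‖fderiv ℝ f w I‖ ^ 2]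
  rw [← hRe]
  nlinarith [Real.pi_gt_three]

theorem IsCylinderSolution.exists_segInt_fderiv_le_exp (H : IsCylinderSolution a C U F L)
    (hC : C * Real.exp a ≤ 1 / 100) (k : ℝ) (hM0 : 0 ≤ M)
    (hM : ∀ s < a, segInt (fun w => ‖U w‖ ^ 2) s ≤ M * Real.exp (k * s)) :
    ∃ M' ≥ 0, ∀ s < a - 1, segInt (fun w => ‖fderiv ℝ U w I‖ ^ 2) s ≤ M' * Real.exp (k * s) := by
  refine ⟨2000000 * ((M + 1) * Real.exp |k|), by positivity, fun s hs => ?_⟩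
  refine (H.segInt_fderiv_le hC (s := s) (M := (M + 1) * Real.exp |k| * Real.exp (k * s))
    (by linarith) (by positivity) fun t ht => ?_).trans_eq (by ring)
  refine (hM t (by linarith [ht.2])).trans ?_
  rw [mul_assoc, ← Real.exp_add]
  refine mul_le_mul (by linarith) (Real.exp_le_exp.2 ?_) (Real.exp_pos _).le (by linarith)
  have h1 : k * (t - s) ≤ |k| * 1 := by
    refine (le_abs_self _).trans ?_
    rw [abs_mul]
    exact mul_le_mul_of_nonneg_left (abs_le.2 ⟨by linarith [ht.1], by linarith [ht.2]⟩)
      (abs_nonneg k)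
  linarith

theorem IsCylinderSolution.segInt_dbar_le (H : IsCylinderSolution a C U F L)
    (hC : C * Real.exp a ≤ 1 / 100) (hs : s < a) :
    segInt (fun w => ‖fderiv ℝ U w 1 + I * fderiv ℝ U w I‖ ^ 2) s
      ≤ 18 * C ^ 2 * Real.exp (2 * s) * (segInt (fun w => ‖U w‖ ^ 2) s
        + segInt (fun w => ‖fderiv ℝ U w I‖ ^ 2) s) := by
  have cN := (contDiffOn_normSq H.smooth).continuousOn
  have cT := continuousOn_normSq_fderiv H.smooth I
  rw [← segInt_add cN cT hs,
    ← segInt_const_mul (18 * C ^ 2 * Real.exp (2 * s))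
      fun w => ‖U w‖ ^ 2 + ‖fderiv ℝ U w I‖ ^ 2]
  refine segInt_mono (a := a) ((continuousOn_dbar H.smooth).norm.pow 2)
    (continuousOn_const.fun_mul (cN.fun_add cT)) hs fun w hw => ?_
  have h1 := pow_le_pow_left₀ (norm_nonneg _)
    (H.norm_dbar_le hC (w := w) (mem_leftHalfPlane.2 (hw ▸ hs))) 2
  have h2 : Real.exp (2 * s) = Real.exp s ^ 2 := by
    rw [← Real.exp_nat_mul]
    norm_num
  rw [hw] at h1
  rw [h2]
  have h3 := mul_nonneg (sq_nonneg (3 * (C * Real.exp s)))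
    (sq_nonneg (‖U w‖ - ‖fderiv ℝ U w I‖))
  linarith

theorem IsCylinderSolution.exists_mode_approx (H : IsCylinderSolution a C U F L)
    (hC : C * Real.exp a ≤ 1 / 100) (m : ℤ) (hM0 : 0 ≤ M)
    (hM : ∀ s < a, segInt (fun w => ‖U w‖ ^ 2) s ≤ M * Real.exp ((2 * m + 1 - 2) * s)) :
    ∃ α K, ∀ s ≤ a - 2, segInt (fun w => ‖U w - α * cexp (m * w)‖ ^ 2) s
      ≤ K * Real.exp ((2 * m + 1) * s) := by
  obtain ⟨M', hM'0, hM'⟩ := H.exists_segInt_fderiv_le_exp hC _ hM0 hM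
  have H' := H.mono (b := a - 1) (by linarith)
  refine _root_.exists_mode_approx H'.smooth H'.periodic m (K := 18 * C ^ 2 * (M + M'))
    (fun s hs => ?_) (by positivity) (fun s hs => hM s (by linarith)) (by linarith)
  refine (H.segInt_dbar_le hC (by linarith)).trans ?_
  have h1 := add_le_add (hM s (by linarith)) (hM' s hs)
  refine (mul_le_mul_of_nonneg_left h1 (by positivity)).trans_eq ?_
  have h2 : Real.exp ((2 * m + 1) * s) = Real.exp (2 * s) * Real.exp ((2 * m + 1 - 2) * s) := by
    rw [← Real.exp_add]
    congr 1
    ring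
  rw [h2]
  ring

end LeadingTerm

section LeadingMode

variable {a C : ℝ} {U : ℂ → ℂ} {F L : ℂ → (ℂ →L[ℝ] ℂ)}

theorem IsCylinderSolution.exists_leading_mode (H : IsCylinderSolution a C U F L)
    (hC : C * Real.exp a ≤ 1 / 100) {Q : ℝ} (hQ : ∀ w ∈ leftHalfPlane a, ‖U w‖ ≤ Q)
    {δ c s₁ : ℝ} (hδ : 0 < δ)
    (hlow : ∀ s ≤ s₁, δ * Real.exp (c * s) ≤ segInt (fun w => ‖U w‖ ^ 2) s) :
    ∃ m : ℕ, ∃ α : ℂ, α ≠ 0 ∧ ∃ b ≤ a, ∃ K : ℝ, ∀ s < b,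
      segInt (fun w => ‖U w - α * cexp ((m : ℤ) * w)‖ ^ 2) s
        ≤ K * Real.exp ((2 * m + 1) * s) := by
  classical
  let P : ℕ → Prop := fun n => ∃ b ≤ a, ∃ M ≥ 0, ∀ s < b,
    segInt (fun w => ‖U w‖ ^ 2) s ≤ M * Real.exp ((2 * n - 1) * s)
  have cN := (contDiffOn_normSq H.smooth).continuousOn
  have hP0 : P 0 := by
    refine ⟨min a 0, min_le_left _ _, 2 * Real.pi * Q ^ 2, by positivity, fun s hs => ?_⟩
    have hsa := hs.trans_le (min_le_left _ _)
    have h1 : segInt (fun w => ‖U w‖ ^ 2) s ≤ segInt (fun _ => Q ^ 2) s :=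
      segInt_mono cN continuousOn_const hsa fun w hw =>
        pow_le_pow_left₀ (norm_nonneg _) (hQ w (mem_leftHalfPlane.2 (hw ▸ hsa))) 2
    rw [segInt_const] at h1
    refine h1.trans (le_mul_of_one_le_right (by positivity) (Real.one_le_exp ?_))
    push_cast
    linarith [hs.trans_le (min_le_right a 0)]
  have hP : ∃ n, ¬ P n := by
    obtain ⟨n, hn⟩ := exists_nat_gt (|c| + 2)
    refine ⟨n, ?_⟩
    rintro ⟨b, -, M, hM0, hM⟩
    obtain ⟨t, ht, htM⟩ := exists_mul_exp_le (C := M) (min (min (b - 1) s₁) 0) hδ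
    have ht1 : t ≤ b - 1 := ht.trans ((min_le_left _ _).trans (min_le_left _ _))
    have ht2 : t ≤ s₁ := ht.trans ((min_le_left _ _).trans (min_le_right _ _))
    have ht3 : t ≤ 0 := ht.trans (min_le_right _ _)
    have h1 := (hlow t ht2).trans (hM t (by linarith))
    have h2 : M * Real.exp ((2 * n - 1) * t) ≤ M * Real.exp t * Real.exp (c * t) := by
      rw [mul_assoc, ← Real.exp_add]
      refine mul_le_mul_of_nonneg_left (Real.exp_le_exp.2 ?_) hM0
      have h3 : 0 ≤ 2 * (n : ℝ) - 2 - c := by linarith [le_abs_self c, abs_nonneg c]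
      linarith [mul_nonneg_of_nonpos_of_nonpos ht3 (neg_nonpos.2 h3)]
    exact absurd (h1.trans h2) (not_le.2 (mul_lt_mul_of_pos_right htM (Real.exp_pos _)))
  obtain ⟨n, hn⟩ : ∃ n, P n ∧ ¬ P (n + 1) := by
    by_contra! h
    obtain ⟨n, hn⟩ := hP
    exact hn (Nat.rec hP0 h n)
  obtain ⟨⟨b, hb, M, hM0, hM⟩, hn⟩ := hn
  have Hb := H.mono hb
  have hCb : C * Real.exp b ≤ 1 / 100 :=
    (mul_le_mul_of_nonneg_left (Real.exp_le_exp.2 hb) H.nonneg).trans hC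
  obtain ⟨α, K, hK⟩ := Hb.exists_mode_approx hCb n hM0 fun s hs => by
    refine (hM s hs).trans_eq ?_
    push_cast
    congr 3
    ring
  simp only [Int.cast_natCast] at hK
  refine ⟨n, α, fun hα => hn ⟨b - 2, by linarith, |K|, abs_nonneg K, fun s hs => ?_⟩,
    b - 2, by linarith, K, fun s hs => ?_⟩
  · have h := hK s hs.le
    simp only [hα, zero_mul, sub_zero] at h
    refine h.trans ?_
    push_cast
    rw [show 2 * ((n : ℝ) + 1) - 1 = 2 * n + 1 by ring]
    exact mul_le_mul_of_nonneg_right (le_abs_self K) (Real.exp_pos _).le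
  · simpa only [Int.cast_natCast] using hK s hs.le

theorem sq_norm_sub_le (x y : ℂ) : ‖x - y‖ ^ 2 ≤ 2 * ‖x‖ ^ 2 + 2 * ‖y‖ ^ 2 := by
  have h := pow_le_pow_left₀ (norm_nonneg _) (norm_sub_le x y) 2
  nlinarith [sq_nonneg (‖x‖ - ‖y‖)]

theorem segInt_sq_norm_sub_le {f g : ℂ → ℂ} (hf : ContinuousOn f (leftHalfPlane a))
    (hg : ContinuousOn g (leftHalfPlane a)) (hs : s < a) {c : ℝ}
    (hc : ∀ w, w.re = s → ‖g w‖ ^ 2 = c) :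
    segInt (fun w => ‖f w - g w‖ ^ 2) s
      ≤ 2 * segInt (fun w => ‖f w‖ ^ 2) s + 4 * Real.pi * c := by
  have cf : ContinuousOn (fun w => ‖f w‖ ^ 2) (leftHalfPlane a) := hf.norm.pow 2
  have h1 : segInt (fun w => ‖f w - g w‖ ^ 2) s ≤ segInt (fun w => 2 * ‖f w‖ ^ 2 + 2 * c) s :=
    segInt_mono ((hf.sub hg).norm.pow 2) ((continuousOn_const.fun_mul cf).fun_add
      continuousOn_const) hs fun w hw => hc w hw ▸ sq_norm_sub_le (f w) (g w)
  rw [segInt_add (continuousOn_const.fun_mul cf) continuousOn_const hs,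
    segInt_const_mul 2 fun w => ‖f w‖ ^ 2, segInt_const] at h1
  linarith

theorem IsCylinderSolution.exists_norm_sub_mode_le (H : IsCylinderSolution a C U F L)
    (hC : C * Real.exp a ≤ 1 / 100) {m : ℤ} {α : ℂ} (hK0 : 0 ≤ K)
    (hK : ∀ s < a, segInt (fun w => ‖U w - α * cexp (m * w)‖ ^ 2) s
      ≤ K * Real.exp ((2 * m + 1) * s)) :
    ∃ K' ≥ 0, ∀ w ∈ leftHalfPlane (a - 1),
      ‖U w - α * cexp (m * w)‖ ^ 2 ≤ K' * Real.exp ((2 * m + 1 / 2) * w.re) := by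
  have hE := contDiffOn_sub_exp H.smooth α m
  have cexp' : ∀ β : ℂ, ContinuousOn (fun w => β * cexp (m * w)) (leftHalfPlane a) := fun β =>
    (by fun_prop : Continuous fun w : ℂ => β * cexp (m * w)).continuousOn
  have hN : ∀ s < a, segInt (fun w => ‖U w‖ ^ 2) s
      ≤ (2 * K * Real.exp a + 4 * Real.pi * ‖α‖ ^ 2) * Real.exp (2 * m * s) := by
    intro s hs
    have h1 := segInt_sq_norm_sub_le hE.continuousOn (cexp' (-α)) hs
      (c := ‖α‖ ^ 2 * Real.exp (2 * m * s))
      fun w hw => by rw [norm_mul_exp_sq, norm_neg, hw]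
    rw [segInt_congr (g := fun w => ‖U w‖ ^ 2) fun w _ => by ring_nf] at h1
    have h2 : Real.exp ((2 * m + 1) * s) ≤ Real.exp a * Real.exp (2 * m * s) := by
      rw [← Real.exp_add]
      exact Real.exp_le_exp.2 (by linarith)
    have h3 := mul_le_mul_of_nonneg_left h2 hK0
    have h4 := hK s hs
    linarith
  obtain ⟨M, hM0, hM⟩ := H.exists_segInt_fderiv_le_exp hC (2 * m) (by positivity) hN
  have hT : ∀ s < a - 1, segInt (fun w => ‖fderiv ℝ (fun w => U w - α * cexp (m * w)) w I‖ ^ 2) s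
      ≤ (2 * M + 4 * Real.pi * ‖α * m * I‖ ^ 2) * Real.exp (2 * m * s) := by
    intro s hs
    have hsa : s < a := by linarith
    have h1 := segInt_sq_norm_sub_le (continuousOn_fderiv_apply H.smooth I) (cexp' (α * m * I)) hsa
      (c := ‖α * m * I‖ ^ 2 * Real.exp (2 * m * s))
      fun w hw => by rw [norm_mul_exp_sq, hw]
    rw [segInt_congr (g := fun w => ‖fderiv ℝ (fun w => U w - α * cexp (m * w)) w I‖ ^ 2)
      fun w hw => by
        rw [fderiv_sub_exp H.smooth α m (mem_leftHalfPlane.2 (hw ▸ hsa))]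
        ring_nf] at h1
    linarith [hM s hs]
  refine ⟨K * Real.exp (a / 2) + K + (2 * M + 4 * Real.pi * ‖α * m * I‖ ^ 2), by positivity,
    fun w hw => ?_⟩
  have hwa : w.re < a - 1 := hw
  have h1 := norm_sq_le_segInt hE (sub_exp_periodic H.periodic α m) (Real.exp_pos (-(w.re / 2)))
    (w := w) (mem_leftHalfPlane.2 (by linarith))
  have h2 := hK w.re (by linarith)
  have h3 := mul_le_mul_of_nonneg_left h2 (Real.exp_pos (-(w.re / 2))).le
  have h4 := mul_le_mul_of_nonneg_left (hT w.re hwa) (Real.exp_pos (w.re / 2)).le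
  have e1 : Real.exp ((2 * m + 1) * w.re)
      ≤ Real.exp (a / 2) * Real.exp ((2 * m + 1 / 2) * w.re) := by
    rw [← Real.exp_add]
    exact Real.exp_le_exp.2 (by linarith)
  have e2 : Real.exp (-(w.re / 2)) * Real.exp ((2 * m + 1) * w.re)
      = Real.exp ((2 * m + 1 / 2) * w.re) := by
    rw [← Real.exp_add]
    congr 1
    ring
  have e3 : Real.exp (w.re / 2) * Real.exp (2 * m * w.re)
      = Real.exp ((2 * m + 1 / 2) * w.re) := by
    rw [← Real.exp_add]
    congr 1
    ring
  rw [mul_left_comm, e2] at h3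
  rw [mul_left_comm, e3] at h4
  rw [← Real.exp_neg, neg_neg] at h1
  have h5 := mul_le_mul_of_nonneg_left e1 hK0
  linarith

end LeadingMode

section CylinderCoordinates

theorem exists_local_bounds {E : Type*} [NormedAddCommGroup E] [NormedSpace ℝ E] {f : ℂ → E} {r : ℝ}
    (hr : 0 < r) (hf : ContDiffOn ℝ 1 f (Metric.ball (0 : ℂ) r)) :
    ∃ K, ∀ᶠ ρ in nhdsWithin (0 : ℝ) (Set.Ioi 0), ∀ z ∈ Metric.ball (0 : ℂ) ρ,
      ‖f z‖ ≤ K ∧ ‖fderiv ℝ f z‖ ≤ K ∧ ‖f z - f 0‖ ≤ K * ‖z‖ := by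
  have h0 : Metric.ball (0 : ℂ) r ∈ nhds (0 : ℂ) := Metric.ball_mem_nhds _ hr
  have hf0 := hf.contDiffAt h0
  have c1 : ContinuousAt (fun z => ‖f z‖) 0 := hf0.continuousAt.norm
  have c2 : ContinuousAt (fun z => ‖fderiv ℝ f z‖) 0 := (hf0.continuousAt_fderiv one_ne_zero).norm
  have e1 := c1.eventually (ge_mem_nhds (lt_add_one ‖f 0‖))
  have e2 := c2.eventually (ge_mem_nhds (lt_add_one ‖fderiv ℝ f 0‖))
  obtain ⟨ρ₀, hρ₀, hb⟩ := Metric.eventually_nhds_iff_ball.1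
    ((e1.and e2).and (Metric.ball_mem_nhds (0 : ℂ) hr))
  refine ⟨max (‖f 0‖ + 1) (‖fderiv ℝ f 0‖ + 1), ?_⟩
  filter_upwards [Ioo_mem_nhdsGT hρ₀] with ρ hρ z hz
  have hsub : ∀ z ∈ Metric.ball (0 : ℂ) ρ, z ∈ Metric.ball (0 : ℂ) ρ₀ := fun z hz =>
    Metric.ball_subset_ball hρ.2.le hz
  refine ⟨(hb z (hsub z hz)).1.1.trans (le_max_left _ _),
    (hb z (hsub z hz)).1.2.trans (le_max_right _ _), ?_⟩
  have h1 := (convex_ball (0 : ℂ) ρ).norm_image_sub_le_of_norm_fderiv_le (𝕜 := ℝ) (f := f)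
    (C := max (‖f 0‖ + 1) (‖fderiv ℝ f 0‖ + 1)) (fun x hx =>
      (hf.contDiffAt (Metric.isOpen_ball.mem_nhds (hb x (hsub x hx)).2)).differentiableAt one_ne_zero)
    (fun x hx => (hb x (hsub x hx)).1.2.trans (le_max_right _ _))
    (Metric.mem_ball_self hρ.1) hz
  simpa using h1

theorem norm_fderiv_clm_comp_le {P Q : ℂ → (ℂ →L[ℝ] ℂ)} {w : ℂ} (hP : DifferentiableAt ℝ P w)
    (hQ : DifferentiableAt ℝ Q w) :
    ‖fderiv ℝ (fun w => (P w).comp (Q w)) w‖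
      ≤ ‖P w‖ * ‖fderiv ℝ Q w‖ + ‖Q w‖ * ‖fderiv ℝ P w‖ := by
  rw [fderiv_clm_comp hP hQ]
  refine ContinuousLinearMap.opNorm_le_bound _ (by positivity) fun v => ?_
  have h1 : ‖(P w).comp (fderiv ℝ Q w v)‖ ≤ ‖P w‖ * (‖fderiv ℝ Q w‖ * ‖v‖) :=
    (ContinuousLinearMap.opNorm_comp_le _ _).trans
      (mul_le_mul_of_nonneg_left ((fderiv ℝ Q w).le_opNorm v) (norm_nonneg _))
  have h2 : ‖(fderiv ℝ P w v).comp (Q w)‖ ≤ ‖fderiv ℝ P w‖ * ‖v‖ * ‖Q w‖ :=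
    (ContinuousLinearMap.opNorm_comp_le _ _).trans
      (mul_le_mul_of_nonneg_right ((fderiv ℝ P w).le_opNorm v) (norm_nonneg _))
  refine (norm_add_le _ _).trans ((add_le_add h1 h2).trans_eq ?_)
  ring

theorem norm_fderiv_mul_le {c : ℂ → ℂ} {w : ℂ} (hc : DifferentiableAt ℝ c w) :
    ‖fderiv ℝ (fun w => ContinuousLinearMap.mul ℝ ℂ (c w)) w‖ ≤ ‖fderiv ℝ c w‖ := by
  have h : fderiv ℝ (fun w => ContinuousLinearMap.mul ℝ ℂ (c w)) w
      = (ContinuousLinearMap.mul ℝ ℂ).comp (fderiv ℝ c w) :=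
    ((ContinuousLinearMap.mul ℝ ℂ).hasFDerivAt.comp w hc.hasFDerivAt).fderiv
  rw [h]
  refine (ContinuousLinearMap.opNorm_comp_le _ _).trans ?_
  exact mul_le_of_le_one_left (norm_nonneg _) (ContinuousLinearMap.opNorm_mul_le ℝ ℂ)

theorem hasFDerivAt_exp_real (w : ℂ) :
    HasFDerivAt cexp (ContinuousLinearMap.mul ℝ ℂ (cexp w)) w := by
  refine ((Complex.hasDerivAt_exp w).hasFDerivAt.restrictScalars ℝ).congr_fderiv ?_
  ext v
  simp [mul_comm]

theorem norm_fderiv_exp_neg_le (w : ℂ) :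
    ‖fderiv ℝ (fun w => cexp (-w)) w‖ ≤ ‖cexp (-w)‖ := by
  have h : HasFDerivAt (fun w : ℂ => cexp (-w)) _ w :=
    (hasFDerivAt_exp_real (-w)).comp w (hasFDerivAt_id w).neg
  rw [h.fderiv]
  refine ContinuousLinearMap.opNorm_le_bound _ (norm_nonneg _) fun v => ?_
  simp

theorem norm_fderiv_conj_exp_le (κ w : ℂ) :
    ‖fderiv ℝ (fun w => κ * (starRingEnd ℂ) (cexp w)) w‖ ≤ ‖κ‖ * ‖cexp w‖ := by
  have h : HasFDerivAt (fun w : ℂ => κ * (starRingEnd ℂ) (cexp w)) _ w :=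
    ((Complex.conjCLE.hasFDerivAt (x := cexp w)).comp w (hasFDerivAt_exp_real w)).const_mul κ
  rw [h.fderiv]
  refine ContinuousLinearMap.opNorm_le_bound _ (by positivity) fun v => ?_
  simp [mul_assoc]

theorem norm_fderiv_comp_exp_le {E : Type*} [NormedAddCommGroup E] [NormedSpace ℝ E] {f : ℂ → E}
    {w : ℂ} (hf : DifferentiableAt ℝ f (cexp w)) :
    ‖fderiv ℝ (fun w => f (cexp w)) w‖ ≤ ‖fderiv ℝ f (cexp w)‖ * ‖cexp w‖ := by
  have h : fderiv ℝ (fun w => f (cexp w)) w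
      = (fderiv ℝ f (cexp w)).comp (ContinuousLinearMap.mul ℝ ℂ (cexp w)) :=
    (hf.hasFDerivAt.comp w (hasFDerivAt_exp_real w)).fderiv
  rw [h]
  refine (ContinuousLinearMap.opNorm_comp_le _ _).trans ?_
  exact mul_le_mul_of_nonneg_left (ContinuousLinearMap.opNorm_mul_apply_le _ _ _) (norm_nonneg _)

theorem cylinder_equation {u : ℂ → ℂ} {S T : ℂ →L[ℝ] ℂ} {w : ℂ}
    (hu : DifferentiableAt ℝ u (cexp w))
    (heq : wirtingerDerivBar u (cexp w) = S (u (cexp w)) + T (wirtingerDeriv u (cexp w))) :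
    fderiv ℝ (fun w => u (cexp w)) w 1 + I * fderiv ℝ (fun w => u (cexp w)) w I
      = 2 * (starRingEnd ℂ) (cexp w) * S (u (cexp w))
        + 1 * (starRingEnd ℂ) (cexp w) * T (cexp (-w)
          * (fderiv ℝ (fun w => u (cexp w)) w 1 - I * fderiv ℝ (fun w => u (cexp w)) w I)) := by
  have h : ∀ v, fderiv ℝ (fun w => u (cexp w)) w v
      = wirtingerDeriv u (cexp w) * (cexp w * v)
        + wirtingerDerivBar u (cexp w) * (starRingEnd ℂ) (cexp w * v) := by
    intro v
    have h1 : fderiv ℝ (fun w => u (cexp w)) w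
        = (fderiv ℝ u (cexp w)).comp (ContinuousLinearMap.mul ℝ ℂ (cexp w)) :=
      (hu.hasFDerivAt.comp w (hasFDerivAt_exp_real w)).fderiv
    rw [h1]
    exact apply_eq_linPart_add_conjPart (fderiv ℝ u (cexp w)) (cexp w * v)
  have hX : cexp (-w) * (fderiv ℝ (fun w => u (cexp w)) w 1
      - I * fderiv ℝ (fun w => u (cexp w)) w I) = (2 : ℝ) • wirtingerDeriv u (cexp w) := by
    rw [h, h, Complex.exp_neg]
    have hz := Complex.exp_ne_zero w
    rw [inv_mul_eq_iff_eq_mul₀ hz]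
    simp only [map_mul, Complex.conj_I, mul_one, Complex.real_smul, Complex.ofReal_ofNat]
    linear_combination (-(wirtingerDeriv u (cexp w) * cexp w)
      + wirtingerDerivBar u (cexp w) * (starRingEnd ℂ) (cexp w)) * I_mul_I
  rw [hX, map_smul, h, h]
  simp only [map_mul, Complex.conj_I, mul_one, one_mul, Complex.real_smul, Complex.ofReal_ofNat]
  linear_combination (wirtingerDeriv u (cexp w) * cexp w
      - wirtingerDerivBar u (cexp w) * (starRingEnd ℂ) (cexp w)) * I_mul_I
    + 2 * (starRingEnd ℂ) (cexp w) * heq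

end CylinderCoordinates

section SimilarityPrinciple

theorem mul_le_of_bounds {x y K t t' : ℝ} (hx : x ≤ t) (hy : y ≤ K * t') (hy0 : 0 ≤ y) (ht : 0 ≤ t) :
    x * y ≤ K * t' * t :=
  (mul_le_mul hx hy hy0 ht).trans_eq (mul_comm _ _)

theorem exists_isCylinderSolution {r : ℝ} (hr : 0 < r) {u : ℂ → ℂ} {A B : ℂ → (ℂ →L[ℝ] ℂ)}
    (hu : ContDiffOn ℝ 1 u (Metric.ball (0 : ℂ) r))
    (hA : ContDiffOn ℝ 1 A (Metric.ball (0 : ℂ) r))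
    (hB : ContDiffOn ℝ 1 B (Metric.ball (0 : ℂ) r)) (hB0 : B 0 = 0)
    (heq : ∀ z ∈ Metric.ball (0 : ℂ) r,
      wirtingerDerivBar u z = A z (u z) + B z (wirtingerDeriv u z)) :
    ∃ a C Q : ℝ, ∃ F L : ℂ → (ℂ →L[ℝ] ℂ), IsCylinderSolution a C (fun w => u (cexp w)) F L ∧
      ∀ w ∈ leftHalfPlane a, ‖u (cexp w)‖ ≤ Q := by
  obtain ⟨Q, hQ⟩ := exists_local_bounds hr hu
  obtain ⟨KA, hKA⟩ := exists_local_bounds hr hA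
  obtain ⟨KB, hKB⟩ := exists_local_bounds hr hB
  obtain ⟨ρ, ⟨hQ, hKA, hKB⟩, hρ0, hρr⟩ :=
    ((hQ.and (hKA.and hKB)).and (Ioo_mem_nhdsGT (lt_min hr one_pos))).exists
  have hmem : ∀ w ∈ leftHalfPlane (Real.log ρ), cexp w ∈ Metric.ball (0 : ℂ) ρ := by
    intro w hw
    rw [mem_ball_zero_iff, Complex.norm_exp]
    exact (Real.lt_log_iff_exp_lt hρ0).1 hw
  have hmemr : ∀ w ∈ leftHalfPlane (Real.log ρ), cexp w ∈ Metric.ball (0 : ℂ) r := fun w hw =>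
    Metric.ball_subset_ball (hρr.le.trans (min_le_left _ _)) (hmem w hw)
  have hle1 : ∀ w ∈ leftHalfPlane (Real.log ρ), Real.exp w.re ≤ 1 := by
    intro w hw
    rw [← Complex.norm_exp]
    exact (mem_ball_zero_iff.1 (hmem w hw)).le.trans (hρr.le.trans (min_le_right _ _))
  have hKA0 : 0 ≤ KA := (norm_nonneg _).trans (hKA 0 (Metric.mem_ball_self hρ0)).1
  have hKB0 : 0 ≤ KB := (norm_nonneg _).trans (hKB 0 (Metric.mem_ball_self hρ0)).1
  have hexp : ContDiff ℝ 1 cexp := Complex.contDiff_exp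
  have smooth_comp : ∀ {E : Type} [NormedAddCommGroup E] [NormedSpace ℝ E] {f : ℂ → E},
      ContDiffOn ℝ 1 f (Metric.ball (0 : ℂ) r) →
      ContDiffOn ℝ 1 (fun w => f (cexp w)) (leftHalfPlane (Real.log ρ)) :=
    fun hf => hf.comp hexp.contDiffOn hmemr
  have hdiff : ∀ {E : Type} [NormedAddCommGroup E] [NormedSpace ℝ E] {f : ℂ → E},
      ContDiffOn ℝ 1 f (Metric.ball (0 : ℂ) r) →
      ∀ w ∈ leftHalfPlane (Real.log ρ), DifferentiableAt ℝ f (cexp w) := fun hf w hw =>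
    (hf.contDiffAt (Metric.isOpen_ball.mem_nhds (hmemr w hw))).differentiableAt one_ne_zero
  have smooth_conj : ∀ κ : ℂ, ContDiff ℝ 1 fun w =>
      ContinuousLinearMap.mul ℝ ℂ (κ * (starRingEnd ℂ) (cexp w)) := fun κ =>
    (ContinuousLinearMap.mul ℝ ℂ).contDiff.comp
      (contDiff_const.mul (Complex.conjCLE.contDiff.comp hexp))
  have smooth_neg : ContDiff ℝ 1 fun w => ContinuousLinearMap.mul ℝ ℂ (cexp (-w)) :=
    (ContinuousLinearMap.mul ℝ ℂ).contDiff.comp (hexp.comp contDiff_neg)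
  have norm_conj : ∀ κ w : ℂ, ‖ContinuousLinearMap.mul ℝ ℂ (κ * (starRingEnd ℂ) (cexp w))‖
      ≤ ‖κ‖ * Real.exp w.re := fun κ w =>
    (ContinuousLinearMap.opNorm_mul_apply_le _ _ _).trans_eq (by simp [Complex.norm_exp])
  have norm_neg : ∀ w : ℂ, ‖ContinuousLinearMap.mul ℝ ℂ (cexp (-w))‖ ≤ Real.exp (-w.re) := fun w =>
    (ContinuousLinearMap.opNorm_mul_apply_le _ _ _).trans_eq (by simp [Complex.norm_exp])
  have fderiv_conj : ∀ κ w : ℂ,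
      ‖fderiv ℝ (fun w => ContinuousLinearMap.mul ℝ ℂ (κ * (starRingEnd ℂ) (cexp w))) w‖
        ≤ ‖κ‖ * Real.exp w.re := fun κ w => by
    rw [← Complex.norm_exp]
    exact (norm_fderiv_mul_le ((contDiff_const.mul (Complex.conjCLE.contDiff.comp
      hexp)).differentiable one_ne_zero w)).trans (norm_fderiv_conj_exp_le κ w)
  have fderiv_neg : ∀ w : ℂ, ‖fderiv ℝ (fun w => ContinuousLinearMap.mul ℝ ℂ (cexp (-w))) w‖
      ≤ Real.exp (-w.re) := fun w => by
    rw [← Complex.neg_re, ← Complex.norm_exp]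
    exact (norm_fderiv_mul_le ((hexp.comp contDiff_neg).differentiable one_ne_zero w)).trans
      (norm_fderiv_exp_neg_le w)
  have bound_B : ∀ w ∈ leftHalfPlane (Real.log ρ), ‖B (cexp w)‖ ≤ KB * Real.exp w.re := by
    intro w hw
    have h := (hKB _ (hmem w hw)).2.2
    rwa [hB0, sub_zero, Complex.norm_exp] at h
  have bound_fderiv : ∀ {f : ℂ → (ℂ →L[ℝ] ℂ)} {K : ℝ},
      ContDiffOn ℝ 1 f (Metric.ball (0 : ℂ) r) →
      (∀ z ∈ Metric.ball (0 : ℂ) ρ, ‖fderiv ℝ f z‖ ≤ K) → ∀ w ∈ leftHalfPlane (Real.log ρ),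
      ‖fderiv ℝ (fun w => f (cexp w)) w‖ ≤ K * Real.exp w.re := by
    intro f K hf hK w hw
    refine (norm_fderiv_comp_exp_le (hdiff hf w hw)).trans ?_
    rw [Complex.norm_exp]
    exact mul_le_mul_of_nonneg_right (hK _ (hmem w hw)) (Real.exp_pos _).le
  have diff_on : ∀ {f : ℂ → (ℂ →L[ℝ] ℂ)}, ContDiffOn ℝ 1 f (leftHalfPlane (Real.log ρ)) →
      ∀ w ∈ leftHalfPlane (Real.log ρ), DifferentiableAt ℝ f w := fun hf w hw =>
    (hf.contDiffAt ((isOpen_leftHalfPlane _).mem_nhds hw)).differentiableAt one_ne_zero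
  have hBc := (smooth_conj 1).contDiffOn.clm_comp (smooth_comp hB)
  have bound_Bc : ∀ w ∈ leftHalfPlane (Real.log ρ),
      ‖(ContinuousLinearMap.mul ℝ ℂ (1 * (starRingEnd ℂ) (cexp w))).comp (B (cexp w))‖
        ≤ KB * Real.exp w.re * Real.exp w.re := by
    intro w hw
    have h := norm_conj 1 w
    rw [norm_one, one_mul (Real.exp _)] at h
    exact (ContinuousLinearMap.opNorm_comp_le _ _).trans
      (mul_le_of_bounds h (bound_B w hw) (norm_nonneg _) (Real.exp_pos _).le)
  have fderiv_Bc : ∀ w ∈ leftHalfPlane (Real.log ρ),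
      ‖fderiv ℝ (fun w => (ContinuousLinearMap.mul ℝ ℂ (1 * (starRingEnd ℂ) (cexp w))).comp
        (B (cexp w))) w‖ ≤ 2 * (KB * Real.exp w.re * Real.exp w.re) := by
    intro w hw
    have h1 := norm_conj 1 w
    have h2 := fderiv_conj 1 w
    rw [norm_one, one_mul (Real.exp _)] at h1 h2
    refine (norm_fderiv_clm_comp_le ((smooth_conj 1).differentiable one_ne_zero w)
      (diff_on (smooth_comp hB) w hw)).trans ?_
    have h3 := mul_le_of_bounds h1 (bound_fderiv hB (fun z hz => (hKB z hz).2.1) w hw)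
      (ContinuousLinearMap.opNorm_nonneg _) (Real.exp_pos _).le
    have h4 := mul_le_of_bounds h2 (bound_B w hw) (norm_nonneg _) (Real.exp_pos _).le
    linarith
  have exp_cancel : ∀ w : ℂ, Real.exp (-w.re) * Real.exp w.re = 1 := fun w => by
    rw [← Real.exp_add, neg_add_cancel, Real.exp_zero]
  refine ⟨Real.log ρ, 4 * KA + 3 * KB, Q,
    fun w => (ContinuousLinearMap.mul ℝ ℂ (2 * (starRingEnd ℂ) (cexp w))).comp (A (cexp w)),
    fun w => ((ContinuousLinearMap.mul ℝ ℂ (1 * (starRingEnd ℂ) (cexp w))).comp (B (cexp w))).comp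
      (ContinuousLinearMap.mul ℝ ℂ (cexp (-w))), ⟨by positivity, smooth_comp hu,
      (smooth_conj 2).contDiffOn.clm_comp (smooth_comp hA), hBc.clm_comp smooth_neg.contDiffOn,
      fun w => by simp only [Complex.exp_periodic w], fun w => ?_, fun w hw => ?_, fun w hw => ?_,
      fun w hw => ?_, fun w hw => ?_, fun w hw => ?_⟩, fun w hw => (hQ _ (hmem w hw)).1⟩
  · simp only [Complex.exp_periodic w, Complex.exp_neg]
  · have h1 := norm_conj 2 w
    rw [Complex.norm_ofNat] at h1
    refine (ContinuousLinearMap.opNorm_comp_le _ _).trans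
      ((mul_le_mul h1 (hKA _ (hmem w hw)).1 (norm_nonneg _) (by positivity)).trans ?_)
    have := mul_nonneg hKA0 (Real.exp_pos w.re).le
    have := mul_nonneg hKB0 (Real.exp_pos w.re).le
    linarith
  · refine (ContinuousLinearMap.opNorm_comp_le _ _).trans
      ((mul_le_mul (bound_Bc w hw) (norm_neg w) (norm_nonneg _) (by positivity)).trans ?_)
    rw [mul_assoc, mul_comm (Real.exp w.re) (Real.exp (-w.re)), exp_cancel, mul_one]
    have := mul_nonneg hKA0 (Real.exp_pos w.re).le
    have := mul_nonneg hKB0 (Real.exp_pos w.re).le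
    linarith
  · have h1 := norm_conj 2 w
    have h2 := fderiv_conj 2 w
    rw [Complex.norm_ofNat] at h1 h2
    refine (norm_fderiv_clm_comp_le ((smooth_conj 2).differentiable one_ne_zero w)
      (diff_on (smooth_comp hA) w hw)).trans ?_
    have h3 := mul_le_mul h1 (bound_fderiv hA (fun z hz => (hKA z hz).2.1) w hw)
      (ContinuousLinearMap.opNorm_nonneg _) (by positivity)
    have h4 := mul_le_mul (hKA _ (hmem w hw)).1 h2
      (ContinuousLinearMap.opNorm_nonneg _) hKA0
    have h5 := mul_nonneg hKA0 (Real.exp_pos w.re).le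
    have h6 := mul_nonneg hKB0 (Real.exp_pos w.re).le
    have h7 := mul_le_of_le_one_right h5 (hle1 w hw)
    linarith
  · refine (norm_fderiv_clm_comp_le (diff_on hBc w hw)
      (smooth_neg.differentiable one_ne_zero w)).trans ?_
    have h3 := mul_le_mul (bound_Bc w hw) (fderiv_neg w) (ContinuousLinearMap.opNorm_nonneg _)
      (by positivity)
    have h4 := mul_le_mul (norm_neg w) (fderiv_Bc w hw) (ContinuousLinearMap.opNorm_nonneg _)
      (Real.exp_pos _).le
    have h5 := mul_nonneg hKA0 (Real.exp_pos w.re).le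
    have h6 : KB * Real.exp w.re * Real.exp w.re * Real.exp (-w.re) = KB * Real.exp w.re := by
      rw [mul_assoc, mul_comm (Real.exp w.re) (Real.exp (-w.re)), exp_cancel, mul_one]
    linarith
  · exact cylinder_equation (hdiff hu w hw) (heq _ (hmemr w hw))

/-- A continuous inequality on a punctured neighbourhood extends to the centre. -/
theorem eventually_le_of_punctured {f g : ℂ → ℝ} {p : ℂ} (hf : ContinuousAt f p)
    (hg : ContinuousAt g p) (h : ∀ᶠ z in nhdsWithin p {p}ᶜ, f z ≤ g z) :
    ∀ᶠ z in nhds p, f z ≤ g z := by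
  have hp : f p ≤ g p := le_of_tendsto_of_tendsto (hf.tendsto.mono_left nhdsWithin_le_nhds)
    (hg.tendsto.mono_left nhdsWithin_le_nhds) h
  filter_upwards [eventually_nhdsWithin_iff.1 h] with z hz
  by_cases hzp : z = p
  · rwa [hzp]
  · exact hz hzp

theorem eventually_log_lt (b : ℝ) :
    ∀ᶠ z in nhdsWithin (0 : ℂ) {0}ᶜ, (Complex.log z).re < b ∧ cexp (Complex.log z) = z := by
  filter_upwards [nhdsWithin_le_nhds (Metric.ball_mem_nhds (0 : ℂ) (Real.exp_pos b)),
    self_mem_nhdsWithin] with z hz hz0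
  refine ⟨?_, Complex.exp_log hz0⟩
  rw [Complex.log_re, Real.log_lt_iff_lt_exp (norm_pos_iff.2 hz0)]
  exact mem_ball_zero_iff.1 hz

theorem eq_zero_of_segInt_eq_zero {a : ℝ} {f : ℂ → ℂ} (hf : ContDiffOn ℝ 1 f (leftHalfPlane a))
    (hper : ∀ w, f (w + 2 * Real.pi * I) = f w) {w : ℂ} (hw : w ∈ leftHalfPlane a)
    (h : segInt (fun w => ‖f w‖ ^ 2) w.re = 0) : f w = 0 := by
  by_contra hne
  set T := segInt (fun w => ‖fderiv ℝ f w I‖ ^ 2) w.re with hT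
  have hT0 : 0 ≤ T := segInt_nonneg fun _ _ => sq_nonneg _
  have hp : 0 < ‖f w‖ ^ 2 := by positivity
  have h1 := norm_sq_le_segInt hf hper (l := (T + 1) / ‖f w‖ ^ 2) (by positivity) hw
  rw [h, mul_zero, zero_add, zero_add, ← hT, inv_div, div_mul_eq_mul_div,
    le_div_iff₀ (by positivity)] at h1
  linarith

end SimilarityPrinciple

/-- **Similarity principle** (Section 2.E, after [Sik1, Prop. 2]): if `u` is `C¹` on a
disc and satisfies `∂u/∂z̄ = A(z)·u + B(z)·∂u/∂z` with `A, B` continuously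
differentiable and `B(0) = 0`, then either `u` vanishes identically near `0`, or
`u(z) = a·zᵐ + o(|z|ᵐ)` for some `a ≠ 0` and `m ∈ ℕ`. -/
theorem similarity_principle (r : ℝ) (hr : 0 < r) (u : ℂ → ℂ)
    (A B : ℂ → (ℂ →L[ℝ] ℂ))
    (hu : ContDiffOn ℝ 1 u (Metric.ball (0 : ℂ) r))
    (hA : ContDiffOn ℝ 1 A (Metric.ball (0 : ℂ) r))
    (hB : ContDiffOn ℝ 1 B (Metric.ball (0 : ℂ) r))
    (hB0 : B 0 = 0)
    (heq : ∀ z ∈ Metric.ball (0 : ℂ) r,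
      wirtingerDerivBar u z = A z (u z) + B z (wirtingerDeriv u z)) :
    (∀ᶠ z in nhds (0 : ℂ), u z = 0) ∨
      ∃ a : ℂ, a ≠ 0 ∧ ∃ m : ℕ,
        (fun z : ℂ => u z - a * z ^ m) =o[nhds (0 : ℂ)] fun z : ℂ => ‖z‖ ^ m := by
  obtain ⟨a, C, Q, F, L, H, hQ⟩ := exists_isCylinderSolution hr hu hA hB hB0 heq
  have hcont : ContinuousAt u 0 := hu.continuousOn.continuousAt (Metric.ball_mem_nhds _ hr)
  obtain ⟨a₁, ha₁, hC⟩ := exists_mul_exp_le (C := C) a (by norm_num : (0 : ℝ) < 1 / 100)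
  obtain ⟨a₂, ha₂, K, f, e, ρ, hS⟩ := (H.mono ha₁).exists_isSymmetrizedSolution
  by_cases hzero : ∀ s < a₂, segInt (fun w => ‖u (cexp w)‖ ^ 2) s ≤ 0
  · left
    have h := eventually_le_of_punctured hcont.norm (continuousAt_const (y := (0 : ℝ))) <| by
      filter_upwards [eventually_log_lt a₂] with z hz
      have h0 : segInt (fun w => ‖u (cexp w)‖ ^ 2) (Complex.log z).re = 0 :=
        le_antisymm (hzero _ hz.1) (segInt_nonneg fun _ _ => sq_nonneg _)
      have h1 := eq_zero_of_segInt_eq_zero hS.smooth H.periodic (mem_leftHalfPlane.2 hz.1) h0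
      simp only [hz.2] at h1
      rw [h1, norm_zero]
    exact h.mono fun z hz => norm_le_zero_iff.1 hz
  · right
    push Not at hzero
    obtain ⟨s₁, hs₁, hpos⟩ := hzero
    obtain ⟨δ, hδ, c, hlow⟩ := hS.exists_exp_le hs₁ hpos
    obtain ⟨m, α, hα, b, hb, K, hK⟩ := (H.mono ha₁).exists_leading_mode hC.le
      (fun w hw => hQ w (leftHalfPlane_mono ha₁ hw)) hδ hlow
    have hCb : C * Real.exp b ≤ 1 / 100 :=
      (mul_le_mul_of_nonneg_left (Real.exp_le_exp.2 hb) H.nonneg).trans hC.le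
    obtain ⟨K', hK'0, hK'⟩ := ((H.mono ha₁).mono hb).exists_norm_sub_mode_le hCb (abs_nonneg K)
      fun s hs => (hK s hs).trans (by
        push_cast
        exact mul_le_mul_of_nonneg_right (le_abs_self K) (Real.exp_pos _).le)
    refine ⟨α, hα, m, isLittleO_iff.2 fun ε hε => ?_⟩
    obtain ⟨t, ht, htε⟩ := exists_mul_exp_le (C := K') ((b - 1) / 2) (pow_pos hε 2)
    refine eventually_le_of_punctured
      (hcont.sub (by fun_prop : Continuous fun z : ℂ => α * z ^ m).continuousAt).norm
      (by fun_prop : Continuous fun z : ℂ => ε * ‖‖z‖ ^ m‖).continuousAt ?_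
    filter_upwards [eventually_log_lt (2 * t), self_mem_nhdsWithin] with z hz hz0
    have h1 := hK' (Complex.log z) (mem_leftHalfPlane.2 (by linarith [hz.1]))
    have hpow : cexp ((m : ℤ) * Complex.log z) = z ^ m := by
      rw [Int.cast_natCast, Complex.exp_nat_mul, hz.2]
    have hnorm : Real.exp ((2 * (m : ℤ) + 1 / 2) * (Complex.log z).re)
        = (‖z‖ ^ m) ^ 2 * Real.exp (1 / 2 * (Complex.log z).re) := by
      conv_rhs => rw [← hz.2, Complex.norm_exp]
      rw [← Real.exp_nat_mul, ← Real.exp_nat_mul, ← Real.exp_add, hz.2]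
      congr 1
      push_cast
      ring
    rw [hpow, hz.2, hnorm] at h1
    have h2 : K' * Real.exp (1 / 2 * (Complex.log z).re) ≤ ε ^ 2 :=
      (mul_le_mul_of_nonneg_left (Real.exp_le_exp.2 (by linarith [hz.1])) hK'0).trans htε.le
    have h3 := mul_le_mul_of_nonneg_left h2 (sq_nonneg (‖z‖ ^ m))
    rw [norm_pow, norm_norm]
    refine abs_le_of_sq_le_sq' ?_ (by positivity) |>.2
    rw [mul_pow]
    linarith
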